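/- arXiv:2109.09370 — 4 statements merged into one kernel-verified Lean document; each statement's English description precedes it below -/
import Mathlib

section
/- Fix l ≥ 2 and let {k_n} be any sequence with 1 ≤ k_n ≤ n-l+1. Then lim_{n→∞} |A^{(n)}_{l;k_n} ∩ S_n^sep| / |S_n^sep| = (3 - 2√2)^{l-1} · |S_l^sep|. In particular, for l = 3 the limit equals 6(3 - 2√2)^2 and for l = 4 the limit equals 22(3 - 2√2)^3. -/
open Filter

def Contains {n m : ℕ} (σ : Fin n → Fin n) (τ : Fin m → Fin m) : Prop :=
  ∃ f : Fin m → Fin n, StrictMono f ∧ ∀ j k : Fin m, σ (f j) < σ (f k) ↔ τ j < τ k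

def Avoids {n m : ℕ} (σ : Fin n → Fin n) (τ : Fin m → Fin m) : Prop :=
  ¬ Contains σ τ

def AvoidSet (n : ℕ) {m : ℕ} (τ : Equiv.Perm (Fin m)) : Set (Equiv.Perm (Fin n)) :=
  {σ : Equiv.Perm (Fin n) | Avoids ⇑σ ⇑τ}

def ClusterAt {n : ℕ} (l k a : ℕ) (σ : Equiv.Perm (Fin n)) : Prop :=
  (Finset.univ.filter fun i : Fin n => a ≤ (i : ℕ) + 1 ∧ (i : ℕ) + 1 < a + l).image
      (fun i => (σ i : ℕ) + 1) = Finset.Ico k (k + l)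

def ClusterEvent (n l k : ℕ) : Set (Equiv.Perm (Fin n)) :=
  {σ : Equiv.Perm (Fin n) | ∃ a : ℕ, 1 ≤ a ∧ a ≤ n - l + 1 ∧ ClusterAt l k a σ}

def ClusterFree {m : ℕ} (τ : Equiv.Perm (Fin m)) : Prop :=
  ∀ l a k : ℕ, 2 ≤ l → l ≤ m - 1 → 1 ≤ a → a + l ≤ m + 1 → ¬ ClusterAt l k a τ

def ContainsTightly12 {m : ℕ} (τ : Equiv.Perm (Fin m)) : Prop :=
  ∃ i j : Fin m, (j : ℕ) = (i : ℕ) + 1 ∧ (τ j : ℕ) = (τ i : ℕ) + 1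

def ContainsTightly21 {m : ℕ} (τ : Equiv.Perm (Fin m)) : Prop :=
  ∃ i j : Fin m, (j : ℕ) = (i : ℕ) + 1 ∧ (τ i : ℕ) = (τ j : ℕ) + 1

def perm123 : Equiv.Perm (Fin 3) := Equiv.refl (Fin 3)

def perm321 : Equiv.Perm (Fin 3) :=
  ⟨![2, 1, 0], ![2, 1, 0], by intro x; fin_cases x <;> rfl, by intro x; fin_cases x <;> rfl⟩

def p2413 : Equiv.Perm (Fin 4) :=
  ⟨![1, 3, 0, 2], ![2, 0, 3, 1], by intro x; fin_cases x <;> rfl, by intro x; fin_cases x <;> rfl⟩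

def p3142 : Equiv.Perm (Fin 4) :=
  ⟨![2, 0, 3, 1], ![1, 3, 0, 2], by intro x; fin_cases x <;> rfl, by intro x; fin_cases x <;> rfl⟩

def SepSet (n : ℕ) : Set (Equiv.Perm (Fin n)) :=
  {σ : Equiv.Perm (Fin n) | Avoids ⇑σ ⇑p2413 ∧ Avoids ⇑σ ⇑p3142}

namespace SepProof

open PowerSeries in
lemma rec3 (t : ℕ → ℤ) (h0 : t 0 = 1)
    (h : ∀ n, t (n+1) = t n + ∑ p ∈ Finset.HasAntidiagonal.antidiagonal n, t p.1 * t p.2) (n : ℕ) :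
    ((n:ℤ) + 4) * t (n+3) = (6 * n + 15) * t (n+2) - (n+1) * t (n+1) := by
  set G : PowerSeries ℤ := PowerSeries.mk t with hG
  have hc : ∀ n, coeff n G = t n := fun n => by simp [hG]
  have e1 : G = 1 + X * G + X * (G * G) := by
    ext n
    cases n with
    | zero => simp [hc, h0, hG]
    | succ n =>
      simp only [map_add, coeff_succ_X_mul]
      rw [coeff_mul]
      simp only [hc, h]
      simp [coeff_one]
  have e2 : d⁄dX ℤ G = G + X * d⁄dX ℤ G + (G * G + X * (2 * G * d⁄dX ℤ G)) := by
    have := congrArg (d⁄dX ℤ) e1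
    simp only [map_add, Derivation.leibniz, derivative_X, derivative_one, smul_eq_mul] at this
    linear_combination this
  set G' := d⁄dX ℤ G with hG'
  have e3 : X * (X * (X * G')) - 6 * (X * (X * G')) + X * G' = 3 * (X * G) - G + 1 + X := by
    linear_combination (X * (2 * X * G + X - 1)) * (-1) * e2 + (4 * X * X * G' + (2 * X * G + X - 1) + 2) * e1
  have := congrArg (coeff (n+3)) e3
  have h6 : (6 : PowerSeries ℤ) = C 6 := by simp
  have h3 : (3 : PowerSeries ℤ) = C 3 := by simp
  rw [h6, h3] at this
  simp only [map_add, map_sub, coeff_succ_X_mul, coeff_C_mul, hc, hG', coeff_derivative] at this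
  simp [coeff_one, coeff_X] at this
  linear_combination this

lemma ratio (t : ℕ → ℝ) (hpos : ∀ n, 0 < t n) (hge : ∀ n, t n ≤ t (n+1)) (h0 : t 0 = 1) (h1 : t 1 = 2)
    (h2 : t 2 = 6)
    (h : ∀ n : ℕ, ((n:ℝ) + 4) * t (n+3) = (6 * n + 15) * t (n+2) - (n+1) * t (n+1)) (n : ℕ) :
    |t (n+1) / t n - (3 + 2 * Real.sqrt 2)| ≤ 30 / ((n:ℝ) + 1) := by
  have hs : Real.sqrt 2 * Real.sqrt 2 = 2 := Real.mul_self_sqrt (by norm_num)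
  have hs1 : 1 ≤ Real.sqrt 2 := by rw [Real.one_le_sqrt]; norm_num
  have hs2 : Real.sqrt 2 ≤ 2 := by nlinarith
  set ρ := 3 + 2 * Real.sqrt 2 with hρ
  have hρ2 : ρ * ρ = 6 * ρ - 1 := by rw [hρ]; nlinarith
  have hρ5 : 5 ≤ ρ := by linarith
  have hρ7 : ρ ≤ 7 := by linarith
  have h' : ∀ n : ℕ, ((n:ℝ) + 3) * t (n+2) = (6 * n + 9) * t (n+1) - n * t n := by
    intro n
    cases n with
    | zero => simp [h1, h2]; norm_num
    | succ n => have := h n; push_cast; linear_combination this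
  induction n with
  | zero =>
    simp only [h0, h1, zero_add, Nat.cast_zero]
    rw [abs_le]; constructor <;> linarith
  | succ n ih =>
    set r := t (n+1) / t n with hr
    have hr1 : 1 ≤ r := by rw [hr, one_le_div (hpos n)]; exact hge n
    have hrpos : 0 < r := by linarith
    have htn : t n ≠ 0 := (hpos n).ne'
    have htn1 : t (n+1) ≠ 0 := (hpos (n+1)).ne'
    have hn3 : (0:ℝ) < n + 3 := by positivity
    have hn0 : (0:ℝ) ≤ n := by positivity
    have e : t (n+1+1) / t (n+1) - ρ = (r - ρ) / (r * ρ) + (-9 + 3 / r) / (n+3) := by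
      have : t (n+2) = ((6 * n + 9) * t (n+1) - n * t n) / (n+3) := by
        rw [eq_div_iff hn3.ne']; linarith [h' n]
      have e5 : t (n+1+1) / t (n+1) = ((6 * n + 9) - n / r) / (n+3) := by
        change t (n+2) / t (n+1) = _
        rw [this, hr]; field_simp
      rw [e5]
      field_simp
      linear_combination (-(r * (n+3) )) * hρ2
    rw [e]
    have b1 : |(r - ρ) / (r * ρ)| ≤ (30 / ((n:ℝ)+1)) / 5 := by
      rw [abs_div, abs_of_pos (show 0 < r * ρ by positivity)]
      have : 5 ≤ r * ρ := by nlinarith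
      apply div_le_div₀ (by positivity) ih (by norm_num) this
    have b2 : |(-9 + 3 / r) / ((n:ℝ)+3)| ≤ 9 / ((n:ℝ)+3) := by
      rw [abs_div, abs_of_pos hn3]
      have : 0 ≤ 3 / r := by positivity
      have : 3 / r ≤ 3 := by rw [div_le_iff₀ hrpos]; linarith
      gcongr
      rw [abs_le]; constructor <;> linarith
    refine (abs_add_le _ _).trans ((add_le_add b1 b2).trans ?_)
    push_cast
    rw [div_div, div_add_div _ _ (by positivity) (by positivity), div_le_div_iff₀ (by positivity) (by positivity)]
    nlinarith [mul_nonneg hn0 hn0, mul_nonneg hn0 (mul_nonneg hn0 hn0)]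

lemma ratio_lim (t : ℕ → ℕ) (h0 : t 0 = 1)
    (h : ∀ n, t (n+1) = t n + ∑ p ∈ Finset.HasAntidiagonal.antidiagonal n, t p.1 * t p.2) :
    (∀ n, 0 < t n) ∧
    Tendsto (fun n => (t n : ℝ) / t (n+1)) atTop (nhds (3 - 2 * Real.sqrt 2)) := by
  have hpos : ∀ n, 0 < t n := by
    intro n
    induction n with
    | zero => simp [h0]
    | succ n ih => rw [h]; omega
  refine ⟨hpos, ?_⟩
  have h1 : t 1 = 2 := by rw [h]; simp [h0]
  have h2 : t 2 = 6 := by rw [h]; simp [h0, h1, Finset.Nat.antidiagonal_succ]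
  have hr := rec3 (fun n => (t n : ℤ)) (by simp [h0]) (by intro n; simp only [h n]; push_cast; rfl)
  have := ratio (fun n => (t n : ℝ)) (by intro n; exact_mod_cast hpos n)
    (by intro n; have : t n ≤ t (n+1) := by { rw [h]; omega }
        exact_mod_cast this) (by simp [h0]) (by simp [h1]) (by simp [h2])
    (by intro n; exact_mod_cast hr n)
  have l0 : Tendsto (fun n : ℕ => 30 / ((n:ℝ) + 1)) atTop (nhds 0) := by
    have := (tendsto_one_div_add_atTop_nhds_zero_nat (𝕜 := ℝ)).const_mul 30
    simpa [div_eq_mul_inv] using this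
  have l1 : Tendsto (fun n => (t (n+1) : ℝ) / t n) atTop (nhds (3 + 2 * Real.sqrt 2)) := by
    rw [tendsto_iff_dist_tendsto_zero]
    exact squeeze_zero (fun _ => dist_nonneg) (fun n => by rw [Real.dist_eq]; exact this n) l0
  have hs : Real.sqrt 2 * Real.sqrt 2 = 2 := Real.mul_self_sqrt (by norm_num)
  have l2 := l1.inv₀ (by positivity)
  have e : (3 + 2 * Real.sqrt 2)⁻¹ = 3 - 2 * Real.sqrt 2 := by
    rw [inv_eq_iff_eq_inv, eq_comm, inv_eq_of_mul_eq_one_left]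
    linear_combination (-4) * hs
  rw [e] at l2
  refine l2.congr ?_
  intro n; simp

lemma ratio_lim_pow (t : ℕ → ℕ) (h0 : t 0 = 1)
    (h : ∀ n, t (n+1) = t n + ∑ p ∈ Finset.HasAntidiagonal.antidiagonal n, t p.1 * t p.2) (j : ℕ) :
    Tendsto (fun n => (t n : ℝ) / t (n+j)) atTop (nhds ((3 - 2 * Real.sqrt 2) ^ j)) := by
  obtain ⟨hpos, hl⟩ := ratio_lim t h0 h
  have hne : ∀ n, (t n : ℝ) ≠ 0 := fun n => by exact_mod_cast (hpos n).ne'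
  induction j with
  | zero => simpa [hne] using tendsto_const_nhds
  | succ j ih =>
    have := ih.mul ((tendsto_add_atTop_iff_nat j).2 hl)
    rw [pow_succ]
    refine this.congr ?_
    intro n
    have a := hne (n+j)
    have b := hne (n+j+1)
    rw [← add_assoc]
    field_simp

def Sp {n : ℕ} (σ : Equiv.Perm (Fin n)) : Prop :=
  ∀ a b c d : Fin n, a < b → b < c → c < d →
    ¬ (σ c < σ a ∧ σ a < σ d ∧ σ d < σ b) ∧ ¬ (σ b < σ d ∧ σ d < σ a ∧ σ a < σ c)

lemma mem_sep {n : ℕ} (σ : Equiv.Perm (Fin n)) : σ ∈ SepSet n ↔ Sp σ := by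
  constructor
  · rintro ⟨h1, h2⟩ a b c d hab hbc hcd
    have hm : StrictMono (![a, b, c, d]) := by
      rw [Fin.strictMono_iff_lt_succ]
      intro i; fin_cases i
      · exact hab
      · exact hbc
      · exact hcd
    constructor
    · rintro ⟨u, v, w⟩
      refine h1 ⟨![a, b, c, d], hm, ?_⟩
      intro j k
      fin_cases j <;> fin_cases k <;> simp [p2413] <;> first | order | skip
    · rintro ⟨u, v, w⟩
      refine h2 ⟨![a, b, c, d], hm, ?_⟩
      intro j k
      fin_cases j <;> fin_cases k <;> simp [p3142] <;> first | order | skip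
  · intro h
    constructor
    · rintro ⟨f, hm, hf⟩
      refine (h (f 0) (f 1) (f 2) (f 3) (hm (by decide)) (hm (by decide)) (hm (by decide))).1 ⟨?_, ?_, ?_⟩
      · rw [hf]; decide
      · rw [hf]; decide
      · rw [hf]; decide
    · rintro ⟨f, hm, hf⟩
      refine (h (f 0) (f 1) (f 2) (f 3) (hm (by decide)) (hm (by decide)) (hm (by decide))).2 ⟨?_, ?_, ?_⟩
      · rw [hf]; decide
      · rw [hf]; decide
      · rw [hf]; decide

def UpCut (f : ℕ → ℤ) (a c b : ℕ) : Prop := ∀ i j, a ≤ i → i < c → c ≤ j → j < b → f i < f j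

def Av (f : ℕ → ℤ) (a b : ℕ) : Prop := ∀ p q r s, a ≤ p → p < q → q < r → r < s → s < b →
    ¬ (f r < f p ∧ f p < f s ∧ f s < f q) ∧ ¬ (f q < f s ∧ f s < f p ∧ f p < f r)

def Ij (f : ℕ → ℤ) (a b : ℕ) : Prop := ∀ p q, a ≤ p → p < q → q < b → f p ≠ f q

def HasCut (f : ℕ → ℤ) (a b : ℕ) : Prop :=
  ∃ c, a < c ∧ c < b ∧ (UpCut f a c b ∨ UpCut (fun i => - f i) a c b)

lemma step (f : ℕ → ℤ) (a b : ℕ) (hi : Ij f a (b+1)) (hav : Av f a (b+1))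
    (ih : ∀ c, a + 2 ≤ c → c < b → HasCut f a c)
    (h : ∃ c, a < c ∧ c < b ∧ UpCut f a c b) : HasCut f a (b+1) := by
  classical
  let c := Nat.find h
  obtain ⟨hc1, hc2, hc3⟩ := Nat.find_spec h
  have hmin : ∀ d, d < c → ¬ (a < d ∧ d < b ∧ UpCut f a d b) := fun d hd => Nat.find_min h hd
  change a < c at hc1
  change c < b at hc2
  change UpCut f a c b at hc3
  clear_value c
  by_cases h1 : ∀ i, a ≤ i → i < c → f i < f b
  · refine ⟨c, hc1, by omega, Or.inl ?_⟩
    intro i j u v w x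
    by_cases hj : j = b
    · subst hj; exact h1 i u v
    · exact hc3 i j u v w (by omega)
  push Not at h1
  obtain ⟨e, he1, he2, he3⟩ := h1
  have he3 : f b < f e := lt_of_le_of_ne he3 (hi e b he1 (by omega) (by omega)).symm
  by_cases h2 : ∀ i, a ≤ i → i < c → f b < f i
  · refine ⟨b, by omega, by omega, Or.inr ?_⟩
    intro i j u v w x
    have : j = b := by omega
    subst this
    show - f i < - f j
    by_cases hic : i < c
    · have := h2 i u hic; omega
    · have := hc3 e i he1 he2 (by omega) v; omega
  push Not at h2
  obtain ⟨d, hd1, hd2, hd3⟩ := h2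
  have hd3 : f d < f b := lt_of_le_of_ne hd3 (hi d b hd1 (by omega) (by omega))
  have hed : e ≠ d := by rintro rfl; omega
  obtain ⟨g, hg1, hg2, hg⟩ := ih c (by omega) hc2
  rcases hg with hg | hg
  · exfalso
    refine hmin g hg2 ⟨hg1, by omega, ?_⟩
    intro i j u v w x
    by_cases hj : j < c
    · exact hg i j u v w hj
    · exact hc3 i j u (by omega) (by omega) x
  · exfalso
    simp only [UpCut] at hg
    have hE : ∃ e', a ≤ e' ∧ e' < g ∧ f b < f e' := by
      by_cases hh : e < g
      · exact ⟨e, he1, hh, he3⟩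
      · refine ⟨a, le_rfl, hg1, ?_⟩
        have := hg a e le_rfl hg1 (by omega) he2; omega
    have hD : ∃ d', g ≤ d' ∧ d' < c ∧ f d' < f b := by
      by_cases hh : g ≤ d
      · exact ⟨d, hh, hd2, hd3⟩
      · refine ⟨g, le_rfl, hg2, ?_⟩
        have := hg d g hd1 (by omega) le_rfl hg2; omega
    obtain ⟨e', e1, e2, e3⟩ := hE
    obtain ⟨d', d1, d2, d3⟩ := hD
    have := (hav e' d' c b e1 (by omega) (by omega) hc2 (by omega)).2
    apply this
    refine ⟨d3, e3, hc3 e' c e1 (by omega) le_rfl hc2⟩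

lemma struct (f : ℕ → ℤ) (a b : ℕ) (hab : a + 2 ≤ b) (hi : Ij f a b) (hav : Av f a b) :
    HasCut f a b := by
  induction b using Nat.strong_induction_on with
  | _ b IH =>
  obtain ⟨b, rfl⟩ : ∃ b', b = b' + 1 := ⟨b - 1, by omega⟩
  have ih : ∀ c, a + 2 ≤ c → c < b + 1 → HasCut f a c := by
    intro c h1 h2
    exact IH c h2 h1 (fun p q u v w => hi p q u v (by omega))
      (fun p q r s u v w x y => hav p q r s u v w x (by omega))
  by_cases hb : b = a + 1
  · subst hb
    refine ⟨a+1, by omega, by omega, ?_⟩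
    rcases lt_or_gt_of_ne (hi a (a+1) le_rfl (by omega) (by omega)) with h | h
    · left; intro i j _ _ _ _
      obtain rfl : i = a := by omega
      obtain rfl : j = i + 1 := by omega
      exact h
    · right; intro i j _ _ _ _
      obtain rfl : i = a := by omega
      obtain rfl : j = i + 1 := by omega
      show - f i < - f (i+1)
      omega
  obtain ⟨c, h1, h2, h3 | h3⟩ := ih b (by omega) (by omega)
  · exact step f a b hi hav (fun c u v => ih c u (by omega)) ⟨c, h1, h2, h3⟩
  · have := step (fun i => - f i) a b (fun p q u v w => by have := hi p q u v w; simpa using this)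
      (fun p q r s u v w x y => by
        have := hav p q r s u v w x y
        simp only [neg_lt_neg_iff]
        exact ⟨fun h => this.2 ⟨h.2.2, h.2.1, h.1⟩, fun h => this.1 ⟨h.2.2, h.2.1, h.1⟩⟩)
      (fun c u v => by
        obtain ⟨g, g1, g2, g3⟩ := ih c u (by omega)
        refine ⟨g, g1, g2, ?_⟩
        simpa [or_comm] using g3) ⟨c, h1, h2, h3⟩
    obtain ⟨g, g1, g2, g3⟩ := this
    refine ⟨g, g1, g2, ?_⟩
    simpa [or_comm] using g3

def Cut {n : ℕ} (σ : Equiv.Perm (Fin n)) (c : ℕ) : Prop :=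
  ∀ i j : Fin n, (i : ℕ) < c → c ≤ (j : ℕ) → σ i < σ j

def Dec {n : ℕ} (σ : Equiv.Perm (Fin n)) : Prop := ∃ c, 0 < c ∧ c < n ∧ Cut σ c

def Ps {c m : ℕ} (α : Equiv.Perm (Fin c)) (β : Equiv.Perm (Fin m)) : Equiv.Perm (Fin (c + m)) :=
  finSumFinEquiv.permCongr (Equiv.sumCongr α β)

lemma Ps_left {c m : ℕ} (α : Equiv.Perm (Fin c)) (β : Equiv.Perm (Fin m)) (i : Fin c) :
    Ps α β (Fin.castAdd m i) = Fin.castAdd m (α i) := by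
  simp [Ps, Equiv.permCongr_apply]

lemma Ps_right {c m : ℕ} (α : Equiv.Perm (Fin c)) (β : Equiv.Perm (Fin m)) (i : Fin m) :
    Ps α β (Fin.natAdd c i) = Fin.natAdd c (β i) := by
  simp [Ps, Equiv.permCongr_apply]

lemma Ps_inj {c m : ℕ} (α α' : Equiv.Perm (Fin c)) (β β' : Equiv.Perm (Fin m))
    (h : Ps α β = Ps α' β') : α = α' ∧ β = β' := by
  constructor
  · ext i
    have := congrArg (fun e => ((e (Fin.castAdd m i) : Fin (c+m)) : ℕ)) h
    simpa [Ps_left] using this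
  · ext i
    have := congrArg (fun e => ((e (Fin.natAdd c i) : Fin (c+m)) : ℕ)) h
    simpa [Ps_right] using this

lemma Ps_cut {c m : ℕ} (α : Equiv.Perm (Fin c)) (β : Equiv.Perm (Fin m)) : Cut (Ps α β) c := by
  intro i j
  refine Fin.addCases (fun i => ?_) (fun i => ?_) i
  · refine Fin.addCases (fun j => ?_) (fun j => ?_) j
    · intro h1 h2; have := j.2; simp at h2; omega
    · intro h1 h2; rw [Ps_left, Ps_right, Fin.lt_def]; have := (α i).2; simp; omega
  · intro h; simp at h

lemma Ps_cut_lt {c m : ℕ} (α : Equiv.Perm (Fin c)) (β : Equiv.Perm (Fin m)) (c' : ℕ) (h : c' < c) :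
    Cut (Ps α β) c' ↔ Cut α c' := by
  constructor
  · intro H i j hi hj
    have := H (Fin.castAdd m i) (Fin.castAdd m j) (by simpa using hi) (by simpa using hj)
    rw [Ps_left, Ps_left] at this
    exact this
  · intro H i j
    refine Fin.addCases (fun i => ?_) (fun i => ?_) i
    · refine Fin.addCases (fun j => ?_) (fun j => ?_) j
      · intro h1 h2
        have := H i j (by simpa using h1) (by simpa using h2)
        rw [Ps_left, Ps_left]
        exact this
      · intro h1 h2; rw [Ps_left, Ps_right, Fin.lt_def]; have := (α i).2; simp; omega
    · intro h; simp at h; omega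

lemma Ps_sp {c m : ℕ} (α : Equiv.Perm (Fin c)) (β : Equiv.Perm (Fin m)) :
    Sp (Ps α β) ↔ Sp α ∧ Sp β := by
  constructor
  · intro h
    constructor
    · intro p q r s h1 h2 h3
      have := h (Fin.castAdd m p) (Fin.castAdd m q) (Fin.castAdd m r) (Fin.castAdd m s) h1 h2 h3
      simp only [Ps_left] at this
      exact this
    · intro p q r s h1 h2 h3
      have := h (Fin.natAdd c p) (Fin.natAdd c q) (Fin.natAdd c r) (Fin.natAdd c s)
        (by simpa using h1) (by simpa using h2) (by simpa using h3)
      simpa only [Ps_right, Fin.natAdd_lt_natAdd_iff] using this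
  · rintro ⟨h1, h2⟩ p q r s
    refine Fin.addCases (fun p => ?_) (fun p => ?_) p <;>
    refine Fin.addCases (fun q => ?_) (fun q => ?_) q <;>
    refine Fin.addCases (fun r => ?_) (fun r => ?_) r <;>
    refine Fin.addCases (fun s => ?_) (fun s => ?_) s <;>
    intro a1 a2 a3 <;>
    simp only [Ps_left, Ps_right] <;>
    simp only [Fin.lt_def, Fin.val_castAdd, Fin.val_natAdd] at a1 a2 a3 ⊢ <;>
    first
    | exact h1 p q r s a1 a2 a3
    | (have := h2 p q r s (Fin.lt_def.2 (by omega)) (Fin.lt_def.2 (by omega)) (Fin.lt_def.2 (by omega))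
       simpa only [Fin.lt_def, Nat.add_lt_add_iff_left] using this)
    | (have x1 := p.2; have x2 := q.2; have x3 := r.2; have x4 := s.2
       omega)
    | skip

lemma cut_maps {c m : ℕ} (σ : Equiv.Perm (Fin (c + m))) (h : Cut σ c) (i : Fin (c+m)) (hi : (i:ℕ) < c) :
    (σ i : ℕ) < c := by
  have hsub : (Finset.univ.map (Fin.natAddEmb c : Fin m ↪ Fin (c+m))).map σ.toEmbedding ⊆ Finset.Ioi (σ i) := by
    intro x hx
    simp only [Finset.mem_map, Finset.mem_univ, true_and, Finset.mem_Ioi] at hx ⊢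
    obtain ⟨y, ⟨z, rfl⟩, rfl⟩ := hx
    exact h i _ hi (by simp)
  have := Finset.card_le_card hsub
  simp at this
  have := (σ i).2
  omega

lemma cut_ex {c m : ℕ} (σ : Equiv.Perm (Fin (c + m))) (h : Cut σ c) :
    ∃ α β, Ps α β = σ := by
  have := Equiv.Perm.mem_sumCongrHom_range_of_perm_mapsTo_inl
    (σ := (finSumFinEquiv (m := c) (n := m)).symm.permCongr σ) ?_
  · obtain ⟨⟨α, β⟩, hh⟩ := this
    refine ⟨α, β, ?_⟩
    have h2 : Equiv.sumCongr α β = (finSumFinEquiv (m := c) (n := m)).symm.permCongr σ := hh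
    rw [Ps, h2]
    ext x; simp [Equiv.permCongr_apply]
  · rintro _ ⟨i, rfl⟩
    have := cut_maps σ h (Fin.castAdd m i) (by simp)
    refine ⟨⟨_, this⟩, ?_⟩
    simp only [Equiv.permCongr_apply, Equiv.symm_symm, finSumFinEquiv_apply_left]
    rw [Equiv.eq_symm_apply]
    ext
    simp

open Classical in
noncomputable def sF (n : ℕ) : Finset (Equiv.Perm (Fin n)) := Finset.univ.filter Sp
open Classical in
noncomputable def pF (n : ℕ) : Finset (Equiv.Perm (Fin n)) :=
  Finset.univ.filter fun σ => Sp σ ∧ ¬ Dec σ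
open Classical in
noncomputable def dF (n : ℕ) : Finset (Equiv.Perm (Fin n)) :=
  Finset.univ.filter fun σ => Sp σ ∧ Dec σ
open Classical in
noncomputable def cF (n c : ℕ) : Finset (Equiv.Perm (Fin n)) :=
  Finset.univ.filter fun σ => Sp σ ∧ Cut σ c ∧ ∀ c', 0 < c' → c' < c → ¬ Cut σ c'

lemma ncard_sep (n : ℕ) : (SepSet n).ncard = (sF n).card := by
  rw [← Set.ncard_coe_finset]
  congr 1
  ext σ
  simp [sF, mem_sep]

lemma s_eq (n : ℕ) : (sF n).card = (dF n).card + (pF n).card := by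
  classical
  rw [← Finset.card_union_of_disjoint]
  · congr 1
    ext σ
    simp only [sF, dF, pF, Finset.mem_filter, Finset.mem_union, Finset.mem_univ, true_and]
    by_cases h : Dec σ <;> simp [h]
  · rw [Finset.disjoint_left]
    intro σ
    simp only [dF, pF, Finset.mem_filter, Finset.mem_univ, true_and]
    tauto

lemma cF_card (c m : ℕ) : (cF (c + m) c).card = (pF c).card * (sF m).card := by
  classical
  rw [← Finset.card_product]
  symm
  refine Finset.card_bij (fun x _ => Ps x.1 x.2) ?_ ?_ ?_
  · rintro ⟨α, β⟩ h
    simp only [pF, sF, cF, Finset.mem_product, Finset.mem_filter, Finset.mem_univ, true_and] at h ⊢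
    refine ⟨(Ps_sp α β).2 ⟨h.1.1, h.2⟩, Ps_cut α β, ?_⟩
    intro c' h1 h2 h3
    exact h.1.2 ⟨c', h1, h2, (Ps_cut_lt α β c' h2).1 h3⟩
  · rintro ⟨α, β⟩ _ ⟨α', β'⟩ _ h
    obtain ⟨rfl, rfl⟩ := Ps_inj _ _ _ _ h
    rfl
  · intro σ h
    simp only [cF, Finset.mem_filter, Finset.mem_univ, true_and] at h
    obtain ⟨α, β, rfl⟩ := cut_ex σ h.2.1
    refine ⟨(α, β), ?_, rfl⟩
    have := (Ps_sp α β).1 h.1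
    simp only [pF, sF, Finset.mem_product, Finset.mem_filter, Finset.mem_univ, true_and]
    refine ⟨⟨this.1, ?_⟩, this.2⟩
    rintro ⟨c', h1, h2, h3⟩
    exact h.2.2 c' h1 h2 ((Ps_cut_lt α β c' h2).2 h3)

lemma d_eq (n : ℕ) : (dF n).card = ∑ c ∈ Finset.Ioo 0 n, (pF c).card * (sF (n - c)).card := by
  classical
  have : dF n = (Finset.Ioo 0 n).biUnion (cF n) := by
    ext σ
    simp only [dF, cF, Finset.mem_filter, Finset.mem_biUnion, Finset.mem_univ, true_and, Finset.mem_Ioo]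
    constructor
    · rintro ⟨h1, h2⟩
      obtain ⟨a, b, d⟩ := Nat.find_spec h2
      refine ⟨Nat.find h2, ⟨a, b⟩, h1, d, ?_⟩
      intro c' u v w
      exact Nat.find_min h2 v ⟨u, by omega, w⟩
    · rintro ⟨c, ⟨a, b⟩, h, d, -⟩
      exact ⟨h, c, a, b, d⟩
  rw [this, Finset.card_biUnion]
  · apply Finset.sum_congr rfl
    intro c hc
    rw [Finset.mem_Ioo] at hc
    obtain ⟨m, rfl⟩ := Nat.exists_eq_add_of_le hc.2.le
    rw [cF_card, Nat.add_sub_cancel_left]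
  · intro x hx y hy hxy
    simp only [Finset.coe_Ioo, Set.mem_Ioo, Finset.mem_Ioo] at hx hy
    change Disjoint (cF n x) (cF n y)
    rw [Finset.disjoint_left]
    intro σ h1 h2
    simp only [cF, Finset.mem_filter, Finset.mem_univ, true_and] at h1 h2
    rcases lt_or_gt_of_ne hxy with h | h
    · exact h2.2.2 x hx.1 h h1.2.1
    · exact h1.2.2 y hy.1 h h2.2.1

lemma sp_rev {n : ℕ} (σ : Equiv.Perm (Fin n)) : Sp (σ.trans Fin.revPerm) ↔ Sp σ := by
  unfold Sp
  simp only [Equiv.trans_apply, Fin.revPerm_apply, Fin.rev_lt_rev]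
  refine forall_congr' fun a => forall_congr' fun b => forall_congr' fun c => forall_congr' fun d => ?_
  tauto

lemma dec_or {n : ℕ} (hn : 2 ≤ n) (σ : Equiv.Perm (Fin n)) (h : Sp σ) :
    Dec σ ∨ Dec (σ.trans Fin.revPerm) := by
  let f : ℕ → ℤ := fun i => if h : i < n then ((σ ⟨i, h⟩ : ℕ) : ℤ) else 0
  have hf : ∀ i (hi : i < n), f i = ((σ ⟨i, hi⟩ : ℕ) : ℤ) := fun i hi => by simp [f, hi]
  have := struct f 0 n (by omega) ?_ ?_
  · obtain ⟨c, h1, h2, h3 | h3⟩ := this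
    · left
      refine ⟨c, h1, h2, ?_⟩
      intro i j hi hj
      have := h3 i j (by omega) hi hj j.2
      rw [hf _ i.2, hf _ j.2] at this
      exact_mod_cast this
    · right
      refine ⟨c, h1, h2, ?_⟩
      intro i j hi hj
      have := h3 i j (by omega) hi hj j.2
      simp only [neg_lt_neg_iff] at this
      rw [hf _ i.2, hf _ j.2] at this
      simp only [Equiv.trans_apply, Fin.revPerm_apply, Fin.rev_lt_rev]
      exact_mod_cast this
  · intro p q _ h1 h2 h3
    rw [hf p (by omega), hf q (by omega)] at h3
    have := σ.injective (Fin.ext (by exact_mod_cast h3))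
    simp at this; omega
  · intro p q r s _ h1 h2 h3 h4
    rw [hf p (by omega), hf q (by omega), hf r (by omega), hf s (by omega)]
    have := h ⟨p, by omega⟩ ⟨q, by omega⟩ ⟨r, by omega⟩ ⟨s, by omega⟩ h1 h2 h3
    exact_mod_cast this

lemma dec_not {n : ℕ} (hn : 2 ≤ n) (σ : Equiv.Perm (Fin n)) :
    ¬ (Dec σ ∧ Dec (σ.trans Fin.revPerm)) := by
  rintro ⟨⟨c, h1, h2, h3⟩, ⟨c', h1', h2', h3'⟩⟩
  have a := h3 ⟨0, by omega⟩ ⟨n-1, by omega⟩ h1 (by simp; omega)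
  have b := h3' ⟨0, by omega⟩ ⟨n-1, by omega⟩ h1' (by simp; omega)
  simp only [Equiv.trans_apply, Fin.revPerm_apply, Fin.rev_lt_rev] at b
  exact lt_asymm a b

lemma p_eq_d {n : ℕ} (hn : 2 ≤ n) : (pF n).card = (dF n).card := by
  classical
  have rr : ∀ σ : Equiv.Perm (Fin n), (σ.trans Fin.revPerm).trans Fin.revPerm = σ := by
    intro σ; ext x; simp
  refine Finset.card_bij' (fun σ _ => σ.trans Fin.revPerm) (fun σ _ => σ.trans Fin.revPerm) ?_ ?_ ?_ ?_
  · intro σ h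
    simp only [pF, dF, Finset.mem_filter, Finset.mem_univ, true_and] at h ⊢
    have := dec_or hn σ h.1
    exact ⟨(sp_rev σ).2 h.1, by tauto⟩
  · intro σ h
    simp only [pF, dF, Finset.mem_filter, Finset.mem_univ, true_and] at h ⊢
    have := dec_not hn σ
    exact ⟨(sp_rev σ).2 h.1, by tauto⟩
  · intro σ _; exact rr σ
  · intro σ _; exact rr σ

lemma s_one : (sF 1).card = 1 := by
  classical
  have : sF 1 = Finset.univ := by
    ext σ
    simp only [sF, Finset.mem_filter, Finset.mem_univ, true_and, iff_true]
    intro a b c d h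
    omega
  rw [this]; simp [Fintype.card_perm]

noncomputable def sC (n : ℕ) : ℕ := (sF n).card
noncomputable def pC (n : ℕ) : ℕ := (pF n).card

lemma s_eq2 (n : ℕ) : sC n = (∑ c ∈ Finset.Ioo 0 n, pC c * sC (n - c)) + pC n :=
  (s_eq n).trans (congrArg (· + _) (d_eq n))

lemma s_eq3 (n : ℕ) (hn : 2 ≤ n) : sC n = 2 * pC n := by
  have h1 := s_eq n
  have h2 := p_eq_d hn
  unfold sC pC
  omega

lemma p_one : pC 1 = 1 := by
  have := s_eq2 1
  rw [show sC 1 = 1 from s_one, show Finset.Ioo 0 1 = ∅ from rfl, Finset.sum_empty] at this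
  omega

lemma s_rec (n : ℕ) : sC (n+1+1) = sC (n+1) +
    ∑ p ∈ Finset.HasAntidiagonal.antidiagonal n, sC (p.1+1) * sC (p.2+1) := by
  rw [Finset.Nat.sum_antidiagonal_eq_sum_range_succ_mk]
  have e1 : sC (n+1+1) = 2 * ∑ c ∈ Finset.Ioo 0 (n+1+1), pC c * sC (n+1+1 - c) := by
    have h1 := s_eq2 (n+1+1)
    have h2 := s_eq3 (n+1+1) (by omega)
    omega
  have e2 : Finset.Ioo 0 (n+1+1) = Finset.Ico 1 (n+1+1) := by ext x; simp; omega
  rw [e1, e2, Finset.sum_Ico_eq_sum_range]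
  have h2 : ∀ k, 2 * pC (k+2) = sC (k+2) := by
    intro k; exact (s_eq3 (k+2) (by omega)).symm
  simp only [Nat.add_sub_cancel]
  rw [Finset.sum_range_succ', Finset.sum_range_succ']
  have s_one : sC 1 = 1 := s_one
  simp only [zero_add, add_zero, p_one, s_one, mul_add, Finset.mul_sum]
  have : ∀ k ∈ Finset.range n, 2 * (pC (1 + (k+1)) * sC (n+1+1 - (1+(k+1))))
      = sC (k+1+1) * sC (n - (k+1) + 1) := by
    intro k hk
    rw [Finset.mem_range] at hk
    rw [← h2 k, show n+1+1 - (1+(k+1)) = n - (k+1) + 1 by omega, show 1 + (k+1) = k+2 by omega]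
    ring
  rw [Finset.sum_congr rfl this]
  simp [s_one]
  ring

def En (L : ℕ) {m : ℕ} (c p : Fin (m+1)) : Fin (m+(L+1)) :=
  ⟨if (p:ℕ) ≤ c then p else p + L, by have := p.2; split_ifs <;> omega⟩

def Bn {L : ℕ} {m : ℕ} (c : Fin (m+1)) (j : Fin (L+1)) : Fin (m+(L+1)) :=
  ⟨c + j, by have := c.2; have := j.2; omega⟩

section
variable {L m : ℕ}

lemma En_lt (c p q : Fin (m+1)) : En L c p < En L c q ↔ p < q := by
  simp only [En, Fin.lt_def]; split_ifs <;> omega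

lemma En_inj (c p q : Fin (m+1)) (h : En L c p = En L c q) : p = q := by
  simp only [En, Fin.ext_iff] at h ⊢; split_ifs at h <;> omega

lemma Bn_lt (c : Fin (m+1)) (i j : Fin (L+1)) : Bn c i < Bn c j ↔ i < j := by
  simp only [Bn, Fin.lt_def]; omega

lemma Bn_inj (c : Fin (m+1)) (i j : Fin (L+1)) (h : Bn c i = Bn c j) : i = j := by
  simp only [Bn, Fin.ext_iff] at h ⊢; omega

lemma Bn_En_lt (c p : Fin (m+1)) (hp : p ≠ c) (i : Fin (L+1)) : Bn c i < En L c p ↔ c < p := by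
  have := i.2
  rw [Ne, Fin.ext_iff] at hp
  simp only [Bn, En, Fin.lt_def]; split_ifs <;> omega

lemma En_Bn_lt (c p : Fin (m+1)) (hp : p ≠ c) (i : Fin (L+1)) : En L c p < Bn c i ↔ p < c := by
  have := i.2
  rw [Ne, Fin.ext_iff] at hp
  simp only [Bn, En, Fin.lt_def]; split_ifs <;> omega

lemma En_ne_Bn (c p : Fin (m+1)) (hp : p ≠ c) (i : Fin (L+1)) : En L c p ≠ Bn c i := by
  intro h
  have h1 := En_Bn_lt c p hp i
  have h2 := Bn_En_lt c p hp i
  rw [h] at h1 h2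
  simp at h1 h2
  exact hp (le_antisymm h2 h1)

lemma En_self (c : Fin (m+1)) : En L c c = Bn c 0 := by
  simp [En, Bn]

lemma cover (c : Fin (m+1)) (i : Fin (m+(L+1))) :
    (∃ j, i = Bn c j) ∨ (∃ p, p ≠ c ∧ i = En L c p) := by
  have hi := i.2
  have hc := c.2
  by_cases h1 : (i:ℕ) < c
  · right
    refine ⟨⟨i, by omega⟩, ?_, ?_⟩
    · rw [Ne, Fin.ext_iff]; simp; omega
    · ext; simp [En]; omega
  by_cases h2 : (i:ℕ) ≤ c + L
  · left
    exact ⟨⟨i - c, by omega⟩, by ext; simp [Bn]; omega⟩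
  · right
    refine ⟨⟨i - L, by omega⟩, ?_, ?_⟩
    · rw [Ne, Fin.ext_iff]; simp; omega
    · ext; simp only [En]; split_ifs <;> omega

/-- inflation relation -/
structure Rl (a κ : Fin (m+1)) (σ : Equiv.Perm (Fin (m+(L+1)))) (σ' : Equiv.Perm (Fin (m+1)))
    (τ : Equiv.Perm (Fin (L+1))) : Prop where
  h1 : σ' a = κ
  h2 : ∀ p, p ≠ a → σ (En L a p) = En L κ (σ' p)
  h3 : ∀ j, σ (Bn a j) = Bn κ (τ j)

lemma Rl.ne {a κ : Fin (m+1)} {σ : Equiv.Perm (Fin (m+(L+1)))} {σ' : Equiv.Perm (Fin (m+1))}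
    {τ : Equiv.Perm (Fin (L+1))} (h : Rl a κ σ σ' τ) {p} (hp : p ≠ a) : σ' p ≠ κ := by
  rw [← h.h1]; exact fun e => hp (σ'.injective e)

lemma Rl.sp {a κ : Fin (m+1)} {σ : Equiv.Perm (Fin (m+(L+1)))} {σ' : Equiv.Perm (Fin (m+1))}
    {τ : Equiv.Perm (Fin (L+1))} (h : Rl a κ σ σ' τ) : Sp σ ↔ Sp σ' ∧ Sp τ := by
  constructor
  · intro H
    constructor
    · have key : ∀ p q, σ' p < σ' q → σ (En L a p) < σ (En L a q) := by
        intro p q hpq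
        by_cases hp : p = a
        · subst hp
          by_cases hq : q = p
          · subst hq; exact absurd hpq (lt_irrefl _)
          rw [En_self, h.h2 q hq, h.h3, Bn_En_lt _ _ (h.ne hq), ← h.h1]; exact hpq
        · by_cases hq : q = a
          · subst hq
            rw [En_self, h.h2 p hp, h.h3, En_Bn_lt _ _ (h.ne hp), ← h.h1]; exact hpq
          · rw [h.h2 p hp, h.h2 q hq, En_lt]; exact hpq
      intro p q r s u v w
      have := H _ _ _ _ ((En_lt (L := L) a p q).2 u) ((En_lt a q r).2 v) ((En_lt a r s).2 w)
      exact ⟨fun x => this.1 ⟨key _ _ x.1, key _ _ x.2.1, key _ _ x.2.2⟩,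
        fun x => this.2 ⟨key _ _ x.1, key _ _ x.2.1, key _ _ x.2.2⟩⟩
    · intro p q r s u v w
      have := H _ _ _ _ ((Bn_lt a p q).2 u) ((Bn_lt a q r).2 v) ((Bn_lt a r s).2 w)
      simpa only [h.h3, Bn_lt] using this
  · rintro ⟨H1, H2⟩ p q r s
    have ha := h.h1
    rcases cover a p with ⟨p, rfl⟩ | ⟨p, hp, rfl⟩ <;>
    rcases cover a q with ⟨q, rfl⟩ | ⟨q, hq, rfl⟩ <;>
    rcases cover a r with ⟨r, rfl⟩ | ⟨r, hr, rfl⟩ <;>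
    rcases cover a s with ⟨s, rfl⟩ | ⟨s, hs, rfl⟩ <;>
    simp only [h.h3, h.h2, Bn_lt, En_lt, Bn_En_lt, En_Bn_lt, h.ne, ne_eq, not_false_eq_true, *] <;>
    intro u v w <;>
    first
    | exact H1 p q r s u v w
    | exact H2 p q r s u v w
    | (have := H1 a q r s u v w; rw [ha] at this; exact this)
    | (have := H1 p a r s u v w; rw [ha] at this; exact this)
    | (have := H1 p q a s u v w; rw [ha] at this; exact this)
    | (have := H1 p q r a u v w; rw [ha] at this; exact this)
    | (constructor <;> rintro ⟨x, y, z⟩ <;> order)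

lemma Rl.inj {a b κ : Fin (m+1)} {σ : Equiv.Perm (Fin (m+(L+1)))} {σ₁ σ₂ : Equiv.Perm (Fin (m+1))}
    {τ₁ τ₂ : Equiv.Perm (Fin (L+1))} (h : Rl a κ σ σ₁ τ₁) (h' : Rl b κ σ σ₂ τ₂) :
    σ₁ = σ₂ ∧ τ₁ = τ₂ := by
  have key : ∀ {a b : Fin (m+1)} {σ₁ σ₂ : Equiv.Perm (Fin (m+1))}
      {τ₁ τ₂ : Equiv.Perm (Fin (L+1))} (_ : Rl a κ σ σ₁ τ₁) (_ : Rl b κ σ σ₂ τ₂), b ≤ a := by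
    intro a b σ₁ σ₂ τ₁ τ₂ h h'
    rcases cover b (Bn (L := L) a 0) with ⟨j, hj⟩ | ⟨p, hp, e⟩
    · simp only [Bn, Fin.ext_iff, Fin.val_zero] at hj
      rw [Fin.le_def]; omega
    · exfalso
      have e1 := h.h3 0
      rw [e, h'.h2 p hp] at e1
      exact En_ne_Bn _ _ (h'.ne hp) _ e1
  obtain rfl : a = b := le_antisymm (key h' h) (key h h')
  constructor
  · ext p
    by_cases hp : p = a
    · subst hp; rw [h.h1, h'.h1]
    · have := (h.h2 p hp).symm.trans (h'.h2 p hp)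
      rw [En_inj _ _ _ this]
  · ext j
    have := (h.h3 j).symm.trans (h'.h3 j)
    rw [Bn_inj _ _ _ this]

lemma Rl.exists_up (a κ : Fin (m+1)) (σ' : Equiv.Perm (Fin (m+1)))
    (τ : Equiv.Perm (Fin (L+1))) (h : σ' a = κ) : ∃ σ, Rl (L := L) a κ σ σ' τ := by
  have hQ : ∀ c : Fin (m+1), Function.Bijective
      (Sum.elim (fun p : {p : Fin (m+1) // p ≠ c} => En L c p) (fun j : Fin (L+1) => Bn c j)) := by
    intro c
    constructor
    · rintro (⟨p, hp⟩ | i) (⟨q, hq⟩ | j) e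
      · simp only [Sum.elim_inl] at e
        have := En_inj _ _ _ e
        subst this; rfl
      · exact absurd e (En_ne_Bn _ _ hp _)
      · exact absurd e.symm (En_ne_Bn _ _ hq _)
      · simp only [Sum.elim_inr] at e
        rw [Bn_inj _ _ _ e]
    · intro i
      rcases cover c i with ⟨j, rfl⟩ | ⟨p, hp, rfl⟩
      · exact ⟨Sum.inr j, rfl⟩
      · exact ⟨Sum.inl ⟨p, hp⟩, rfl⟩
  let Q := fun c => Equiv.ofBijective _ (hQ c)
  have hs : ∀ p, p ≠ a ↔ σ' p ≠ κ := by
    intro p; rw [← h]; simp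
  let σ : Equiv.Perm (Fin (m+(L+1))) :=
    (Q a).symm.trans ((Equiv.sumCongr (σ'.subtypeEquiv hs) τ).trans (Q κ))
  refine ⟨σ, h, ?_, ?_⟩
  · intro p hp
    have : En L a p = Q a (Sum.inl ⟨p, hp⟩) := rfl
    rw [this]
    simp only [σ, Equiv.trans_apply, Equiv.symm_apply_apply]
    rfl
  · intro j
    have : Bn a j = Q a (Sum.inr j) := rfl
    rw [this]
    simp only [σ, Equiv.trans_apply, Equiv.symm_apply_apply]
    rfl

def Blk (a κ : Fin (m+1)) (σ : Equiv.Perm (Fin (m+(L+1)))) : Prop :=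
  ∀ i, (∃ j, i = Bn a j) ↔ (∃ j, σ i = Bn κ j)

lemma Rl.blk {a κ : Fin (m+1)} {σ : Equiv.Perm (Fin (m+(L+1)))} {σ' : Equiv.Perm (Fin (m+1))}
    {τ : Equiv.Perm (Fin (L+1))} (h : Rl a κ σ σ' τ) : Blk a κ σ := by
  intro i
  constructor
  · rintro ⟨j, rfl⟩; exact ⟨_, h.h3 j⟩
  · rintro ⟨j, hj⟩
    rcases cover a i with h' | ⟨p, hp, rfl⟩
    · exact h'
    · rw [h.h2 p hp] at hj
      exact absurd hj (En_ne_Bn _ _ (h.ne hp) _)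

lemma Rl.exists_down (a κ : Fin (m+1)) (σ : Equiv.Perm (Fin (m+(L+1)))) (h : Blk a κ σ) :
    ∃ σ' τ, Rl a κ σ σ' τ := by
  have h3 : ∀ j, ∃ j', σ (Bn a j) = Bn κ j' := fun j => (h _).1 ⟨j, rfl⟩
  have h2 : ∀ p, p ≠ a → ∃ q, q ≠ κ ∧ σ (En L a p) = En L κ q := by
    intro p hp
    rcases cover κ (σ (En L a p)) with h' | h'
    · obtain ⟨j, hj⟩ := (h _).2 h'
      exact absurd hj (En_ne_Bn _ _ hp _)
    · exact h'
  choose t ht using h3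
  choose f hf1 hf2 using h2
  have tinj : Function.Injective t := by
    intro i j e
    have := ht i
    rw [e, ← ht j] at this
    exact Bn_inj _ _ _ (σ.injective this)
  classical
  let g : Fin (m+1) → Fin (m+1) := fun p => if hp : p = a then κ else f p hp
  have ginj : Function.Injective g := by
    intro p q e
    simp only [g] at e
    split_ifs at e with hp hq hq
    · rw [hp, hq]
    · exact absurd e.symm (hf1 _ _)
    · exact absurd e (hf1 _ _)
    · have := hf2 p hp
      rw [e, ← hf2 q hq] at this
      exact En_inj _ _ _ (σ.injective this)
  refine ⟨Equiv.ofBijective g (Finite.injective_iff_bijective.1 ginj),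
    Equiv.ofBijective t (Finite.injective_iff_bijective.1 tinj), ?_, ?_, ?_⟩
  · simp [g]
  · intro p hp
    rw [hf2 p hp]; simp [g, hp]
  · intro j
    rw [ht]; simp

lemma mem_cluster (κ : Fin (m+1)) (σ : Equiv.Perm (Fin (m+(L+1)))) :
    σ ∈ ClusterEvent (m+(L+1)) (L+1) (κ+1) ↔ ∃ a : Fin (m+1), Blk a κ σ := by
  have hB : ∀ (c : Fin (m+1)) (i : Fin (m+(L+1))), (∃ j, i = Bn c j) ↔ (c:ℕ) ≤ i ∧ (i:ℕ) ≤ c + L := by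
    intro c i
    constructor
    · rintro ⟨j, rfl⟩; have := j.2; simp only [Bn]; omega
    · rintro ⟨h1, h2⟩; exact ⟨⟨i - c, by omega⟩, by ext; simp [Bn]; omega⟩
  constructor
  · rintro ⟨a, ha1, ha2, h⟩
    refine ⟨⟨a - 1, by omega⟩, ?_⟩
    intro i
    rw [hB, hB]
    simp only
    unfold ClusterAt at h
    rw [Finset.ext_iff] at h
    have := h ((σ i : ℕ) + 1)
    simp only [Finset.mem_image, Finset.mem_filter, Finset.mem_univ, true_and, Finset.mem_Ico] at this
    constructor
    · intro hi
      have := this.1 ⟨i, by omega, rfl⟩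
      omega
    · intro hi
      obtain ⟨j, hj, e⟩ := this.2 (by omega)
      have : j = i := σ.injective (Fin.ext (by omega))
      subst this
      omega
  · rintro ⟨a, h⟩
    refine ⟨a + 1, by omega, by have := a.2; omega, ?_⟩
    unfold ClusterAt
    ext v
    simp only [Finset.mem_image, Finset.mem_filter, Finset.mem_univ, true_and, Finset.mem_Ico]
    constructor
    · rintro ⟨i, hi, rfl⟩
      have := h i
      rw [hB, hB] at this
      have := this.1 (by omega)
      omega
    · intro hv
      have hκ := κ.2
      have := h (σ.symm ⟨v - 1, by omega⟩)
      rw [hB, hB] at this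
      simp only [Equiv.apply_symm_apply] at this
      have := this.2 (by omega)
      refine ⟨σ.symm ⟨v - 1, by omega⟩, ⟨?_, ?_⟩, ?_⟩
      · omega
      · omega
      · simp; omega

lemma count (κ : Fin (m+1)) :
    (ClusterEvent (m+(L+1)) (L+1) (κ+1) ∩ SepSet (m+(L+1))).ncard
      = (SepSet (m+1)).ncard * (SepSet (L+1)).ncard := by
  have hex : ∀ x : Equiv.Perm (Fin (m+1)) × Equiv.Perm (Fin (L+1)),
      ∃ σ, Rl (x.1.symm κ) κ σ x.1 x.2 := fun x => Rl.exists_up _ _ _ _ (by simp)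
  choose F hF using hex
  rw [← Set.ncard_prod]
  have : ClusterEvent (m+(L+1)) (L+1) (κ+1) ∩ SepSet (m+(L+1)) =
      F '' (SepSet (m+1) ×ˢ SepSet (L+1)) := by
    ext σ
    simp only [Set.mem_inter_iff, Set.mem_image, Set.mem_prod, mem_sep, mem_cluster]
    constructor
    · rintro ⟨⟨a, ha⟩, hs⟩
      obtain ⟨σ', τ, h⟩ := Rl.exists_down a κ σ ha
      refine ⟨(σ', τ), h.sp.1 hs, ?_⟩
      have h' := hF (σ', τ)
      have ea : σ'.symm κ = a := by rw [← h.h1]; simp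
      simp only [ea] at h'
      ext i
      rcases cover a i with ⟨j, rfl⟩ | ⟨p, hp, rfl⟩
      · rw [h.h3, h'.h3]
      · rw [h.h2 p hp, h'.h2 p hp]
    · rintro ⟨x, hx, rfl⟩
      exact ⟨⟨_, (hF x).blk⟩, (hF x).sp.2 hx⟩
  rw [this, Set.ncard_image_of_injective]
  rintro x y e
  have h1 := hF x
  have h2 := hF y
  rw [e] at h1
  obtain ⟨a, b⟩ := h1.inj h2
  exact Prod.ext a b

end

lemma main_lim (l : ℕ) (hl : 2 ≤ l)
    (k : ℕ → ℕ) (hk : ∀ n : ℕ, 1 ≤ k n ∧ k n ≤ n - l + 1) :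
    Filter.Tendsto
      (fun n : ℕ => ((ClusterEvent n l (k n) ∩ SepSet n).ncard : ℝ) / ((SepSet n).ncard : ℝ))
      Filter.atTop
      (nhds ((3 - 2 * Real.sqrt 2) ^ (l - 1) * ((SepSet l).ncard : ℝ))) := by
  obtain ⟨L, rfl⟩ : ∃ L, l = L + 1 := ⟨l - 1, by omega⟩
  have h := ratio_lim_pow (fun n => sC (n+1)) s_one s_rec L
  rw [← tendsto_add_atTop_iff_nat (L+1)]
  rw [Nat.add_sub_cancel]
  refine (h.mul_const _).congr ?_
  intro m
  have hk' := hk (m + (L+1))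
  obtain ⟨κ, hκ⟩ : ∃ κ : Fin (m+1), k (m+(L+1)) = κ + 1 :=
    ⟨⟨k (m+(L+1)) - 1, by omega⟩, by simp; omega⟩
  rw [hκ, count κ]
  have e : ∀ n, (SepSet n).ncard = sC n := ncard_sep
  simp only [e]
  push_cast
  rw [show m + L + 1 = m + (L+1) by omega]
  ring

lemma s3 : (SepSet 3).ncard = 6 := by
  have h1 : sC 1 = 1 := s_one
  have h2 := s_rec 0
  have h3 := s_rec 1
  simp [Finset.Nat.antidiagonal_succ, h1] at h2
  simp [Finset.Nat.antidiagonal_succ, h1, h2] at h3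
  rw [ncard_sep]; exact h3

lemma s4 : (SepSet 4).ncard = 22 := by
  have h1 : sC 1 = 1 := s_one
  have h2 := s_rec 0
  have h3 : sC 3 = 6 := by rw [← s3, ncard_sep]; rfl
  have h4 := s_rec 2
  simp [Finset.Nat.antidiagonal_succ, h1] at h2
  simp [Finset.Nat.antidiagonal_succ, h1, h2, h3] at h4
  rw [ncard_sep]; exact h4

end SepProof

/-- the limiting probability for separable permutations equals
`(3-2√2)^{l-1}|S_l^sep|`; in particular `6(3-2√2)^2` for `l = 3` and `22(3-2√2)^3`
for `l = 4`. -/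
theorem separable_cluster_limit (l : ℕ) (hl : 2 ≤ l)
    (k : ℕ → ℕ) (hk : ∀ n : ℕ, 1 ≤ k n ∧ k n ≤ n - l + 1) :
    Filter.Tendsto
      (fun n : ℕ => ((ClusterEvent n l (k n) ∩ SepSet n).ncard : ℝ) / ((SepSet n).ncard : ℝ))
      Filter.atTop
      (nhds ((3 - 2 * Real.sqrt 2) ^ (l - 1) * ((SepSet l).ncard : ℝ))) ∧
    (l = 3 →
      Filter.Tendsto
        (fun n : ℕ => ((ClusterEvent n l (k n) ∩ SepSet n).ncard : ℝ) / ((SepSet n).ncard : ℝ))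
        Filter.atTop (nhds (6 * (3 - 2 * Real.sqrt 2) ^ 2))) ∧
    (l = 4 →
      Filter.Tendsto
        (fun n : ℕ => ((ClusterEvent n l (k n) ∩ SepSet n).ncard : ℝ) / ((SepSet n).ncard : ℝ))
        Filter.atTop (nhds (22 * (3 - 2 * Real.sqrt 2) ^ 3))) := by

  have h := SepProof.main_lim l hl k hk
  refine ⟨h, ?_, ?_⟩
  · rintro rfl
    rw [SepProof.s3] at h
    convert h using 2
    push_cast; ring
  · rintro rfl
    rw [SepProof.s4] at h
    convert h using 2
    push_cast; ring
end

section
/- Let τ ∈ {123, 321} ⊂ S_3. Then for all n ≥ 3, all l with 2 ≤ l ≤ n-1, and all k with 1 ≤ k ≤ n-l+1, one has |A^{(n)}_{l;k} ∩ S_n(τ)| = C_{n-l+1} + C_{k-1}·C_{n-k-l+1}·(C_l - 1); equivalently, since |S_n(τ)| = C_n, the probability of A^{(n)}_{l;k} under the uniform measure on S_n(τ) equals (C_{n-l+1} + C_{k-1}·C_{n-k-l+1}·(C_l - 1))/C_n. -/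
open Filter

namespace CX

def Av {n : ℕ} (σ : Equiv.Perm (Fin n)) : Prop :=
  ∀ i j k : Fin n, i < j → j < k → σ j < σ i → σ k < σ j → False

def ins {n : ℕ} (p v : Fin (n+1)) (ρ : Equiv.Perm (Fin n)) : Equiv.Perm (Fin (n+1)) :=
  (finSuccEquiv' p).trans ((Equiv.optionCongr ρ).trans (finSuccEquiv' v).symm)

lemma ins_self {n : ℕ} (p v : Fin (n+1)) (ρ : Equiv.Perm (Fin n)) : ins p v ρ p = v := by
  simp [ins]

lemma ins_succAbove {n : ℕ} (p v : Fin (n+1)) (ρ : Equiv.Perm (Fin n)) (i : Fin n) :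
    ins p v ρ (p.succAbove i) = v.succAbove (ρ i) := by
  simp [ins]

lemma ins_inj {n : ℕ} (p : Fin (n+1)) :
    Function.Injective (fun x : Fin (n+1) × Equiv.Perm (Fin n) => ins p x.1 x.2) := by
  rintro ⟨v, ρ⟩ ⟨w, ρ'⟩ h
  simp only at h
  have h1 : v = w := by
    rw [← ins_self p v ρ, h, ins_self]
  subst h1
  have : ρ = ρ' := by
    ext i
    have := ins_succAbove p v ρ i
    rw [h, ins_succAbove] at this
    rw [Fin.succAbove_right_injective this]
  rw [this]

lemma ins_bij {n : ℕ} (p : Fin (n+1)) :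
    Function.Bijective (fun x : Fin (n+1) × Equiv.Perm (Fin n) => ins p x.1 x.2) := by
  rw [Fintype.bijective_iff_injective_and_card]
  refine ⟨ins_inj p, ?_⟩
  simp [Fintype.card_perm, Nat.factorial_succ]

def L {n : ℕ} (j : ℕ) (σ : Equiv.Perm (Fin n)) : Prop :=
  ∀ x y : Fin n, x < y → (σ x : ℕ) < j → (σ y : ℕ) < j → σ x < σ y

lemma sa_lt {n : ℕ} (p : Fin (n+1)) (x y : Fin n) : p.succAbove x < p.succAbove y ↔ x < y :=
  Fin.succAbove_lt_succAbove_iff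

lemma sa_val {n : ℕ} (p : Fin (n+1)) (x : Fin n) :
    (p.succAbove x : ℕ) = if (x : ℕ) < p then (x : ℕ) else x + 1 := by
  simp only [Fin.succAbove, Fin.lt_def, Fin.val_castSucc]
  split_ifs <;> simp

lemma ins_zero {n : ℕ} (v : Fin (n+1)) (ρ : Equiv.Perm (Fin n)) : ins 0 v ρ 0 = v := ins_self _ _ _
lemma ins_zs {n : ℕ} (v : Fin (n+1)) (ρ : Equiv.Perm (Fin n)) (i : Fin n) :
    ins 0 v ρ i.succ = v.succAbove (ρ i) := by
  have := ins_succAbove 0 v ρ i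
  simpa using this

lemma av_cons {n : ℕ} (v : Fin (n+1)) (ρ : Equiv.Perm (Fin n)) :
    Av (ins 0 v ρ) ↔ Av ρ ∧ L v ρ := by
  constructor
  · intro h
    constructor
    · intro i j k hij hjk h1 h2
      refine h i.succ j.succ k.succ (by simpa) (by simpa) ?_ ?_ <;>
      · rw [ins_zs, ins_zs, sa_lt]; assumption
    · intro x y hxy hx hy
      by_contra hc
      have hne : ρ x ≠ ρ y := fun e => hxy.ne (ρ.injective e)
      refine h 0 x.succ y.succ (by simp) (by simpa) ?_ ?_
      · rw [ins_zs, ins_zero, Fin.lt_def, sa_val]; simp [hx]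
      · rw [ins_zs, ins_zs, sa_lt]; exact lt_of_le_of_ne (not_lt.1 hc) hne.symm
  · rintro ⟨h, hL⟩ i j k hij hjk h1 h2
    obtain ⟨j, rfl⟩ := Fin.exists_succ_eq.2 (Fin.ne_zero_of_lt hij)
    obtain ⟨k, rfl⟩ := Fin.exists_succ_eq.2 (Fin.ne_zero_of_lt hjk)
    rw [ins_zs, ins_zs, sa_lt] at h2
    have hjk' : j < k := by simpa using hjk
    rcases Fin.eq_zero_or_eq_succ i with rfl | ⟨i, rfl⟩
    · rw [ins_zs, ins_zero, Fin.lt_def, sa_val] at h1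
      have hj : (ρ j : ℕ) < v := by split_ifs at h1 <;> omega
      have := hL j k hjk' hj (lt_trans h2 hj)
      exact absurd this (not_lt.2 h2.le)
    · rw [ins_zs, ins_zs, sa_lt] at h1
      exact h i j k (by simpa using hij) hjk' h1 h2

lemma L_mono {n : ℕ} {a b : ℕ} (h : a ≤ b) {σ : Equiv.Perm (Fin n)} (hb : L b σ) : L a σ :=
  fun x y hxy hx hy => hb x y hxy (by omega) (by omega)

lemma L_cons0 {n : ℕ} (j : ℕ) (ρ : Equiv.Perm (Fin n)) :
    L (j+1) (ins 0 0 ρ) ↔ L j ρ := by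
  constructor
  · intro h x y hxy hx hy
    have := h x.succ y.succ (by simpa) (by rw [ins_zs, sa_val]; simp; omega)
      (by rw [ins_zs, sa_val]; simp; omega)
    rwa [ins_zs, ins_zs, sa_lt] at this
  · intro h x y hxy hx hy
    obtain ⟨y, rfl⟩ := Fin.exists_succ_eq.2 (Fin.ne_zero_of_lt hxy)
    rcases Fin.eq_zero_or_eq_succ x with rfl | ⟨x, rfl⟩
    · rw [ins_zs, ins_zero]; simp
    · rw [ins_zs, sa_val] at hx hy
      rw [ins_zs, ins_zs, sa_lt]
      simp at hx hy
      exact h x y (by simpa using hxy) hx hy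

lemma L_cons {n : ℕ} (j : ℕ) (v : Fin (n+1)) (hv : v ≠ 0) (ρ : Equiv.Perm (Fin n)) (hL : L v ρ) :
    L (j+1) (ins 0 v ρ) ↔ j + 1 ≤ v := by
  have hv0 : 0 < (v : ℕ) := Nat.pos_of_ne_zero (fun h => hv (Fin.ext h))
  constructor
  · intro h
    by_contra hc
    have hn : 0 < n := by have := v.2; omega
    let x : Fin n := ρ.symm ⟨0, hn⟩
    have e : ins 0 v ρ x.succ = 0 := by
      rw [ins_zs]
      apply Fin.ext
      rw [sa_val]; simp [x, hv0]
    have := h 0 x.succ (by simp) (by rw [ins_zero]; omega) (by rw [e]; simp)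
    rw [e] at this
    simp at this
  · intro h x y hxy hx hy
    obtain ⟨y, rfl⟩ := Fin.exists_succ_eq.2 (Fin.ne_zero_of_lt hxy)
    rcases Fin.eq_zero_or_eq_succ x with rfl | ⟨x, rfl⟩
    · rw [ins_zero] at hx; omega
    · rw [ins_zs, sa_val] at hx hy
      rw [ins_zs, ins_zs, sa_lt]
      refine hL x y (by simpa using hxy) ?_ ?_
      · split_ifs at hx <;> omega
      · split_ifs at hy <;> omega

open Classical in
noncomputable def U (n j : ℕ) : ℕ := Fintype.card {σ : Equiv.Perm (Fin n) // Av σ ∧ L j σ}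

open Classical in
lemma U_succ (n j : ℕ) : U (n+1) (j+1) =
    ∑ v : Fin (n+1), if v = 0 then U n j else if j + 1 ≤ (v : ℕ) then U n v else 0 := by
  have e := Equiv.ofBijective _ (ins_bij (n := n) 0)
  have h1 : U (n+1) (j+1) = Fintype.card {x : Fin (n+1) × Equiv.Perm (Fin n) //
      Av (ins 0 x.1 x.2) ∧ L (j+1) (ins 0 x.1 x.2)} := by
    symm
    exact Fintype.card_congr ((Equiv.ofBijective _ (ins_bij (n := n) 0)).subtypeEquiv (fun _ => Iff.rfl))
  rw [h1, Fintype.card_subtype, Finset.card_filter, Fintype.sum_prod_type]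
  refine Finset.sum_congr rfl fun v _ => ?_
  rw [← Finset.card_filter]
  split_ifs with hv hj
  · subst hv
    rw [U, Fintype.card_subtype]
    congr 1
    ext ρ
    simp only [Finset.mem_filter, Finset.mem_univ, true_and, L_cons0, av_cons]
    constructor
    · rintro ⟨⟨a, b⟩, c⟩; exact ⟨a, c⟩
    · rintro ⟨a, c⟩; exact ⟨⟨a, fun x y _ hx => by simp at hx⟩, c⟩
  · rw [U, Fintype.card_subtype]
    congr 1
    ext ρ
    simp only [Finset.mem_filter, Finset.mem_univ, true_and, av_cons]
    constructor
    · rintro ⟨⟨a, b⟩, c⟩; exact ⟨a, b⟩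
    · rintro ⟨a, c⟩; exact ⟨⟨a, c⟩, (L_cons j v hv ρ c).2 hj⟩
  · rw [Finset.card_eq_zero, Finset.filter_eq_empty_iff]
    rintro ρ _ ⟨a, b⟩
    exact hj ((L_cons j v hv ρ ((av_cons v ρ).1 a).2).1 b)

def B (n j : ℕ) : ℤ := ((2*n-j).choose n : ℤ) - ((2*n-j).choose (n+1) : ℤ)

lemma B_rec (n j : ℕ) (h : j ≤ n) : B (n+1) (j+1) = B n j + B (n+1) (j+2) := by
  unfold B
  have e1 : 2*(n+1)-(j+1) = (2*n-j)+1 := by omega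
  have e2 : 2*(n+1)-(j+2) = (2*n-j) := by omega
  rw [e1, e2, Nat.choose_succ_succ, Nat.choose_succ_succ]
  push_cast
  ring

lemma B_top (n : ℕ) : B (n+1) (n+2) = 0 := by
  unfold B
  have e2 : 2*(n+1)-(n+2) = n := by omega
  rw [e2, Nat.choose_eq_zero_of_lt (by omega), Nat.choose_eq_zero_of_lt (by omega)]; simp

lemma B_sum (n j : ℕ) (h : j ≤ n) : ∑ p ∈ Finset.Ico (j+1) (n+1), B n p = B (n+1) (j+2) := by
  have h1 : ∀ p ∈ Finset.Ico (j+1) (n+1), B n p = (-B (n+1) (p+1+1)) - (-B (n+1) (p+1)) := by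
    intro p hp
    rw [Finset.mem_Ico] at hp
    have := B_rec n p (by omega)
    linarith
  rw [Finset.sum_congr rfl h1, Finset.sum_Ico_sub (fun p => -B (n+1) (p+1)) (by omega)]
  have := B_top n
  rw [show n+1+1 = n+2 from rfl, this]; simp

lemma U_zero_eq (n : ℕ) : U n 0 = U n 1 := by
  classical
  unfold U
  refine Fintype.card_congr (Equiv.subtypeEquivRight fun σ => ?_)
  refine and_congr_right fun _ => ⟨fun _ x y hxy hx hy => ?_, fun h => L_mono (by omega) h⟩
  exact absurd (σ.injective (Fin.ext (by omega))) hxy.ne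

lemma U_eq (n j : ℕ) (h : j ≤ n) (h1 : j = 0 → n = 0) : (U n j : ℤ) = B n j := by
  induction n generalizing j with
  | zero =>
    have : j = 0 := by omega
    subst this
    have : U 0 0 = 1 := by
      classical
      unfold U
      rw [Fintype.card_eq_one_iff]
      refine ⟨⟨1, fun i => i.elim0, fun i => i.elim0⟩, fun y => Subtype.ext (Subsingleton.elim _ _)⟩
    rw [this]; simp [B]
  | succ n ih =>
    obtain ⟨j, rfl⟩ : ∃ i, j = i + 1 := ⟨j-1, by omega⟩
    have hU0 : (U n j : ℤ) = B n j := by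
      rcases Nat.eq_zero_or_pos j with rfl | hj
      · rcases Nat.eq_zero_or_pos n with rfl | hn
        · exact ih 0 (by omega) (by omega)
        · rw [U_zero_eq, ih 1 (by omega) (by omega)]
          obtain ⟨t, rfl⟩ : ∃ t, n = t + 1 := ⟨n-1, by omega⟩
          unfold B
          have e1 : 2*(t+1)-0 = (2*t+1)+1 := by omega
          have e2 : 2*(t+1)-1 = 2*t+1 := by omega
          rw [e1, e2, Nat.choose_succ_succ (2*t+1) t, Nat.choose_succ_succ (2*t+1) (t+1)]
          have := Nat.choose_symm_of_eq_add (n := 2*t+1) (a := t) (b := t+1) (by omega)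
          rw [this]; push_cast; simp only [Nat.succ_eq_add_one]; ring
      · exact ih j (by omega) (by omega)
    rw [U_succ, Fin.sum_univ_succ, B_rec n j (by omega), ← B_sum n j (by omega)]
    simp only [if_true, Fin.succ_ne_zero, if_false, Fin.val_succ, add_le_add_iff_right]
    push_cast
    rw [hU0]
    congr 1
    rw [Fin.sum_univ_eq_sum_range (fun i => if j ≤ i then (U n (i+1) : ℤ) else 0) n,
      ← Finset.sum_filter, ← Finset.sum_Ico_add' (fun p => B n p) j n 1]
    refine Finset.sum_congr ?_ ?_
    · ext i; simp; omega
    · intro i hi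
      simp at hi
      exact ih (i+1) (by omega) (by omega)

lemma U_cat (n : ℕ) : U n 0 = catalan n := by
  rcases n with _ | t
  · have := U_eq 0 0 le_rfl (by simp)
    simp [B] at this
    simpa using this
  · have h := U_eq (t+1) 1 (by omega) (by omega)
    rw [← U_zero_eq] at h
    have h2 : (t+2) * catalan (t+1) = (t+1).centralBinom := succ_mul_catalan_eq_centralBinom (t+1)
    rw [Nat.centralBinom, show 2*(t+1) = (2*t+1)+1 by ring, Nat.choose_succ_succ,
      Nat.choose_symm_of_eq_add (n := 2*t+1) (a := t) (b := t+1) (by omega)] at h2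
    have h3 := Nat.choose_succ_right_eq (2*t+1) (t+1)
    rw [show 2*t+1-(t+1) = t by omega] at h3
    unfold B at h
    rw [show 2*(t+1)-1 = 2*t+1 by omega] at h
    zify at h2 h3
    have : ((t:ℤ)+2) * (U (t+1) 0 : ℤ) = (t+2) * catalan (t+1) := by
      rw [h, h2]
      simp only [Nat.succ_eq_add_one] at *
      linear_combination -h3
    have := mul_left_cancel₀ (by positivity) this
    exact_mod_cast this

lemma card_Av (n : ℕ) : {σ : Equiv.Perm (Fin n) | Av σ}.ncard = catalan n := by
  classical
  rw [← U_cat, U, ← Nat.card_eq_fintype_card, ← Nat.card_coe_set_eq]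
  refine Nat.card_congr (Equiv.subtypeEquivRight fun σ => ?_)
  simp [L]

lemma av_of_ins {n : ℕ} (p v : Fin (n+1)) (ρ : Equiv.Perm (Fin n)) (h : Av (ins p v ρ)) : Av ρ := by
  intro i j k hij hjk h1 h2
  refine h (p.succAbove i) (p.succAbove j) (p.succAbove k) (by rwa [sa_lt]) (by rwa [sa_lt]) ?_ ?_ <;>
  · rw [ins_succAbove, ins_succAbove, sa_lt]; assumption

def dup {n : ℕ} (m : Fin n) (ρ : Equiv.Perm (Fin n)) : Equiv.Perm (Fin (n+1)) :=
  ins (ρ.symm m).castSucc m.castSucc ρ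

lemma dup_p {n : ℕ} (m : Fin n) (ρ : Equiv.Perm (Fin n)) :
    dup m ρ (ρ.symm m).castSucc = m.castSucc := ins_self _ _ _

lemma dup_s {n : ℕ} (m : Fin n) (ρ : Equiv.Perm (Fin n)) (x : Fin n) :
    dup m ρ ((ρ.symm m).castSucc.succAbove x) = m.castSucc.succAbove (ρ x) := ins_succAbove _ _ _ _

lemma dup_inj {n : ℕ} (m : Fin n) : Function.Injective (dup m) := by
  intro ρ ρ' h
  have hp : (ρ.symm m).castSucc = (ρ'.symm m).castSucc := by
    apply (dup m ρ).injective
    rw [dup_p, h, dup_p]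
  unfold dup at h
  rw [hp] at h
  have := ins_inj (ρ'.symm m).castSucc (a₁ := (m.castSucc, ρ)) (a₂ := (m.castSucc, ρ')) h
  exact (Prod.ext_iff.1 this).2

lemma dup_av {n : ℕ} (m : Fin n) (ρ : Equiv.Perm (Fin n)) : Av (dup m ρ) ↔ Av ρ := by
  refine ⟨av_of_ins _ _ _, fun h => ?_⟩
  have hc : ∀ i : Fin (n+1), ∃ x : Fin n, (i = (ρ.symm m).castSucc ∧ x = ρ.symm m) ∨
      i = (ρ.symm m).castSucc.succAbove x := by
    intro i
    rcases Fin.eq_self_or_eq_succAbove (ρ.symm m).castSucc i with h | ⟨x, h⟩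
    · exact ⟨_, Or.inl ⟨h, rfl⟩⟩
    · exact ⟨x, Or.inr h⟩
  choose c hc using hc
  have key : ∀ i j, i < j → dup m ρ j < dup m ρ i → c i < c j ∧ ρ (c j) < ρ (c i) := by
    intro i j hij hs
    rcases hc i with ⟨h1, h2⟩ | h1 <;> rcases hc j with ⟨h3, h4⟩ | h3
    · rw [h1, h3] at hij; exact absurd hij (lt_irrefl _)
    · generalize c j = x at *
      rw [h1, h3] at hij hs
      rw [dup_p, dup_s] at hs
      rw [h2, Equiv.apply_symm_apply]
      rw [Fin.lt_def, sa_val] at hs hij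
      simp only [Fin.val_castSucc] at hs hij
      have hx : ρ x < m := by rw [Fin.lt_def]; split_ifs at hs <;> omega
      have hne : x ≠ ρ.symm m := by rintro rfl; simp at hx
      refine ⟨?_, hx⟩
      have : (x : ℕ) ≠ ρ.symm m := fun e => hne (Fin.ext e)
      rw [Fin.lt_def]; split_ifs at hij <;> omega
    · generalize c i = x at *
      rw [h1, h3] at hij hs
      rw [dup_p, dup_s] at hs
      rw [h4, Equiv.apply_symm_apply]
      rw [Fin.lt_def, sa_val] at hs hij
      simp only [Fin.val_castSucc] at hs hij
      have hx : x < ρ.symm m := by rw [Fin.lt_def]; split_ifs at hij <;> omega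
      have hne : ρ x ≠ m := by rintro rfl; simp at hx
      refine ⟨hx, ?_⟩
      have : (ρ x : ℕ) ≠ m := fun e => hne (Fin.ext e)
      rw [Fin.lt_def]; split_ifs at hs <;> omega
    · generalize c i = x at *
      generalize c j = y at *
      rw [h1, h3] at hij hs
      rw [dup_s, dup_s, sa_lt] at hs
      rw [sa_lt] at hij
      exact ⟨hij, hs⟩
  intro i j k hij hjk h1 h2
  obtain ⟨a1, a2⟩ := key i j hij h1
  obtain ⟨b1, b2⟩ := key j k hjk h2
  exact h _ _ _ a1 b1 a2 b2

def R {n : ℕ} (l m : ℕ) (σ : Equiv.Perm (Fin n)) : Prop :=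
  ∃ a, ∀ i < l, ∃ h : a + i < n, (σ ⟨a+i, h⟩ : ℕ) = m + i

lemma dup_R {n : ℕ} (l : ℕ) (hl : 1 ≤ l) (m : Fin n) (ρ : Equiv.Perm (Fin n)) :
    R (l+1) m (dup m ρ) ↔ R l m ρ := by
  have sa : ∀ i (h : (ρ.symm m : ℕ) + i < n), (ρ.symm m).castSucc.succAbove ⟨ρ.symm m + i, h⟩
      = ⟨ρ.symm m + (i + 1), by omega⟩ := by
    intro i h
    apply Fin.ext
    rw [sa_val]; simp; omega
  constructor
  · rintro ⟨a, ha⟩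
    have hap : a = ρ.symm m := by
      obtain ⟨h, e⟩ := ha 0 (by omega)
      have : (⟨a, h⟩ : Fin (n+1)) = (ρ.symm m).castSucc := by
        apply (dup m ρ).injective
        rw [dup_p]
        exact Fin.ext e
      simpa using congrArg Fin.val this
    subst hap
    refine ⟨ρ.symm m, fun i hi => ?_⟩
    obtain ⟨h, e⟩ := ha (i+1) (by omega)
    have h' : (ρ.symm m : ℕ) + i < n := by omega
    refine ⟨h', ?_⟩
    rw [← sa i h', dup_s, sa_val] at e
    simp only [Fin.val_castSucc] at e
    split_ifs at e <;> omega
  · rintro ⟨a, ha⟩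
    have hap : a = ρ.symm m := by
      obtain ⟨h, e⟩ := ha 0 (by omega)
      have : (⟨a, h⟩ : Fin n) = (ρ.symm m) := by
        apply ρ.injective
        rw [Equiv.apply_symm_apply]
        exact Fin.ext e
      simpa using congrArg Fin.val this
    subst hap
    refine ⟨ρ.symm m, fun i hi => ?_⟩
    rcases i with _ | i
    · refine ⟨by omega, ?_⟩
      have := dup_p m ρ
      exact congrArg Fin.val this
    · obtain ⟨h, e⟩ := ha i (by omega)
      refine ⟨by omega, ?_⟩
      rw [← sa i h, dup_s, sa_val, e]
      simp
      omega

lemma dup_surj {n : ℕ} (l : ℕ) (hl : 1 ≤ l) (m : Fin n) (σ : Equiv.Perm (Fin (n+1)))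
    (h : R (l+1) m σ) : ∃ ρ, dup m ρ = σ := by
  obtain ⟨a, ha⟩ := h
  obtain ⟨h0, e0⟩ := ha 0 (by omega)
  obtain ⟨h1, e1⟩ := ha 1 (by omega)
  have han : a < n := by omega
  obtain ⟨⟨v, ρ⟩, hσ⟩ := (ins_bij (⟨a, by omega⟩ : Fin (n+1))).2 σ
  simp only at hσ
  have hv : v = m.castSucc := by
    rw [← ins_self ⟨a, by omega⟩ v ρ, hσ]
    exact Fin.ext e0
  subst hv
  have hρ : ρ ⟨a, han⟩ = m := by
    have := ins_succAbove ⟨a, by omega⟩ m.castSucc ρ ⟨a, han⟩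
    have e : (⟨a, by omega⟩ : Fin (n+1)).succAbove ⟨a, han⟩ = ⟨a+1, h1⟩ := by
      apply Fin.ext; rw [sa_val]; simp
    rw [e, hσ] at this
    have := congrArg Fin.val this
    rw [e1, sa_val] at this
    apply Fin.ext
    simp only [Fin.val_castSucc] at this
    split_ifs at this <;> omega
  refine ⟨ρ, ?_⟩
  rw [← hσ, dup]
  congr 1
  rw [← hρ, Equiv.symm_apply_apply]
  rfl

lemma card_R (l : ℕ) (n m : ℕ) (hm : m < n) :
    {σ : Equiv.Perm (Fin (n+l)) | Av σ ∧ R (l+1) m σ}.ncard = catalan n := by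
  induction l with
  | zero =>
    rw [← card_Av]
    congr 1
    ext σ
    change (Av σ ∧ R 1 m σ) ↔ Av σ
    refine and_iff_left_of_imp fun _ => ?_
    refine ⟨σ.symm ⟨m, hm⟩, fun i hi => ?_⟩
    have : i = 0 := by omega
    subst this
    refine ⟨(σ.symm ⟨m, hm⟩).2, ?_⟩
    simp
  | succ l ih =>
    rw [← ih]
    have hm' : m < n + l := by omega
    rw [← Set.ncard_image_of_injective _ (dup_inj (⟨m, hm'⟩ : Fin (n+l)))]
    congr 1
    ext σ
    simp only [Set.mem_ofPred_eq, Set.mem_image]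
    constructor
    · rintro ⟨h1, h2⟩
      obtain ⟨ρ, rfl⟩ := dup_surj (l+1) (by omega) (⟨m, hm'⟩ : Fin (n+l)) σ h2
      exact ⟨ρ, ⟨(dup_av _ _).1 h1, (dup_R (l+1) (by omega) ⟨m, hm'⟩ ρ).1 h2⟩, rfl⟩
    · rintro ⟨ρ, ⟨h1, h2⟩, rfl⟩
      exact ⟨(dup_av _ _).2 h1, (dup_R (l+1) (by omega) ⟨m, hm'⟩ ρ).2 h2⟩

def dsum {m r : ℕ} (a : Equiv.Perm (Fin m)) (b : Equiv.Perm (Fin r)) : Equiv.Perm (Fin (m+r)) :=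
  finSumFinEquiv.permCongr (Equiv.sumCongr a b)

lemma dsum_l {m r : ℕ} (a : Equiv.Perm (Fin m)) (b : Equiv.Perm (Fin r)) (i : Fin m) :
    dsum a b (Fin.castAdd r i) = Fin.castAdd r (a i) := by
  simp [dsum, Equiv.permCongr_apply]

lemma dsum_r {m r : ℕ} (a : Equiv.Perm (Fin m)) (b : Equiv.Perm (Fin r)) (i : Fin r) :
    dsum a b (Fin.natAdd m i) = Fin.natAdd m (b i) := by
  simp [dsum, Equiv.permCongr_apply]

lemma dsum_inj {m r : ℕ} {a a' : Equiv.Perm (Fin m)} {b b' : Equiv.Perm (Fin r)}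
    (h : dsum a b = dsum a' b') : a = a' ∧ b = b' := by
  constructor
  · ext i
    have := dsum_l a b i
    rw [h, dsum_l] at this
    simpa using (congrArg Fin.val this).symm
  · ext i
    have := dsum_r a b i
    rw [h, dsum_r] at this
    simpa using (congrArg Fin.val this).symm

lemma dsum_surj {m r : ℕ} (σ : Equiv.Perm (Fin (m+r))) (h : ∀ i : Fin (m+r), (i : ℕ) < m → (σ i : ℕ) < m) :
    ∃ a b, σ = dsum a b := by
  have : finSumFinEquiv.symm.permCongr σ ∈ (Equiv.Perm.sumCongrHom (Fin m) (Fin r)).range := by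
    apply Equiv.Perm.mem_sumCongrHom_range_of_perm_mapsTo_inl
    rintro _ ⟨i, rfl⟩
    have hi := h (Fin.castAdd r i) (by simp)
    refine ⟨⟨_, hi⟩, ?_⟩
    rw [Equiv.permCongr_apply, Equiv.eq_symm_apply]
    simp
  obtain ⟨⟨a, b⟩, hab⟩ := this
  refine ⟨a, b, ?_⟩
  rw [dsum]
  have h2 : Equiv.sumCongr a b = finSumFinEquiv.symm.permCongr σ := hab
  rw [h2]
  ext i
  simp [Equiv.permCongr_apply]

lemma dsum_av {m r : ℕ} (a : Equiv.Perm (Fin m)) (b : Equiv.Perm (Fin r)) :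
    Av (dsum a b) ↔ Av a ∧ Av b := by
  constructor
  · intro h
    constructor
    · intro i j k hij hjk h1 h2
      refine h (Fin.castAdd r i) (Fin.castAdd r j) (Fin.castAdd r k) (by simpa) (by simpa) ?_ ?_ <;>
      · rw [dsum_l, dsum_l]; simpa
    · intro i j k hij hjk h1 h2
      refine h (Fin.natAdd m i) (Fin.natAdd m j) (Fin.natAdd m k) (by simpa) (by simpa) ?_ ?_ <;>
      · rw [dsum_r, dsum_r]; simpa
  · rintro ⟨ha, hb⟩ i j k hij hjk h1 h2
    induction i using Fin.addCases with
    | left i =>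
      induction j using Fin.addCases with
      | left j =>
        induction k using Fin.addCases with
        | left k =>
          rw [dsum_l, dsum_l] at h1 h2
          exact ha i j k hij hjk h1 h2
        | right k =>
          rw [dsum_l, dsum_r] at h2
          simp [Fin.lt_def] at h2; omega
      | right j =>
        rw [dsum_l, dsum_r] at h1
        simp [Fin.lt_def] at h1; omega
    | right i =>
      induction j using Fin.addCases with
      | left j => simp [Fin.lt_def] at hij; omega
      | right j =>
        induction k using Fin.addCases with
        | left k => simp [Fin.lt_def] at hjk; omega
        | right k =>
          rw [dsum_r, dsum_r] at h1 h2
          exact hb i j k (by simpa using hij) (by simpa using hjk) (by simpa using h1) (by simpa using h2)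

def Cl {n : ℕ} (l m : ℕ) (σ : Equiv.Perm (Fin n)) : Prop :=
  ∃ a, a + l ≤ n ∧ ∀ i : Fin n, (a ≤ (i : ℕ) ∧ (i : ℕ) < a + l) ↔ (m ≤ (σ i : ℕ) ∧ (σ i : ℕ) < m + l)

lemma R_Cl {n : ℕ} (l m : ℕ) (hl : 1 ≤ l) (σ : Equiv.Perm (Fin n)) (h : R l m σ) : Cl l m σ := by
  obtain ⟨a, ha⟩ := h
  refine ⟨a, ?_, fun i => ⟨?_, ?_⟩⟩
  · obtain ⟨h, _⟩ := ha (l-1) (by omega)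
    omega
  · rintro ⟨h1, h2⟩
    obtain ⟨h, e⟩ := ha (i-a) (by omega)
    have : (⟨a + (i-a), h⟩ : Fin n) = i := Fin.ext (by simp; omega)
    rw [this] at e
    omega
  · rintro ⟨h1, h2⟩
    obtain ⟨h, e⟩ := ha (σ i-m) (by omega)
    have : (⟨a + (σ i-m), h⟩ : Fin n) = i := σ.injective (Fin.ext (by rw [e]; omega))
    have := congrArg Fin.val this
    simp at this
    omega

lemma mono_id (l m : ℕ) (f : ℕ → ℕ) (hf : ∀ i < l, m ≤ f i ∧ f i < m + l)
    (hm : ∀ i j, i < j → j < l → f i < f j) : ∀ i < l, f i = m + i := by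
  have lo : ∀ i < l, m + i ≤ f i := by
    intro i
    induction i with
    | zero => intro h; exact (hf 0 h).1
    | succ i ih => intro h; have := ih (by omega); have := hm i (i+1) (by omega) h; omega
  have hi : ∀ d < l, f (l - 1 - d) + d < m + l := by
    intro d
    induction d with
    | zero => intro h; exact (hf _ (by omega)).2
    | succ d ih =>
      intro h; have := ih (by omega); have := hm (l-1-(d+1)) (l-1-d) (by omega) (by omega); omega
  intro i h
  have h1 := lo i h
  have h2 := hi (l-1-i) (by omega)
  rw [show l-1-(l-1-i) = i by omega] at h2
  omega

lemma card_aux {n : ℕ} (σ : Equiv.Perm (Fin n)) (a m : ℕ) (ha : a ≤ n)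
    (h : ∀ i : Fin n, (i : ℕ) < a → (σ i : ℕ) < m) : a ≤ m := by
  have := Fintype.card_le_of_injective (fun x : Fin a =>
    (⟨σ ⟨x, by omega⟩, h ⟨x, by omega⟩ x.2⟩ : Fin m)) (by
      intro x y hxy
      have h1 := congrArg Fin.val hxy
      have h2 := σ.injective (Fin.ext h1)
      exact Fin.ext (Fin.mk.inj_iff.1 h2))
  simpa using this

lemma struct {m l r : ℕ} (σ : Equiv.Perm (Fin (m+l+r))) (hA : Av σ) (hC : Cl l m σ)
    (hR : ¬ R l m σ) : ∃ a b c, σ = dsum (dsum a b) c := by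
  obtain ⟨a, han, ha⟩ := hC
  obtain ⟨x, y, hxy, hx, hy, hs⟩ : ∃ x y : Fin (m+l+r), x < y ∧ (a ≤ (x : ℕ) ∧ (x : ℕ) < a + l) ∧
      (a ≤ (y : ℕ) ∧ (y : ℕ) < a + l) ∧ σ y < σ x := by
    by_contra hc
    push Not at hc
    apply hR
    let f : ℕ → ℕ := fun i => if h : a + i < m+l+r then (σ ⟨a+i, h⟩ : ℕ) else 0
    have hf : ∀ i (h : a + i < m+l+r), f i = σ ⟨a+i, h⟩ := fun i h => by simp [f, h]
    have := mono_id l m f (fun i hi => by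
        rw [hf i (by omega)]
        exact (ha ⟨a+i, by omega⟩).1 ⟨by simp, by simpa⟩) (fun i j hij hj => by
        rw [hf i (by omega), hf j (by omega)]
        have h1 := hc ⟨a+i, by omega⟩ ⟨a+j, by omega⟩ (by simpa) ⟨by simp, by simp; omega⟩
          ⟨by simp, by simpa⟩
        refine lt_of_le_of_ne h1 fun e => ?_
        have := congrArg Fin.val (σ.injective (Fin.ext e))
        simp at this; omega)
    exact ⟨a, fun i hi => ⟨by omega, by rw [← hf i, this i hi]⟩⟩
  have hvx := (ha x).1 hx
  have hvy := (ha y).1 hy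
  have h1 : ∀ i : Fin (m+l+r), (i : ℕ) < a → (σ i : ℕ) < m := by
    intro i hi
    by_contra hc
    have hn : ¬ (m ≤ (σ i : ℕ) ∧ (σ i : ℕ) < m + l) := by rw [← ha i]; omega
    exact hA i x y (by rw [Fin.lt_def]; omega) hxy (by rw [Fin.lt_def]; omega) hs
  have h2 : ∀ i : Fin (m+l+r), a + l ≤ (i : ℕ) → m + l ≤ (σ i : ℕ) := by
    intro i hi
    by_contra hc
    have hn : ¬ (m ≤ (σ i : ℕ) ∧ (σ i : ℕ) < m + l) := by rw [← ha i]; omega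
    exact hA x y i hxy (by rw [Fin.lt_def]; omega) hs (by rw [Fin.lt_def]; omega)
  have h3 : a ≤ m := card_aux σ a m (by omega) h1
  have h4 : m + l ≤ a + l := card_aux σ.symm (m+l) (a+l) (by omega) (by
    intro i hi
    by_contra hc
    have := h2 (σ.symm i) (by omega)
    rw [Equiv.apply_symm_apply] at this
    omega)
  have ham : a = m := by omega
  subst ham
  obtain ⟨σ', c, rfl⟩ := dsum_surj σ (by
    intro i hi
    by_cases h : (i : ℕ) < a
    · have := h1 i h; omega
    · exact ((ha i).1 (by omega)).2)
  obtain ⟨p, q, rfl⟩ := dsum_surj σ' (by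
    intro i hi
    have := h1 (Fin.castAdd r i) (by simpa)
    rw [dsum_l] at this
    simpa using this)
  exact ⟨p, q, c, rfl⟩

lemma tri_mid {m l r : ℕ} (a : Equiv.Perm (Fin m)) (b : Equiv.Perm (Fin l)) (c : Equiv.Perm (Fin r))
    (i : Fin l) : dsum (dsum a b) c (Fin.castAdd r (Fin.natAdd m i)) =
      Fin.castAdd r (Fin.natAdd m (b i)) := by
  rw [dsum_l, dsum_r]

lemma tri_Cl {m l r : ℕ} (a : Equiv.Perm (Fin m)) (b : Equiv.Perm (Fin l)) (c : Equiv.Perm (Fin r)) :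
    Cl l m (dsum (dsum a b) c) := by
  refine ⟨m, by omega, fun i => ?_⟩
  induction i using Fin.addCases with
  | left i =>
    induction i using Fin.addCases with
    | left i => rw [dsum_l, dsum_l]; simp; omega
    | right i => rw [dsum_l, dsum_r]; simp
  | right i => rw [dsum_r]; simp

lemma tri_R {m l r : ℕ} (hl : 1 ≤ l) (a : Equiv.Perm (Fin m)) (b : Equiv.Perm (Fin l))
    (c : Equiv.Perm (Fin r)) : R l m (dsum (dsum a b) c) ↔ b = 1 := by
  constructor
  · rintro ⟨p, hp⟩
    have pos : ∀ (t : Fin l) (s : ℕ) (h : s < m + l + r),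
        (dsum (dsum a b) c ⟨s, h⟩ : ℕ) = m + t → s = m + b.symm t := by
      intro t s h e
      have h1 := tri_mid a b c (b.symm t)
      rw [Equiv.apply_symm_apply] at h1
      have : (⟨s, h⟩ : Fin (m+l+r)) = Fin.castAdd r (Fin.natAdd m (b.symm t)) := by
        apply (dsum (dsum a b) c).injective
        rw [h1]
        exact Fin.ext e
      simpa using congrArg Fin.val this
    have hpm : p = m := by
      obtain ⟨h0, e0⟩ := hp 0 (by omega)
      obtain ⟨h1, e1⟩ := hp (l-1) (by omega)
      have f0 := pos ⟨0, by omega⟩ _ h0 e0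
      have f1 := pos ⟨l-1, by omega⟩ _ h1 e1
      omega
    subst hpm
    apply Equiv.ext
    intro i
    obtain ⟨h0, e0⟩ := hp i i.2
    have f0 := pos i _ h0 e0
    have : i = b.symm i := Fin.ext (by omega)
    rw [Equiv.Perm.one_apply]
    conv_lhs => rw [this]
    simp
  · rintro rfl
    refine ⟨m, fun i hi => ⟨by omega, ?_⟩⟩
    have := congrArg Fin.val (tri_mid a 1 c ⟨i, hi⟩)
    simpa using this

lemma one_av (l : ℕ) : Av (1 : Equiv.Perm (Fin l)) := by
  intro i j k hij hjk h1 h2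
  exact absurd hij (not_lt.2 h1.le)

lemma card_main (m l r : ℕ) (hl : 1 ≤ l) :
    {σ : Equiv.Perm (Fin (m+l+r)) | Cl l m σ ∧ Av σ}.ncard =
      catalan (m+r+1) + catalan m * catalan r * (catalan l - 1) := by
  have hsplit : {σ : Equiv.Perm (Fin (m+l+r)) | Cl l m σ ∧ Av σ} =
      {σ | Av σ ∧ R l m σ} ∪
      (fun x : Equiv.Perm (Fin m) × Equiv.Perm (Fin r) × Equiv.Perm (Fin l) =>
        dsum (dsum x.1 x.2.2) x.2.1) '' ({a | Av a} ×ˢ ({c | Av c} ×ˢ ({b | Av b} \ {1}))) := by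
    ext σ
    constructor
    · rintro ⟨hC, hA⟩
      by_cases hR : R l m σ
      · exact Or.inl ⟨hA, hR⟩
      · right
        obtain ⟨a, b, c, rfl⟩ := struct σ hA hC hR
        rw [tri_R hl] at hR
        rw [dsum_av, dsum_av] at hA
        exact ⟨(a, c, b), ⟨hA.1.1, hA.2, hA.1.2, hR⟩, rfl⟩
    · rintro (⟨hA, hR⟩ | ⟨⟨a, c, b⟩, ⟨ha, hc, hb, hne⟩, rfl⟩)
      · exact ⟨R_Cl l m hl σ hR, hA⟩
      · refine ⟨tri_Cl _ _ _, ?_⟩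
        rw [dsum_av, dsum_av]
        exact ⟨⟨ha, hb⟩, hc⟩
  rw [hsplit, Set.ncard_union_eq, Set.ncard_image_of_injective, Set.ncard_prod, Set.ncard_prod,
    Set.ncard_sdiff_singleton_of_mem (one_av l), card_Av, card_Av, card_Av, mul_assoc]
  · congr 1
    obtain ⟨l, rfl⟩ : ∃ t, l = t + 1 := ⟨l-1, by omega⟩
    have := card_R l (m+r+1) m (by omega)
    rw [← this]
    have e : m + (l+1) + r = m+r+1+l := by omega
    rw [e]
  · rintro ⟨a, c, b⟩ ⟨a', c', b'⟩ h
    obtain ⟨h1, rfl⟩ := dsum_inj h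
    simp only at h1
    obtain ⟨rfl, rfl⟩ := dsum_inj h1
    rfl
  · rw [Set.disjoint_left]
    rintro σ ⟨_, hR⟩ ⟨⟨a, c, b⟩, ⟨ha, hc, hb, hne⟩, rfl⟩
    exact hne ((tri_R hl _ _ _).1 hR)

lemma clusterAt_iff {n : ℕ} (l m a : ℕ) (hm : m + l ≤ n) (σ : Equiv.Perm (Fin n)) :
    ClusterAt l (m+1) (a+1) σ ↔
      ∀ i : Fin n, (a ≤ (i : ℕ) ∧ (i : ℕ) < a + l) ↔ (m ≤ (σ i : ℕ) ∧ (σ i : ℕ) < m + l) := by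
  unfold ClusterAt
  constructor
  · intro h i
    have h' := Finset.ext_iff.1 h (σ i + 1)
    simp only [Finset.mem_image, Finset.mem_filter, Finset.mem_univ, true_and, Finset.mem_Ico] at h'
    constructor
    · rintro ⟨h1, h2⟩
      have := h'.1 ⟨i, ⟨by omega, by omega⟩, rfl⟩
      omega
    · rintro ⟨h1, h2⟩
      obtain ⟨j, hj, e⟩ := h'.2 ⟨by omega, by omega⟩
      have : j = i := σ.injective (Fin.ext (by omega))
      subst this
      omega
  · intro h
    ext y
    simp only [Finset.mem_image, Finset.mem_filter, Finset.mem_univ, true_and, Finset.mem_Ico]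
    constructor
    · rintro ⟨j, hj, rfl⟩
      have := (h j).1 (by omega)
      omega
    · rintro ⟨h1, h2⟩
      refine ⟨σ.symm ⟨y-1, by omega⟩, ?_, ?_⟩
      · have := (h (σ.symm ⟨y-1, by omega⟩)).2 (by simp; omega)
        omega
      · simp; omega

lemma cluster_iff {n : ℕ} (l m : ℕ) (hm : m + l ≤ n) (σ : Equiv.Perm (Fin n)) :
    σ ∈ ClusterEvent n l (m+1) ↔ Cl l m σ := by
  constructor
  · rintro ⟨a, h1, h2, h3⟩
    obtain ⟨a, rfl⟩ : ∃ t, a = t + 1 := ⟨a-1, by omega⟩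
    exact ⟨a, by omega, (clusterAt_iff l m a hm σ).1 h3⟩
  · rintro ⟨a, h1, h2⟩
    exact ⟨a+1, by omega, by omega, (clusterAt_iff l m a hm σ).2 h2⟩

lemma avoid_iff {n : ℕ} (σ : Equiv.Perm (Fin n)) : σ ∈ AvoidSet n perm321 ↔ Av σ := by
  change ¬ Contains _ _ ↔ _
  constructor
  · intro h i j k hij hjk h1 h2
    apply h
    refine ⟨![i, j, k], ?_, ?_⟩
    · intro x y hxy
      fin_cases x <;> fin_cases y <;> simp at hxy ⊢ <;> first | assumption | exact hij.trans hjk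
    · have h3 := h2.trans h1
      intro x y
      fin_cases x <;> fin_cases y <;> simp [perm321, h1, h2, h3, h1.le, h2.le, h3.le]
  · rintro h ⟨f, hf, hp⟩
    exact h (f 0) (f 1) (f 2) (hf (by decide)) (hf (by decide)) ((hp 1 0).2 (by decide))
      ((hp 2 1).2 (by decide))

lemma avoid_iff' {n : ℕ} (σ : Equiv.Perm (Fin n)) :
    σ ∈ AvoidSet n perm123 ↔ Av (Fin.revPerm.trans σ) := by
  change ¬ Contains _ _ ↔ _
  constructor
  · intro h i j k hij hjk h1 h2
    apply h
    have hij' := Fin.rev_lt_rev.2 hij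
    have hjk' := Fin.rev_lt_rev.2 hjk
    simp only [Equiv.trans_apply, Fin.revPerm_apply] at h1 h2
    refine ⟨![k.rev, j.rev, i.rev], ?_, ?_⟩
    · intro x y hxy
      fin_cases x <;> fin_cases y <;> simp at hxy ⊢ <;> first | assumption | exact hij.trans hjk
    · have h3 := h2.trans h1
      intro x y
      fin_cases x <;> fin_cases y <;> simp [perm123, h1, h2, h3, h1.le, h2.le, h3.le]
  · rintro h ⟨f, hf, hp⟩
    refine h (f 2).rev (f 1).rev (f 0).rev (Fin.rev_lt_rev.2 (hf (by decide)))
      (Fin.rev_lt_rev.2 (hf (by decide))) ?_ ?_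
    · simpa using ((hp 1 2).2 (by decide))
    · simpa using ((hp 0 1).2 (by decide))

lemma Cl_rev {n l m : ℕ} (σ : Equiv.Perm (Fin n)) (h : Cl l m σ) : Cl l m (Fin.revPerm.trans σ) := by
  obtain ⟨a, h1, h2⟩ := h
  refine ⟨n - l - a, by omega, fun i => ?_⟩
  rw [Equiv.trans_apply, Fin.revPerm_apply, ← h2, Fin.val_rev]
  omega

def revE (n : ℕ) : Equiv.Perm (Fin n) → Equiv.Perm (Fin n) := fun σ => Fin.revPerm.trans σ

lemma revE_revE (n : ℕ) (σ : Equiv.Perm (Fin n)) : revE n (revE n σ) = σ := by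
  ext i; simp [revE]

lemma revE_inj (n : ℕ) : Function.Injective (revE n) :=
  Function.LeftInverse.injective (g := revE n) (fun x => revE_revE n x)

lemma image_rev {n : ℕ} (S T : Set (Equiv.Perm (Fin n))) (h : ∀ σ, σ ∈ S ↔ revE n σ ∈ T) :
    S.ncard = T.ncard := by
  rw [← Set.ncard_image_of_injective S (revE_inj n)]
  congr 1
  ext σ
  constructor
  · rintro ⟨ρ, h1, rfl⟩; exact (h ρ).1 h1
  · intro hσ; exact ⟨revE n σ, (h _).2 (by rwa [revE_revE]), revE_revE n σ⟩

lemma Cl_rev_iff {n l m : ℕ} (σ : Equiv.Perm (Fin n)) : Cl l m σ ↔ Cl l m (revE n σ) := by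
  refine ⟨Cl_rev σ, fun h => ?_⟩
  have := Cl_rev _ h
  change Cl l m (revE n (revE n σ)) at this
  rwa [revE_revE] at this

end CX

/-- exact count (and probability) for `τ ∈ {123, 321}`, in terms of
Catalan numbers. -/
theorem avoid123or321_cluster_exact (τ : Equiv.Perm (Fin 3))
    (hτ : τ = perm123 ∨ τ = perm321)
    (n : ℕ) (hn : 3 ≤ n) (l : ℕ) (hl2 : 2 ≤ l) (hln : l ≤ n - 1)
    (k : ℕ) (hk1 : 1 ≤ k) (hk2 : k ≤ n - l + 1) :
    (ClusterEvent n l k ∩ AvoidSet n τ).ncard =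
      catalan (n - l + 1) + catalan (k - 1) * catalan (n + 1 - k - l) * (catalan l - 1) ∧
    ((ClusterEvent n l k ∩ AvoidSet n τ).ncard : ℝ) / ((AvoidSet n τ).ncard : ℝ) =
      ((catalan (n - l + 1) + catalan (k - 1) * catalan (n + 1 - k - l) * (catalan l - 1) : ℕ) : ℝ) /
        (catalan n : ℝ) := by
  have hA : (AvoidSet n τ).ncard = catalan n := by
    rw [← CX.card_Av]
    rcases hτ with rfl | rfl
    · exact CX.image_rev _ _ fun σ => CX.avoid_iff' σ
    · congr 1; ext σ; exact CX.avoid_iff σ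
  have hC : (ClusterEvent n l k ∩ AvoidSet n τ).ncard =
      catalan (n - l + 1) + catalan (k - 1) * catalan (n + 1 - k - l) * (catalan l - 1) := by
    obtain ⟨m, rfl⟩ : ∃ m, k = m + 1 := ⟨k-1, by omega⟩
    obtain ⟨r, rfl⟩ : ∃ r, n = m + l + r := ⟨n-m-l, by omega⟩
    have h := CX.card_main m l r (by omega)
    rw [show m + l + r - l + 1 = m + r + 1 by omega, show m + 1 - 1 = m by omega,
      show m + l + r + 1 - (m+1) - l = r by omega, ← h]
    rcases hτ with rfl | rfl
    · exact CX.image_rev _ _ fun σ => and_congr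
        ((CX.cluster_iff l m (by omega) σ).trans (CX.Cl_rev_iff σ)) (CX.avoid_iff' σ)
    · congr 1; ext σ
      exact and_congr (CX.cluster_iff l m (by omega) σ) (CX.avoid_iff σ)
  exact ⟨hC, by rw [hA, hC]⟩
end

section
/- Let τ ∈ {123, 321} ⊂ S_3, and fix l ≥ 2 and k ≥ 1. Then lim_{n→∞} |A^{(n)}_{l;k} ∩ S_n(τ)| / |S_n(τ)| = 1/4^{l-1} + C_{k-1}·(C_l - 1)/4^{k+l-1}, and moreover lim_{n→∞} |A^{(n)}_{l;n+2-k-l} ∩ S_n(τ)| / |S_n(τ)| equals the same value 1/4^{l-1} + C_{k-1}·(C_l - 1)/4^{k+l-1}. -/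
open Filter

namespace CL
open Equiv

def Av {n : ℕ} (σ : Perm (Fin n)) : Prop :=
  ∀ i j k : Fin n, i < j → j < k → σ k < σ j → σ j < σ i → False

def IncFrom {n : ℕ} (m : ℕ) (σ : Perm (Fin n)) : Prop :=
  ∀ i j : Fin n, m ≤ (i : ℕ) → i < j → σ i < σ j

def ins {n : ℕ} (p v : Fin (n+1)) (ρ : Perm (Fin n)) : Perm (Fin (n+1)) :=
  (finSuccEquiv' p).trans ((Equiv.optionCongr ρ).trans (finSuccEquiv' v).symm)

lemma ins_same {n : ℕ} (p v : Fin (n+1)) (ρ : Perm (Fin n)) : ins p v ρ p = v := by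
  simp [ins]

lemma ins_succAbove {n : ℕ} (p v : Fin (n+1)) (ρ : Perm (Fin n)) (i : Fin n) :
    ins p v ρ (p.succAbove i) = v.succAbove (ρ i) := by
  simp [ins]

lemma ins_surj {n : ℕ} (p v : Fin (n+1)) (σ : Perm (Fin (n+1))) (h : σ p = v) :
    ∃ ρ, ins p v ρ = σ := by
  let e : Option (Fin n) ≃ Option (Fin n) :=
    (finSuccEquiv' p).symm.trans (σ.trans (finSuccEquiv' v))
  have he : e none = none := by simp [e, h]
  refine ⟨Equiv.removeNone e, ?_⟩
  have h2 : ∀ i, some (Equiv.removeNone e i) = e (some i) := by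
    intro i
    apply Equiv.removeNone_some
    rcases hx : e (some i) with _ | y
    · rw [← he] at hx
      exact absurd (e.injective hx) (by simp)
    · exact ⟨y, rfl⟩
  ext x : 1
  rcases Fin.eq_self_or_eq_succAbove p x with rfl | ⟨i, rfl⟩
  · rw [ins_same, h]
  · rw [ins_succAbove]
    have := h2 i
    simp only [e, Equiv.trans_apply, finSuccEquiv'_symm_some] at this
    rw [← finSuccEquiv'_symm_some, this, Equiv.symm_apply_apply]

lemma ins_inj {n : ℕ} (p v : Fin (n+1)) : Function.Injective (ins p v) := by
  intro ρ ρ' h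
  ext i : 1
  have := congrArg (fun s : Perm (Fin (n+1)) => s (p.succAbove i)) h
  simp only [ins_succAbove] at this
  exact Fin.succAbove_right_injective this

lemma Av_of_ins {n : ℕ} {p v : Fin (n+1)} {ρ : Perm (Fin n)} (h : Av (ins p v ρ)) : Av ρ := by
  intro i j k hij hjk h1 h2
  have s := Fin.strictMono_succAbove p
  have s' := Fin.strictMono_succAbove v
  refine h _ _ _ (s hij) (s hjk) ?_ ?_ <;> rw [ins_succAbove, ins_succAbove]
  · exact s' h1
  · exact s' h2

lemma succAbove_gt {n : ℕ} {p : Fin (n+1)} {i : Fin n} (h : (p:ℕ) ≤ i) :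
    ((p.succAbove i : Fin (n+1)) : ℕ) = i + 1 := by
  rw [Fin.succAbove_of_le_castSucc]; · simp
  simpa [Fin.le_def] using h

lemma succAbove_lt {n : ℕ} {p : Fin (n+1)} {i : Fin n} (h : (i:ℕ) < p) :
    ((p.succAbove i : Fin (n+1)) : ℕ) = i := by
  rw [Fin.succAbove_of_castSucc_lt]; · simp
  simpa [Fin.lt_def] using h

lemma Av_ins_last {n : ℕ} (p : Fin (n+1)) (ρ : Perm (Fin n)) :
    Av (ins p (Fin.last n) ρ) ↔ Av ρ ∧ IncFrom p ρ := by
  constructor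
  · intro h
    refine ⟨Av_of_ins h, ?_⟩
    intro i j hi hij
    by_contra hc
    have hne : ρ i ≠ ρ j := fun e => hij.ne (ρ.injective e)
    have hlt : ρ j < ρ i := lt_of_le_of_ne (not_lt.mp hc) hne.symm
    refine h p (p.succAbove i) (p.succAbove j) ?_ (Fin.strictMono_succAbove p hij) ?_ ?_
    · rw [Fin.lt_def, succAbove_gt hi]; omega
    · rw [ins_succAbove, ins_succAbove]; exact Fin.strictMono_succAbove _ hlt
    · rw [ins_same, ins_succAbove, Fin.succAbove_last]; exact Fin.castSucc_lt_last _
  · rintro ⟨h, hI⟩ i j k hij hjk h1 h2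
    rcases Fin.eq_self_or_eq_succAbove p k with rfl | ⟨k, rfl⟩
    · rw [ins_same] at h1; exact absurd h1 (Fin.le_last _).not_gt
    rcases Fin.eq_self_or_eq_succAbove p j with rfl | ⟨j, rfl⟩
    · rw [ins_same] at h2; exact absurd h2 (Fin.le_last _).not_gt
    have s := Fin.strictMono_succAbove p
    have s' := Fin.strictMono_succAbove (Fin.last n)
    rw [ins_succAbove, ins_succAbove] at h1
    rw [s'.lt_iff_lt] at h1
    rw [s.lt_iff_lt] at hjk
    rcases Fin.eq_self_or_eq_succAbove p i with rfl | ⟨i, rfl⟩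
    · refine absurd h1 (hI j k ?_ hjk).not_gt
      by_contra hc
      rw [Fin.lt_def, succAbove_lt (not_le.mp hc)] at hij
      omega
    · rw [ins_succAbove, ins_succAbove, s'.lt_iff_lt] at h2
      rw [s.lt_iff_lt] at hij
      exact h i j k hij hjk h1 h2

noncomputable def F (n m : ℕ) : ℕ := {σ : Perm (Fin n) | Av σ ∧ IncFrom m σ}.ncard

lemma ncard_insert_sum {n : ℕ} (P : Perm (Fin (n+1)) → Prop) :
    {σ | P σ}.ncard = ∑ p : Fin (n+1), {ρ : Perm (Fin n) | P (ins p (Fin.last n) ρ)}.ncard := by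
  classical
  have h1 : {σ | P σ}.ncard = (Finset.univ.filter fun σ => P σ).card := by
    rw [← Set.ncard_coe_finset]; congr 1; ext; simp
  rw [h1, Finset.card_eq_sum_card_fiberwise (f := fun σ => σ.symm (Fin.last n)) (t := Finset.univ)
    (by intro x _; simp)]
  refine Finset.sum_congr rfl fun p _ => ?_
  rw [← Set.ncard_coe_finset, ← Set.ncard_image_of_injective _ (ins_inj p (Fin.last n))]
  congr 1
  ext σ
  simp only [Finset.coe_filter, Finset.mem_filter, Finset.mem_univ, true_and, Set.mem_ofPred_eq,
    Set.mem_image]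
  constructor
  · rintro ⟨h, hp⟩
    obtain ⟨ρ, rfl⟩ := ins_surj p (Fin.last n) σ (by rw [← hp]; simp)
    exact ⟨ρ, h, rfl⟩
  · rintro ⟨ρ, h, rfl⟩
    refine ⟨h, ?_⟩
    rw [Equiv.symm_apply_eq, ins_same]

lemma IncFrom.mono {n m m' : ℕ} {σ : Perm (Fin n)} (h : IncFrom m σ) (hm : m ≤ m') :
    IncFrom m' σ := fun i j hi hij => h i j (hm.trans hi) hij

lemma IncFrom_ins_lt {n m : ℕ} {p : Fin (n+1)} {ρ : Perm (Fin n)} (hp : (p:ℕ) < m)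
    (h : IncFrom p ρ) : IncFrom m (ins p (Fin.last n) ρ) := by
  intro i j hi hij
  rcases Fin.eq_self_or_eq_succAbove p i with rfl | ⟨i, rfl⟩
  · omega
  rcases Fin.eq_self_or_eq_succAbove p j with rfl | ⟨j, rfl⟩
  · rw [Fin.lt_def] at hij; omega
  rw [ins_succAbove, ins_succAbove]
  apply Fin.strictMono_succAbove
  rw [(Fin.strictMono_succAbove p).lt_iff_lt] at hij
  refine h i j ?_ hij
  by_contra hc
  rw [succAbove_lt (not_le.mp hc)] at hi
  omega

lemma IncFrom_ins_last {n m : ℕ} {ρ : Perm (Fin n)} :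
    IncFrom m (ins (Fin.last n) (Fin.last n) ρ) ↔ IncFrom m ρ := by
  constructor
  · intro h i j hi hij
    have := h ((Fin.last n).succAbove i) ((Fin.last n).succAbove j) (by simpa using hi)
      (Fin.strictMono_succAbove _ hij)
    rw [ins_succAbove, ins_succAbove] at this
    exact (Fin.strictMono_succAbove _).lt_iff_lt.mp this
  · intro h i j hi hij
    rcases Fin.eq_self_or_eq_succAbove (Fin.last n) i with rfl | ⟨i, rfl⟩
    · exact absurd hij (Fin.le_last _).not_gt
    rcases Fin.eq_self_or_eq_succAbove (Fin.last n) j with rfl | ⟨j, rfl⟩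
    · rw [ins_same, ins_succAbove, Fin.succAbove_last]; exact Fin.castSucc_lt_last _
    rw [ins_succAbove, ins_succAbove]
    apply Fin.strictMono_succAbove
    rw [(Fin.strictMono_succAbove _).lt_iff_lt] at hij
    exact h i j (by simpa using hi) hij

lemma not_IncFrom_ins {n m : ℕ} {p : Fin n} {ρ : Perm (Fin n)} (hp : m ≤ (p:ℕ)) :
    ¬ IncFrom m (ins p.castSucc (Fin.last n) ρ) := by
  intro h
  have := h p.castSucc (Fin.last n) (by simpa using hp) (Fin.castSucc_lt_last _)
  rw [ins_same] at this
  exact absurd this (Fin.le_last _).not_gt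

lemma F_rec (n m : ℕ) (h : m ≤ n) :
    F (n+1) m = ∑ p ∈ Finset.range (m+1), F n p := by
  rw [F, ncard_insert_sum, Fin.sum_univ_castSucc, Finset.sum_range_succ]
  congr 1
  · have : ∀ p : Fin n, {ρ : Perm (Fin n) | Av (ins p.castSucc (Fin.last n) ρ) ∧
        IncFrom m (ins p.castSucc (Fin.last n) ρ)}.ncard = (fun p : ℕ => if p < m then F n p else 0) p := by
      intro p
      dsimp only
      split_ifs with hp
      · rw [F]; congr 1; ext ρ
        simp only [Set.mem_ofPred_eq, Av_ins_last]
        constructor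
        · rintro ⟨h, _⟩; simpa using h
        · intro h; exact ⟨by simpa using h, IncFrom_ins_lt (by simpa using hp) (by simpa using h.2)⟩
      · rw [Set.ncard_eq_zero, Set.eq_empty_iff_forall_notMem]
        intro ρ
        exact fun h => not_IncFrom_ins (not_lt.mp hp) h.2
    simp only [this]
    rw [Fin.sum_univ_eq_sum_range (fun p : ℕ => if p < m then F n p else 0), ← Finset.sum_filter]
    refine Finset.sum_congr ?_ fun _ _ => rfl
    ext x; simp; omega
  · rw [F]; congr 1; ext ρ
    simp only [Set.mem_ofPred_eq, Av_ins_last, IncFrom_ins_last]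
    constructor
    · rintro ⟨h, h'⟩; exact ⟨h.1, h'⟩
    · rintro ⟨h1, h'⟩; exact ⟨⟨h1, h'.mono h⟩, h'⟩

lemma F_diag (n : ℕ) : F (n+1) (n+1) = F (n+1) n := by
  rw [F, F]; congr 1; ext σ
  simp only [Set.mem_ofPred_eq]
  refine and_congr_right fun _ => ⟨?_, fun h => h.mono (by omega)⟩
  intro h i j hi hij
  rw [Fin.lt_def] at hij
  omega

lemma F_closed (n : ℕ) : ∀ m ≤ n, F n m + (n+m).choose (n+1) = (n+m).choose n := by
  induction n with
  | zero =>
    intro m hm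
    obtain rfl : m = 0 := by omega
    have : {σ : Perm (Fin 0) | Av σ ∧ IncFrom 0 σ} = {1} := by
      ext σ; simp only [Set.mem_ofPred_eq, Set.mem_singleton_iff]
      exact ⟨fun _ => Subsingleton.elim _ _, fun _ => ⟨fun i => i.elim0, fun i => i.elim0⟩⟩
    simp [F, this]
  | succ n ih =>
    have key : ∀ m ≤ n, F (n+1) m + (n+1+m).choose (n+1+1) = (n+1+m).choose (n+1) := by
      intro m
      induction m with
      | zero =>
        intro _
        rw [F_rec n 0 (by omega)]
        have := ih 0 (by omega)
        simp at this ⊢; omega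
      | succ m ihm =>
        intro hm
        have h1 := ihm (by omega)
        have h2 := ih (m+1) hm
        rw [F_rec n m (by omega)] at h1
        rw [F_rec n (m+1) hm, Finset.sum_range_succ]
        have e1 := Nat.choose_succ_succ (n+m+1) (n+1)
        have e2 := Nat.choose_succ_succ (n+m+1) n
        have r1 : n+1+(m+1) = n+m+1+1 := by ring
        have r2 : n+1+m = n+m+1 := by ring
        have r3 : n+(m+1) = n+m+1 := by ring
        rw [r1]; rw [r2] at h1; rw [r3] at h2
        simp only [Nat.succ_eq_add_one] at e1 e2
        omega
    intro m hm
    rcases Nat.lt_or_ge m (n+1) with h | h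
    · exact key m (by omega)
    · obtain rfl : m = n+1 := by omega
      rw [F_diag]
      have h1 := key n le_rfl
      have r1 : n+1+(n+1) = 2*n+1+1 := by ring
      have r2 : n+1+n = 2*n+1 := by ring
      rw [r1]; rw [r2] at h1
      have e1 := Nat.choose_succ_succ (2*n+1) (n+1)
      have e2 := Nat.choose_succ_succ (2*n+1) n
      have e3 := Nat.choose_symm_half n
      simp only [Nat.succ_eq_add_one] at e1 e2
      omega

lemma card_Av (n : ℕ) : {σ : Perm (Fin n) | Av σ}.ncard = catalan n := by
  have h : {σ : Perm (Fin n) | Av σ}.ncard = F n n := by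
    rw [F]; congr 1; ext σ
    simp only [Set.mem_ofPred_eq]
    exact ⟨fun h => ⟨h, fun i j hi => by omega⟩, fun h => h.1⟩
  rw [h]
  have h1 := F_closed n n le_rfl
  have h2 := Nat.choose_succ_right_eq (n+n) n
  have h3 := succ_mul_catalan_eq_centralBinom n
  rw [Nat.centralBinom_eq_two_mul_choose, two_mul] at h3
  apply Nat.eq_of_mul_eq_mul_left (Nat.succ_pos n)
  simp only [Nat.succ_eq_add_one]
  rw [h3]
  have : n + n - n = n := by omega
  rw [this] at h2
  nlinarith

lemma succAbove_val {n : ℕ} (p : Fin (n+1)) (i : Fin n) :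
    ((p.succAbove i : Fin (n+1)) : ℕ) = if (i:ℕ) < p then (i:ℕ) else i + 1 := by
  split_ifs with h
  · exact succAbove_lt h
  · exact succAbove_gt (not_lt.mp h)

lemma Av_ins_succ {n : ℕ} {a k : Fin n} {ρ : Perm (Fin n)} (hak : ρ a = k) (h : Av ρ) :
    Av (ins a.succ k.succ ρ) := by
  have hc : ∀ x : Fin (n+1), ∃ i : Fin n, (x = a.succ.succAbove i) ∨ (x = a.succ ∧ i = a) := by
    intro x
    rcases Fin.eq_self_or_eq_succAbove a.succ x with rfl | ⟨i, rfl⟩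
    · exact ⟨a, Or.inr ⟨rfl, rfl⟩⟩
    · exact ⟨i, Or.inl rfl⟩
  choose c hc using hc
  have key : ∀ x y, x < y → ins a.succ k.succ ρ y < ins a.succ k.succ ρ x →
      c x < c y ∧ ρ (c y) < ρ (c x) := by
    intro x y hxy hv
    have hne : (c x : ℕ) = c y ↔ (ρ (c x) : ℕ) = ρ (c y) := by
      rw [Fin.val_inj, Fin.val_inj, ρ.injective.eq_iff]
    have hxk : (c x : ℕ) = a ↔ (ρ (c x) : ℕ) = k := by
      rw [← hak, Fin.val_inj, Fin.val_inj, ρ.injective.eq_iff]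
    have hyk : (c y : ℕ) = a ↔ (ρ (c y) : ℕ) = k := by
      rw [← hak, Fin.val_inj, Fin.val_inj, ρ.injective.eq_iff]
    have vx : ((x:ℕ) = (if (c x : ℕ) < a + 1 then (c x:ℕ) else c x + 1) ∧
        (ins a.succ k.succ ρ x : ℕ) = if (ρ (c x) : ℕ) < k + 1 then (ρ (c x) : ℕ) else ρ (c x) + 1)
        ∨ ((x:ℕ) = a + 1 ∧ (ins a.succ k.succ ρ x : ℕ) = k + 1 ∧ (c x:ℕ) = a) := by
      rcases hc x with e | ⟨e, e'⟩
      · left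
        generalize c x = i at e
        rw [e, ins_succAbove, succAbove_val, succAbove_val]; simp
      · right
        rw [e'] ; rw [e, ins_same]; simp
    have vy : ((y:ℕ) = (if (c y : ℕ) < a + 1 then (c y:ℕ) else c y + 1) ∧
        (ins a.succ k.succ ρ y : ℕ) = if (ρ (c y) : ℕ) < k + 1 then (ρ (c y) : ℕ) else ρ (c y) + 1)
        ∨ ((y:ℕ) = a + 1 ∧ (ins a.succ k.succ ρ y : ℕ) = k + 1 ∧ (c y:ℕ) = a) := by
      rcases hc y with e | ⟨e, e'⟩
      · left
        generalize c y = i at e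
        rw [e, ins_succAbove, succAbove_val, succAbove_val]; simp
      · right
        rw [e'] ; rw [e, ins_same]; simp
    rw [Fin.lt_def] at hxy hv ⊢
    rw [Fin.lt_def]
    split_ifs at vx vy <;> omega
  intro i j m hij hjm h1 h2
  obtain ⟨p1, p2⟩ := key i j hij h2
  obtain ⟨p3, p4⟩ := key j m hjm h1
  exact h _ _ _ p1 p3 p4 p2

def IncCl {n : ℕ} (l k : ℕ) (σ : Perm (Fin n)) : Prop :=
  ∃ a, a + l ≤ n ∧ ∀ i : Fin n, ∀ j < l, (i:ℕ) = a + j → (σ i : ℕ) = k + j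

def T {n : ℕ} (K : Fin n) (ρ : Perm (Fin n)) : Perm (Fin (n+1)) :=
  ins (ρ.symm K).succ K.succ ρ

lemma T_inj {n : ℕ} (K : Fin n) : Function.Injective (T K) := by
  intro ρ ρ' h
  have : (ρ.symm K).succ = (ρ'.symm K).succ := by
    have h1 : T K ρ (ρ.symm K).succ = K.succ := ins_same _ _ _
    have h2 : T K ρ' (ρ'.symm K).succ = K.succ := ins_same _ _ _
    rw [h] at h1
    exact (T K ρ').injective (h1.trans h2.symm)
  unfold T at h
  rw [this] at h
  exact ins_inj _ _ h

lemma T_image {n l : ℕ} (K : Fin n) (hl : 1 ≤ l) :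
    {σ : Perm (Fin (n+1)) | Av σ ∧ IncCl (l+1) K σ} = T K '' {ρ | Av ρ ∧ IncCl l K ρ} := by
  ext σ
  simp only [Set.mem_ofPred_eq, Set.mem_image]
  constructor
  · rintro ⟨hA, a, ha, hI⟩
    have han : a < n := by omega
    let A : Fin n := ⟨a, han⟩
    have e1 := hI A.succ 1 (by omega) (by simp [A])
    have e0 := hI A.castSucc 0 (by omega) (by simp [A])
    obtain ⟨ρ, rfl⟩ := ins_surj A.succ K.succ σ (by ext; rw [e1]; simp)
    have hs : A.succ.succAbove A = A.castSucc := by ext; rw [succAbove_val]; simp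
    have hρ : ρ A = K := by
      rw [← hs, ins_succAbove, succAbove_val] at e0
      ext
      simp at e0
      split_ifs at e0 <;> omega
    refine ⟨ρ, ⟨Av_of_ins hA, a, by omega, ?_⟩, ?_⟩
    · intro i j hj hi
      rcases Nat.eq_zero_or_pos j with rfl | hj0
      · have : i = A := by ext; simpa [A] using hi
        rw [this, hρ]; rfl
      · have hv : ((A.succ.succAbove i : Fin (n+1)) : ℕ) = a + (j+1) := by
          rw [succAbove_gt]
          · omega
          · simp [A]; omega
        have := hI _ (j+1) (by omega) hv
        rw [ins_succAbove, succAbove_val] at this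
        simp at this
        split_ifs at this <;> omega
    · unfold T
      rw [← hρ]; simp
  · rintro ⟨ρ, ⟨hA, a, ha, hI⟩, rfl⟩
    have han : a < n := by omega
    let A : Fin n := ⟨a, han⟩
    have hρ : ρ A = K := by ext; exact hI A 0 (by omega) rfl
    have hT : T K ρ = ins A.succ K.succ ρ := by unfold T; rw [← hρ]; simp
    rw [hT]
    refine ⟨Av_ins_succ hρ hA, a, by omega, ?_⟩
    intro x j hj hx
    rcases Fin.eq_self_or_eq_succAbove A.succ x with rfl | ⟨i, rfl⟩
    · rw [ins_same]; simp [A] at hx ⊢; omega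
    · rw [ins_succAbove, succAbove_val]
      rw [succAbove_val] at hx
      simp [A] at hx ⊢
      rcases Nat.lt_or_ge a i with h | h
      · have := hI i (j-1) (by split_ifs at hx <;> omega) (by split_ifs at hx <;> omega)
        split_ifs at hx ⊢ <;> omega
      · have := hI i j (by split_ifs at hx <;> omega) (by split_ifs at hx <;> omega)
        split_ifs at hx ⊢ <;> omega

lemma card_IncCl (m k : ℕ) (hk : k < m) (l : ℕ) :
    {σ : Perm (Fin (m+l)) | Av σ ∧ IncCl (l+1) k σ}.ncard = catalan m := by
  induction l with
  | zero =>
    rw [← card_Av]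
    congr 1
    ext σ
    refine ⟨fun h => h.1, fun h => ⟨h, ?_⟩⟩
    refine ⟨σ.symm ⟨k, by omega⟩, by omega, ?_⟩
    intro i j hj hi
    obtain rfl : j = 0 := by omega
    obtain rfl : i = σ.symm ⟨k, by omega⟩ := by ext; simpa using hi
    simp
  | succ l ih =>
    have := T_image (n := m + l) (l := l+1) ⟨k, by omega⟩ (by omega)
    calc _ = _ := congrArg Set.ncard this
      _ = _ := Set.ncard_image_of_injective _ (T_inj _)
      _ = _ := ih

/-! direct sums -/

def dsum {a b : ℕ} (ρ : Perm (Fin a)) (π : Perm (Fin b)) : Perm (Fin (a+b)) :=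
  finSumFinEquiv.permCongr (Equiv.sumCongr ρ π)

lemma dsum_left {a b : ℕ} (ρ : Perm (Fin a)) (π : Perm (Fin b)) (i : Fin a) :
    dsum ρ π (Fin.castAdd b i) = Fin.castAdd b (ρ i) := by
  simp [dsum, Equiv.permCongr_apply]

lemma dsum_right {a b : ℕ} (ρ : Perm (Fin a)) (π : Perm (Fin b)) (i : Fin b) :
    dsum ρ π (Fin.natAdd a i) = Fin.natAdd a (π i) := by
  simp [dsum, Equiv.permCongr_apply]

lemma dsum_inj {a b : ℕ} {ρ ρ' : Perm (Fin a)} {π π' : Perm (Fin b)}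
    (h : dsum ρ π = dsum ρ' π') : ρ = ρ' ∧ π = π' := by
  constructor
  · ext i
    have := congrArg (fun s : Perm (Fin (a+b)) => (s (Fin.castAdd b i) : ℕ)) h
    simpa [dsum_left] using this
  · ext i
    have := congrArg (fun s : Perm (Fin (a+b)) => (s (Fin.natAdd a i) : ℕ)) h
    simpa [dsum_right] using this

lemma dsum_surj {a b : ℕ} (σ : Perm (Fin (a+b))) (h : ∀ i : Fin (a+b), (i:ℕ) < a → (σ i : ℕ) < a) :
    ∃ ρ π, dsum ρ π = σ := by
  have hm : Set.MapsTo (finSumFinEquiv.symm.permCongr σ) (Set.range (Sum.inl : Fin a → Fin a ⊕ Fin b))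
      (Set.range Sum.inl) := by
    rintro _ ⟨i, rfl⟩
    have := h (Fin.castAdd b i) (by simp)
    refine ⟨⟨_, this⟩, ?_⟩
    rw [Equiv.permCongr_apply]
    simp only [Equiv.symm_symm, finSumFinEquiv_apply_left]
    rw [Equiv.eq_symm_apply]
    simp
  obtain ⟨⟨ρ, π⟩, h⟩ := Equiv.Perm.mem_sumCongrHom_range_of_perm_mapsTo_inl hm
  refine ⟨ρ, π, ?_⟩
  rw [dsum]
  have h' : Equiv.sumCongr ρ π = finSumFinEquiv.symm.permCongr σ := h
  rw [h']
  ext i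
  simp [Equiv.permCongr_apply]

lemma fin_split {a b : ℕ} (i : Fin (a+b)) :
    (∃ j : Fin a, i = Fin.castAdd b j) ∨ ∃ j : Fin b, i = Fin.natAdd a j := by
  induction i using Fin.addCases with
  | left j => exact Or.inl ⟨j, rfl⟩
  | right j => exact Or.inr ⟨j, rfl⟩

lemma Av_dsum {a b : ℕ} {ρ : Perm (Fin a)} {π : Perm (Fin b)} :
    Av (dsum ρ π) ↔ Av ρ ∧ Av π := by
  constructor
  · intro h
    constructor
    · intro i j k h1 h2 h3 h4
      refine h (Fin.castAdd b i) (Fin.castAdd b j) (Fin.castAdd b k) ?_ ?_ ?_ ?_ <;>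
        simpa [dsum_left]
    · intro i j k h1 h2 h3 h4
      refine h (Fin.natAdd a i) (Fin.natAdd a j) (Fin.natAdd a k) ?_ ?_ ?_ ?_ <;>
        simpa [dsum_right]
  · rintro ⟨hρ, hπ⟩ i j k h1 h2 h3 h4
    rcases fin_split i with ⟨i, rfl⟩ | ⟨i, rfl⟩ <;> rcases fin_split j with ⟨j, rfl⟩ | ⟨j, rfl⟩ <;>
    rcases fin_split k with ⟨k, rfl⟩ | ⟨k, rfl⟩ <;>
    simp only [dsum_left, dsum_right, Fin.lt_def, Fin.val_castAdd, Fin.val_natAdd] at h1 h2 h3 h4 <;>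
    first
    | omega
    | exact hρ i j k (by simpa using h1) (by simpa using h2) (by simpa using h3) (by simpa using h4)
    | exact hπ i j k (by simpa using h1) (by simpa using h2) (by simpa using h3) (by simpa using h4)

/-! cluster -/

def Clu {n : ℕ} (l k a : ℕ) (σ : Perm (Fin n)) : Prop :=
  a + l ≤ n ∧ ∀ i : Fin n, (a ≤ (i:ℕ) ∧ (i:ℕ) < a + l) ↔ (k ≤ (σ i : ℕ) ∧ (σ i : ℕ) < k + l)

lemma ClusterAt_iff {n l k a : ℕ} (hk : k + l ≤ n) (σ : Perm (Fin n)) :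
    ClusterAt l (k+1) (a+1) σ ↔
      ∀ i : Fin n, (a ≤ (i:ℕ) ∧ (i:ℕ) < a + l) ↔ (k ≤ (σ i : ℕ) ∧ (σ i : ℕ) < k + l) := by
  unfold ClusterAt
  rw [Finset.ext_iff]
  simp only [Finset.mem_image, Finset.mem_filter, Finset.mem_univ, true_and, Finset.mem_Ico]
  constructor
  · intro h i
    constructor
    · intro hi
      have := (h (σ i + 1)).1 ⟨i, by omega, rfl⟩
      omega
    · intro hi
      obtain ⟨j, hj, e⟩ := (h (σ i + 1)).2 (by omega)
      have : j = i := σ.injective (by ext; omega)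
      subst this
      omega
  · intro h x
    constructor
    · rintro ⟨i, hi, rfl⟩
      have := (h i).1 (by omega)
      omega
    · intro hx
      let y : Fin n := ⟨x - 1, by omega⟩
      have := (h (σ.symm y)).2 (by simp [y]; omega)
      exact ⟨σ.symm y, by omega, by simp [y]; omega⟩

lemma mem_ClusterEvent {n l k : ℕ} (hk : k + l ≤ n) (σ : Perm (Fin n)) :
    σ ∈ ClusterEvent n l (k+1) ↔ ∃ a, Clu l k a σ := by
  constructor
  · rintro ⟨a, h1, h2, h3⟩
    obtain ⟨a, rfl⟩ : ∃ b, a = b + 1 := ⟨a - 1, by omega⟩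
    exact ⟨a, by omega, (ClusterAt_iff hk σ).1 h3⟩
  · rintro ⟨a, h1, h2⟩
    exact ⟨a + 1, by omega, by omega, (ClusterAt_iff hk σ).2 h2⟩

def J {n : ℕ} (l k : ℕ) (σ : Perm (Fin n)) : Prop :=
  ∃ i j : Fin n, i < j ∧ k ≤ (σ j : ℕ) ∧ σ j < σ i ∧ (σ i : ℕ) < k + l

lemma nat_strict (l k : ℕ) (f : ℕ → ℕ) (h1 : ∀ j < l, k ≤ f j ∧ f j < k + l)
    (h2 : ∀ i j, i < j → j < l → f i < f j) : ∀ j < l, f j = k + j := by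
  have lo : ∀ j, j < l → k + j ≤ f j := by
    intro j
    induction j with
    | zero => intro h; simpa using (h1 0 h).1
    | succ j ih =>
      intro h
      have := ih (by omega)
      have := h2 j (j+1) (by omega) h
      omega
  have hi : ∀ d j, j + d + 1 = l → f j ≤ k + j := by
    intro d
    induction d with
    | zero => intro j h; have := (h1 j (by omega)).2; omega
    | succ d ih =>
      intro j h
      have := ih (j+1) (by omega)
      have := h2 j (j+1) (by omega) (by omega)
      omega
  intro j hj
  have := lo j hj
  have := hi (l - j - 1) j (by omega)
  omega

lemma IncCl_iff {n l k : ℕ} (hk : k + l ≤ n) (σ : Perm (Fin n)) :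
    IncCl l k σ ↔ (∃ a, Clu l k a σ) ∧ ¬ J l k σ := by
  constructor
  · rintro ⟨a, ha, h⟩
    have hC : Clu l k a σ := by
      refine ⟨ha, fun i => ⟨fun hi => ?_, fun hi => ?_⟩⟩
      · have := h i (i - a) (by omega) (by omega)
        omega
      · have := h ⟨a + (σ i - k), by omega⟩ (σ i - k) (by omega) rfl
        have e : i = ⟨a + (σ i - k), by omega⟩ := σ.injective (by ext; omega)
        have := congrArg Fin.val e
        simp only at this
        omega
    refine ⟨⟨a, hC⟩, ?_⟩
    rintro ⟨i, j, hij, h1, h2, h3⟩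
    rw [Fin.lt_def] at hij h2
    have hi := (hC.2 i).2 (by omega)
    have hj := (hC.2 j).2 (by omega)
    have := h i (i - a) (by omega) (by omega)
    have := h j (j - a) (by omega) (by omega)
    omega
  · rintro ⟨⟨a, ha, hC⟩, hJ⟩
    refine ⟨a, ha, ?_⟩
    have := nat_strict l k (fun j => if h : a + j < n then σ ⟨a + j, h⟩ else 0) ?_ ?_
    · intro i j hj hi
      have h := this j hj
      have hlt : a + j < n := by omega
      simp only [hlt, dite_true] at h
      rw [← h]; congr 2; ext; exact hi
    · intro j hj
      have hlt : a + j < n := by omega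
      simp only [hlt, dite_true]
      exact (hC ⟨a + j, hlt⟩).1 (by simp; omega)
    · intro i j hij hj
      have hlt : a + j < n := by omega
      have hlt' : a + i < n := by omega
      simp only [hlt, hlt', dite_true]
      by_contra hc
      have b1 := (hC ⟨a + j, hlt⟩).1 (by simp; omega)
      have b2 := (hC ⟨a + i, hlt'⟩).1 (by simp; omega)
      refine hJ ⟨⟨a + i, hlt'⟩, ⟨a + j, hlt⟩, by simpa using hij, b1.1, ?_, b2.2⟩
      refine lt_of_le_of_ne (Fin.le_def.2 (not_lt.mp hc)) fun e => ?_
      have := congrArg Fin.val (σ.injective e)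
      simp only at this
      omega

lemma exists_inv {l : ℕ} {π : Perm (Fin l)} (h : π ≠ 1) : ∃ i j, i < j ∧ π j < π i := by
  by_contra! hc
  apply h
  have hs : StrictMono π := fun i j hij => lt_of_le_of_ne (hc i j hij) fun e => hij.ne (π.injective e)
  have := Subsingleton.elim (hs.orderIsoOfSurjective _ π.surjective) (OrderIso.refl (Fin l))
  ext i
  have h2 := congrArg (fun e : Fin l ≃o Fin l => (e i : ℕ)) this
  simpa using h2

lemma J_image (k l m : ℕ) :
    {σ : Perm (Fin (k + (l + m))) | Av σ ∧ (∃ a, Clu l k a σ) ∧ J l k σ} =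
      (fun x : Perm (Fin k) × Perm (Fin l) × Perm (Fin m) => dsum x.1 (dsum x.2.1 x.2.2)) ''
        ({ρ | Av ρ} ×ˢ (({π | Av π} \ {1}) ×ˢ {ρ | Av ρ})) := by
  ext σ
  simp only [Set.mem_ofPred_eq, Set.mem_image, Set.mem_prod, Set.mem_sdiff, Set.mem_singleton_iff,
    Prod.exists]
  constructor
  · rintro ⟨hA, ⟨a, ha, hC⟩, ⟨i, j, hij, h1, h2, h3⟩⟩
    rw [Fin.lt_def] at h2
    have hi := (hC i).2 (by omega)
    have hj := (hC j).2 (by omega)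
    have lo : ∀ p : Fin (k + (l+m)), (p:ℕ) < a → (σ p : ℕ) < k := by
      intro p hp
      by_contra hc
      have : ¬ (σ p : ℕ) < k + l := fun h => by have := (hC p).2 (by omega); omega
      exact hA p i j (by rw [Fin.lt_def]; omega) hij (by rw [Fin.lt_def]; omega)
        (by rw [Fin.lt_def]; omega)
    have hi' : ∀ p : Fin (k + (l+m)), a + l ≤ (p:ℕ) → k + l ≤ (σ p : ℕ) := by
      intro p hp
      by_contra hc
      have : (σ p : ℕ) < k := by
        by_contra h; have := (hC p).2 (by omega); omega
      exact hA i j p hij (by rw [Fin.lt_def]; omega) (by rw [Fin.lt_def]; omega)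
        (by rw [Fin.lt_def]; omega)
    have c1 : a ≤ k := by
      have := Fintype.card_le_of_injective
        (fun x : Fin a => (⟨σ ⟨x, by omega⟩, lo _ x.2⟩ : Fin k)) (by
          intro x y h
          simp only [Fin.mk.injEq] at h
          have := σ.injective (Fin.ext h)
          simpa [Fin.ext_iff] using this)
      simpa using this
    have c2 : k ≤ a := by
      have := Fintype.card_le_of_injective
        (fun x : Fin (k+l) => (⟨σ.symm ⟨x, by omega⟩, by
          by_contra h
          have := hi' _ (not_lt.mp h)
          simp at this
          omega⟩ : Fin (a+l))) (by
          intro x y h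
          simp only [Fin.mk.injEq] at h
          have := σ.symm.injective (Fin.ext h)
          simpa [Fin.ext_iff] using this)
      simp at this
      omega
    obtain rfl : a = k := by omega
    obtain ⟨ρ, π', rfl⟩ := dsum_surj σ lo
    obtain ⟨π, ρ', rfl⟩ := dsum_surj π' (by
      intro p hp
      have := (hC (Fin.natAdd a p)).1 (by simp; omega)
      rw [dsum_right] at this
      simp at this
      omega)
    rw [Av_dsum, Av_dsum] at hA
    refine ⟨ρ, π, ρ', ⟨hA.1, ⟨hA.2.1, ?_⟩, hA.2.2⟩, rfl⟩
    rintro rfl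
    have fx : ∀ p : Fin (a + (l+m)), a ≤ (p:ℕ) → (p:ℕ) < a + l →
        dsum ρ (dsum (1 : Perm (Fin l)) ρ') p = p := by
      intro p q1 q2
      rcases fin_split p with ⟨p, rfl⟩ | ⟨p, rfl⟩
      · simp at q1; omega
      rcases fin_split p with ⟨p, rfl⟩ | ⟨p, rfl⟩
      · rw [dsum_right, dsum_left]; rfl
      · simp at q2
    rw [fx i hi.1 hi.2, fx j hj.1 hj.2] at h2
    rw [Fin.lt_def] at hij
    omega
  · rintro ⟨ρ, π, ρ', ⟨h1, ⟨h2, h3⟩, h4⟩, rfl⟩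
    refine ⟨Av_dsum.2 ⟨h1, Av_dsum.2 ⟨h2, h4⟩⟩, ⟨k, by omega, ?_⟩, ?_⟩
    · intro p
      rcases fin_split p with ⟨p, rfl⟩ | ⟨p, rfl⟩
      · rw [dsum_left]; simp; omega
      rcases fin_split p with ⟨p, rfl⟩ | ⟨p, rfl⟩
      · rw [dsum_right, dsum_left]; simp
      · rw [dsum_right, dsum_right]; simp
    · obtain ⟨i, j, hij, hv⟩ := exists_inv h3
      refine ⟨Fin.natAdd k (Fin.castAdd m i), Fin.natAdd k (Fin.castAdd m j), by simpa, ?_, ?_, ?_⟩ <;>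
      rw [dsum_right, dsum_left]
      · simp
      · rw [dsum_right, dsum_left]; simpa
      · simp

lemma Av_one (n : ℕ) : Av (1 : Perm (Fin n)) := by
  intro i j k h1 h2 h3 h4
  exact absurd h1 (not_lt.mpr h4.le)

lemma card_event (k l m : ℕ) (hl : 1 ≤ l) :
    (ClusterEvent (k + (l+m)) l (k+1) ∩ {σ | Av σ}).ncard =
      catalan (k + m + 1) + catalan k * ((catalan l - 1) * catalan m) := by
  have e : ClusterEvent (k + (l+m)) l (k+1) ∩ {σ | Av σ} =
      {σ | Av σ ∧ IncCl l k σ} ∪ {σ : Perm (Fin (k + (l + m))) | Av σ ∧ (∃ a, Clu l k a σ) ∧ J l k σ} := by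
    ext σ
    simp only [Set.mem_inter_iff, Set.mem_union, Set.mem_ofPred_eq]
    rw [mem_ClusterEvent (by omega), IncCl_iff (by omega)]
    tauto
  rw [e, Set.ncard_union_eq]
  · congr 1
    · obtain ⟨l, rfl⟩ : ∃ l', l = l' + 1 := ⟨l - 1, by omega⟩
      have : k + (l + 1 + m) = (k + m + 1) + l := by ring
      rw [this]
      exact card_IncCl (k+m+1) k (by omega) l
    · rw [J_image, Set.ncard_image_of_injective, Set.ncard_prod, Set.ncard_prod, card_Av, card_Av,
        Set.ncard_sdiff_singleton_of_mem (Av_one l), card_Av]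
      rintro ⟨a, b, c⟩ ⟨a', b', c'⟩ h
      obtain ⟨h1, h2⟩ := dsum_inj h
      obtain ⟨h3, h4⟩ := dsum_inj h2
      simp at h1 h3 h4
      simp [h1, h3, h4]
  · rw [Set.disjoint_left]
    rintro σ h1 h2
    exact ((IncCl_iff (by omega) σ).1 h1.2).2 h2.2.2

lemma tendsto_ratio : Tendsto (fun n => (catalan n : ℝ) / catalan (n+1)) atTop (nhds (1/4)) := by
  have hpos : ∀ n, 0 < (catalan n : ℝ) := by
    intro n
    have h := succ_mul_catalan_eq_centralBinom n
    have := Nat.centralBinom_pos n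
    rw [← h] at this
    exact_mod_cast Nat.pos_of_mul_pos_left this
  have h : ∀ n : ℕ, (catalan n : ℝ) / catalan (n+1) = 1/4 + (3/8) * (1 / ((n:ℝ) + 1/2)) := by
    intro n
    have h0 := succ_mul_catalan_eq_centralBinom n
    have h1 := succ_mul_catalan_eq_centralBinom (n+1)
    have h2 := Nat.succ_mul_centralBinom_succ n
    rw [← h0, ← h1] at h2
    have h3 : ((n:ℝ)+1) * ((n+1+1) * catalan (n+1)) = 2 * (2*n+1) * ((n+1) * catalan n) := by
      exact_mod_cast h2
    have h4 : ((n:ℝ)+2) * catalan (n+1) = 2 * (2*n+1) * catalan n := by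
      have : ((n:ℝ)+1) ≠ 0 := by positivity
      apply mul_left_cancel₀ this
      linarith
    have := hpos (n+1)
    rw [div_eq_iff this.ne']
    have hn : ((n:ℝ) + 1/2) ≠ 0 := by positivity
    field_simp
    linarith
  simp only [h]
  have h5 : Tendsto (fun n : ℕ => 1 / ((n:ℝ) + 1/2)) atTop (nhds 0) := by
    have := (tendsto_natCast_atTop_atTop (R := ℝ)).atTop_add (tendsto_const_nhds (x := (1/2:ℝ)))
    refine this.inv_tendsto_atTop.congr fun n => ?_
    simp
  have h6 := (h5.const_mul (3/8)).const_add (1/4)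
  rwa [mul_zero, add_zero] at h6

lemma catalan_pos' (n : ℕ) : 0 < catalan n := by
  have h := succ_mul_catalan_eq_centralBinom n
  have := Nat.centralBinom_pos n
  rw [← h] at this
  exact Nat.pos_of_mul_pos_left this

lemma tendsto_ratio_c (c : ℕ) :
    Tendsto (fun n => (catalan n : ℝ) / catalan (n+c)) atTop (nhds (1/4^c)) := by
  induction c with
  | zero =>
    have : ∀ n, (catalan n : ℝ) / catalan (n+0) = 1 := fun n =>
      div_self (by exact_mod_cast (catalan_pos' n).ne')
    simp only [this]; simp
  | succ c ih =>
    have := ih.mul (tendsto_ratio.comp (tendsto_add_atTop_nat c))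
    rw [show (1:ℝ)/4^(c+1) = 1/4^c * (1/4) by rw [pow_succ]; field_simp]
    refine this.congr fun n => ?_
    have := (catalan_pos' (n+c)).ne'
    simp only [Function.comp]
    rw [div_mul_div_cancel₀ (by exact_mod_cast this)]
    rfl

lemma main_Av (k l : ℕ) (hl : 1 ≤ l) :
    Tendsto (fun n : ℕ => ((ClusterEvent n l (k+1) ∩ {σ | Av σ}).ncard : ℝ) /
      ({σ : Perm (Fin n) | Av σ}.ncard : ℝ)) atTop
      (nhds (1 / 4 ^ (l - 1) + (catalan k : ℝ) * ((catalan l : ℝ) - 1) / 4 ^ (k + l))) := by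
  rw [← tendsto_add_atTop_iff_nat (k + l)]
  have e : ∀ m : ℕ, ((ClusterEvent (m + (k+l)) l (k+1) ∩ {σ | Av σ}).ncard : ℝ) /
      ({σ : Perm (Fin (m + (k+l))) | Av σ}.ncard : ℝ) =
      (catalan (m + (k+1)) : ℝ) / catalan (m + (k+1) + (l-1)) +
        catalan k * ((catalan l : ℝ) - 1) * ((catalan m : ℝ) / catalan (m + (k+l))) := by
    intro m
    rw [card_Av, show m + (k+l) = k + (l+m) by ring, card_event k l m hl,
      show m + (k+1) + (l-1) = k + (l + m) by omega, show k + m + 1 = m + (k+1) by ring]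
    push_cast [Nat.cast_sub (catalan_pos' l)]
    ring
  simp only [e]
  refine Tendsto.add ?_ ?_
  · exact (tendsto_ratio_c (l-1)).comp (tendsto_add_atTop_nat (k+1))
  · have := (tendsto_ratio_c (k+l)).const_mul (catalan k * ((catalan l : ℝ) - 1))
    simpa [mul_div_assoc, div_eq_mul_inv] using this

/-! symmetries -/

def Av1 {n : ℕ} (σ : Perm (Fin n)) : Prop :=
  ∀ i j k : Fin n, i < j → j < k → σ i < σ j → σ j < σ k → False

lemma strictMono3 {n : ℕ} {i j k : Fin n} (h1 : i < j) (h2 : j < k) : StrictMono ![i, j, k] := by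
  intro x y hxy
  fin_cases x <;> fin_cases y <;> simp at hxy ⊢ <;> first | assumption | exact h1.trans h2

lemma AvoidSet_321 (n : ℕ) : AvoidSet n perm321 = {σ | Av σ} := by
  ext σ
  constructor
  · intro h i j k h1 h2 h3 h4
    refine h ⟨![i, j, k], strictMono3 h1 h2, ?_⟩
    have h5 := h3.trans h4
    intro x y
    fin_cases x <;> fin_cases y <;> simp [perm321, h3, h4, h5, h3.le, h4.le, h5.le]
  · rintro h ⟨f, hf, hp⟩
    exact h (f 0) (f 1) (f 2) (hf (by decide)) (hf (by decide)) ((hp 2 1).2 (by decide))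
      ((hp 1 0).2 (by decide))

lemma AvoidSet_123 (n : ℕ) : AvoidSet n perm123 = {σ | Av1 σ} := by
  ext σ
  constructor
  · intro h i j k h1 h2 h3 h4
    refine h ⟨![i, j, k], strictMono3 h1 h2, ?_⟩
    have h5 := h3.trans h4
    intro x y
    fin_cases x <;> fin_cases y <;> simp [perm123, h3, h4, h5, h3.le, h4.le, h5.le]
  · rintro h ⟨f, hf, hp⟩
    exact h (f 0) (f 1) (f 2) (hf (by decide)) (hf (by decide)) ((hp 0 1).2 (by decide))
      ((hp 1 2).2 (by decide))

def rp {n : ℕ} (σ : Perm (Fin n)) : Perm (Fin n) := Fin.revPerm.trans σ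
def rv {n : ℕ} (σ : Perm (Fin n)) : Perm (Fin n) := σ.trans Fin.revPerm

lemma rp_apply {n : ℕ} (σ : Perm (Fin n)) (i : Fin n) : rp σ i = σ i.rev := rfl
lemma rv_apply {n : ℕ} (σ : Perm (Fin n)) (i : Fin n) : rv σ i = (σ i).rev := rfl

lemma rp_inj {n : ℕ} : Function.Injective (rp (n := n)) := by
  intro σ τ h
  ext i
  have := congrArg (fun s : Perm (Fin n) => (s i.rev : ℕ)) h
  simpa [rp_apply] using this

lemma rv_inj {n : ℕ} : Function.Injective (rv (n := n)) := by
  intro σ τ h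
  ext i : 1
  have := congrArg (fun s : Perm (Fin n) => s i) h
  simpa [rv_apply] using this

lemma Av_rp {n : ℕ} {σ : Perm (Fin n)} (h : Av1 σ) : Av (rp σ) :=
  fun i j k h1 h2 h3 h4 => h k.rev j.rev i.rev (by simpa) (by simpa) h3 h4

lemma Av1_rp {n : ℕ} {σ : Perm (Fin n)} (h : Av σ) : Av1 (rp σ) :=
  fun i j k h1 h2 h3 h4 => h k.rev j.rev i.rev (by simpa) (by simpa) h3 h4

lemma Av_rv {n : ℕ} {σ : Perm (Fin n)} (h : Av1 σ) : Av (rv σ) :=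
  fun i j k h1 h2 h3 h4 => h i j k h1 h2 (by simpa [rv_apply] using h4) (by simpa [rv_apply] using h3)

lemma Av1_rv {n : ℕ} {σ : Perm (Fin n)} (h : Av σ) : Av1 (rv σ) :=
  fun i j k h1 h2 h3 h4 => h i j k h1 h2 (by simpa [rv_apply] using h4) (by simpa [rv_apply] using h3)

lemma Clu_rp {n l k a : ℕ} {σ : Perm (Fin n)} (h : Clu l k a σ) : Clu l k (n - l - a) (rp σ) := by
  obtain ⟨ha, h⟩ := h
  refine ⟨by omega, fun i => ?_⟩
  rw [rp_apply, ← h i.rev, Fin.val_rev]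
  omega

lemma Clu_rv {n l k a : ℕ} {σ : Perm (Fin n)} (hk : k + l ≤ n) (h : Clu l k a σ) :
    Clu l (n - l - k) a (rv σ) := by
  obtain ⟨ha, h⟩ := h
  refine ⟨by omega, fun i => ?_⟩
  rw [rv_apply, h i, Fin.val_rev]
  omega

lemma ncard_eq_of {α : Type*} [Finite α] {f : α → α} (hf : Function.Injective f) {S S' : Set α}
    (h1 : ∀ x ∈ S, f x ∈ S') (h2 : ∀ x ∈ S', f x ∈ S) : S.ncard = S'.ncard :=
  le_antisymm (Set.ncard_le_ncard_of_injOn f h1 hf.injOn) (Set.ncard_le_ncard_of_injOn f h2 hf.injOn)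

lemma card_Av1 (n : ℕ) : {σ : Perm (Fin n) | Av1 σ}.ncard = {σ : Perm (Fin n) | Av σ}.ncard :=
  ncard_eq_of rp_inj (fun _ h => Av_rp h) (fun _ h => Av1_rp h)

lemma L1 {n l k : ℕ} (hk : k + l ≤ n) : (ClusterEvent n l (k+1) ∩ {σ | Av1 σ}).ncard =
    (ClusterEvent n l (k+1) ∩ {σ | Av σ}).ncard := by
  refine ncard_eq_of rp_inj ?_ ?_
  · rintro σ ⟨h1, h2⟩
    obtain ⟨a, h⟩ := (mem_ClusterEvent hk σ).1 h1
    exact ⟨(mem_ClusterEvent hk _).2 ⟨_, Clu_rp h⟩, Av_rp h2⟩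
  · rintro σ ⟨h1, h2⟩
    obtain ⟨a, h⟩ := (mem_ClusterEvent hk σ).1 h1
    exact ⟨(mem_ClusterEvent hk _).2 ⟨_, Clu_rp h⟩, Av1_rp h2⟩

lemma L2 {n l k : ℕ} (hk : k + l ≤ n) : (ClusterEvent n l (n - l - k + 1) ∩ {σ | Av1 σ}).ncard =
    (ClusterEvent n l (k+1) ∩ {σ | Av σ}).ncard := by
  refine ncard_eq_of rv_inj ?_ ?_
  · rintro σ ⟨h1, h2⟩
    obtain ⟨a, h⟩ := (mem_ClusterEvent (by omega) σ).1 h1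
    refine ⟨(mem_ClusterEvent hk _).2 ⟨a, ?_⟩, Av_rv h2⟩
    have := Clu_rv (by omega) h
    rwa [show n - l - (n - l - k) = k by omega] at this
  · rintro σ ⟨h1, h2⟩
    obtain ⟨a, h⟩ := (mem_ClusterEvent hk σ).1 h1
    exact ⟨(mem_ClusterEvent (by omega) _).2 ⟨_, Clu_rv hk h⟩, Av1_rv h2⟩

end CL

/-- for `τ ∈ {123, 321}` and fixed `l ≥ 2`, `k ≥ 1`, the limiting probabilities
of `A^{(n)}_{l;k}` and of `A^{(n)}_{l;n+2-k-l}` both equal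
`1/4^{l-1} + C_{k-1}(C_l - 1)/4^{k+l-1}`. -/
theorem avoid123or321_cluster_limit_fixed_k (τ : Equiv.Perm (Fin 3))
    (hτ : τ = perm123 ∨ τ = perm321)
    (l k : ℕ) (hl : 2 ≤ l) (hk : 1 ≤ k) :
    Filter.Tendsto
      (fun n : ℕ => ((ClusterEvent n l k ∩ AvoidSet n τ).ncard : ℝ) /
        ((AvoidSet n τ).ncard : ℝ)) Filter.atTop
      (nhds (1 / 4 ^ (l - 1) +
        (catalan (k - 1) : ℝ) * ((catalan l : ℝ) - 1) / 4 ^ (k + l - 1))) ∧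
    Filter.Tendsto
      (fun n : ℕ => ((ClusterEvent n l (n + 2 - k - l) ∩ AvoidSet n τ).ncard : ℝ) /
        ((AvoidSet n τ).ncard : ℝ)) Filter.atTop
      (nhds (1 / 4 ^ (l - 1) +
        (catalan (k - 1) : ℝ) * ((catalan l : ℝ) - 1) / 4 ^ (k + l - 1))) := by
  obtain ⟨k, rfl⟩ : ∃ k', k = k' + 1 := ⟨k - 1, by omega⟩
  have main := CL.main_Av k l (by omega)
  have ek : k + 1 + l - 1 = k + l := by omega
  rw [ek, Nat.add_sub_cancel]
  rcases hτ with rfl | rfl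
  · simp only [CL.AvoidSet_123, CL.card_Av1]
    constructor
    · refine main.congr' ?_
      filter_upwards [Filter.eventually_ge_atTop (k + l)] with n hn
      rw [CL.L1 hn]
    · refine main.congr' ?_
      filter_upwards [Filter.eventually_ge_atTop (k + l)] with n hn
      rw [show n + 2 - (k + 1) - l = n - l - k + 1 by omega, CL.L2 hn]
  · simp only [CL.AvoidSet_321]
    refine ⟨main, main.congr' ?_⟩
    filter_upwards [Filter.eventually_ge_atTop (k + l)] with n hn
    rw [show n + 2 - (k + 1) - l = n - l - k + 1 by omega, ← CL.L1 (k := n - l - k) (by omega), CL.L2 hn]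
end

section
/- Let τ ∈ {123, 321} ⊂ S_3, fix l ≥ 2, and let {k_n} be a sequence with 1 ≤ k_n ≤ n-l+1 such that k_n → ∞ and n - k_n → ∞ as n → ∞. Then lim_{n→∞} |A^{(n)}_{l;k_n} ∩ S_n(τ)| / |S_n(τ)| = 1/4^{l-1}. -/
open Filter

section
open Classical

def Av {n : ℕ} (σ : Equiv.Perm (Fin n)) : Prop :=
  ∀ i j k : Fin n, i < j → j < k → σ j < σ i → σ k < σ j → False

def ins {n : ℕ} (p v : Fin (n+1)) (σ : Equiv.Perm (Fin n)) : Equiv.Perm (Fin (n+1)) :=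
  ((finSuccEquiv' p).trans (Equiv.optionCongr σ)).trans (finSuccEquiv' v).symm

lemma ins_self {n : ℕ} (p v : Fin (n+1)) (σ : Equiv.Perm (Fin n)) : ins p v σ p = v := by
  simp [ins]

lemma ins_above {n : ℕ} (p v : Fin (n+1)) (σ : Equiv.Perm (Fin n)) (i : Fin n) :
    ins p v σ (p.succAbove i) = v.succAbove (σ i) := by
  simp [ins]

lemma ins_inj {n : ℕ} {p v : Fin (n+1)} {σ σ' : Equiv.Perm (Fin n)}
    (h : ins p v σ = ins p v σ') : σ = σ' := by
  ext i : 1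
  have h1 := ins_above p v σ i
  rw [h, ins_above] at h1
  exact (Fin.succAbove_right_injective h1).symm

lemma ins_surj {n : ℕ} {p v : Fin (n+1)} {σ' : Equiv.Perm (Fin (n+1))} (h : σ' p = v) :
    ∃ σ, ins p v σ = σ' := by
  let f : Equiv.Perm (Option (Fin n)) := ((finSuccEquiv' p).symm.trans σ').trans (finSuccEquiv' v)
  have hf : f none = none := by simp [f, h]
  refine ⟨Equiv.removeNone f, ?_⟩
  have : (Equiv.removeNone f).optionCongr = f := by
    rw [map_equiv_removeNone, hf, Equiv.swap_self]
    rfl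
  unfold ins
  rw [this]
  ext i : 1
  simp [f]

def Inc {n : ℕ} (s : ℕ) (σ : Equiv.Perm (Fin n)) : Prop :=
  ∀ i j : Fin n, s ≤ (i : ℕ) → i < j → σ i < σ j

lemma av_ins_last {n : ℕ} (p : Fin (n+1)) (σ : Equiv.Perm (Fin n)) :
    Av (ins p (Fin.last n) σ) ↔ Av σ ∧ Inc p σ := by
  constructor
  · intro h
    refine ⟨?_, ?_⟩
    · intro i j k hij hjk h1 h2
      refine h (p.succAbove i) (p.succAbove j) (p.succAbove k) ?_ ?_ ?_ ?_ <;>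
        simpa [ins_above]
    · intro i j hi hij
      by_contra hc
      have hlt : σ j < σ i := by
        refine lt_of_le_of_ne (not_lt.mp hc) ?_
        intro he; exact hij.ne' (σ.injective he)
      refine h p (p.succAbove i) (p.succAbove j) ?_ ?_ ?_ ?_
      · rw [Fin.lt_succAbove_iff_le_castSucc]; exact hi
      · simpa
      · simp [ins_above, ins_self, Fin.castSucc_lt_last]
      · simpa [ins_above]
  · rintro ⟨h, hs⟩ i j k hij hjk h1 h2
    have hj : j ≠ p := by
      rintro rfl
      rw [ins_self] at h1
      exact absurd h1 (not_lt.mpr (Fin.le_last _))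
    have hk : k ≠ p := by
      rintro rfl
      rw [ins_self] at h2
      exact absurd h2 (not_lt.mpr (Fin.le_last _))
    obtain ⟨j, rfl⟩ := Fin.exists_succAbove_eq hj
    obtain ⟨k, rfl⟩ := Fin.exists_succAbove_eq hk
    rw [ins_above, ins_above, Fin.succAbove_lt_succAbove_iff] at h2
    rw [Fin.succAbove_lt_succAbove_iff] at hjk
    by_cases hi : i = p
    · subst hi
      rw [Fin.lt_succAbove_iff_le_castSucc] at hij
      exact absurd (hs j k hij hjk) (not_lt.mpr h2.le)
    · obtain ⟨i, rfl⟩ := Fin.exists_succAbove_eq hi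
      rw [ins_above, ins_above, Fin.succAbove_lt_succAbove_iff] at h1
      rw [Fin.succAbove_lt_succAbove_iff] at hij
      exact h i j k hij hjk h1 h2

lemma inc_ins_last {n s : ℕ} (hs : s ≤ n) (p : Fin (n+1)) (σ : Equiv.Perm (Fin n)) :
    (Av (ins p (Fin.last n) σ) ∧ Inc s (ins p (Fin.last n) σ)) ↔
      (Av σ ∧ ((p = Fin.last n ∧ Inc s σ) ∨ ((p : ℕ) < s ∧ Inc p σ))) := by
  rw [av_ins_last]
  constructor
  · rintro ⟨⟨h1, h2⟩, h3⟩
    refine ⟨h1, ?_⟩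
    by_cases hp : (p : ℕ) < s
    · exact Or.inr ⟨hp, h2⟩
    left
    have hpl : p = Fin.last n := by
      by_contra hne
      have := h3 p (Fin.last n) (not_lt.mp hp) (Fin.lt_last_iff_ne_last.mpr hne)
      rw [ins_self] at this
      exact absurd this (not_lt.mpr (Fin.le_last _))
    refine ⟨hpl, ?_⟩
    intro i j hi hij
    have := h3 (p.succAbove i) (p.succAbove j) ?_ (by simpa)
    · simpa [ins_above] using this
    · subst hpl; simpa using hi
  · rintro ⟨h1, h | h⟩
    · obtain ⟨rfl, h2⟩ := h
      refine ⟨⟨h1, ?_⟩, ?_⟩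
      · intro i j hi; have := i.2; simp at hi; omega
      · intro i j hi hij
        have hil : i ≠ Fin.last n := Fin.ne_last_of_lt hij
        obtain ⟨i, rfl⟩ := Fin.exists_succAbove_eq hil
        by_cases hj : j = Fin.last n
        · subst hj
          rw [ins_self, ins_above]
          simp [Fin.castSucc_lt_last]
        · obtain ⟨j, rfl⟩ := Fin.exists_succAbove_eq hj
          rw [ins_above, ins_above, Fin.succAbove_lt_succAbove_iff]
          rw [Fin.succAbove_lt_succAbove_iff] at hij
          refine h2 i j ?_ hij
          simpa using hi
    · obtain ⟨hp, h2⟩ := h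
      refine ⟨⟨h1, h2⟩, ?_⟩
      intro i j hi hij
      have hip : p < i := by rw [Fin.lt_def]; omega
      have hjp : p < j := hip.trans hij
      obtain ⟨i, rfl⟩ := Fin.exists_succAbove_eq hip.ne'
      obtain ⟨j, rfl⟩ := Fin.exists_succAbove_eq hjp.ne'
      rw [ins_above, ins_above, Fin.succAbove_lt_succAbove_iff]
      rw [Fin.succAbove_lt_succAbove_iff] at hij
      rw [Fin.lt_succAbove_iff_le_castSucc] at hip
      exact h2 i j hip hij

noncomputable def M (n s : ℕ) : ℕ := {σ : Equiv.Perm (Fin n) | Av σ ∧ Inc s σ}.ncard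

lemma M_fiber (n s : ℕ) (hs : s ≤ n) (p : Fin (n+1)) :
    {σ : Equiv.Perm (Fin (n+1)) | (Av σ ∧ Inc s σ) ∧ σ p = Fin.last n}.ncard =
      if p = Fin.last n then M n s else if (p : ℕ) < s then M n p else 0 := by
  have himg : {σ : Equiv.Perm (Fin (n+1)) | (Av σ ∧ Inc s σ) ∧ σ p = Fin.last n} =
      ins p (Fin.last n) '' {σ | Av σ ∧ ((p = Fin.last n ∧ Inc s σ) ∨ ((p : ℕ) < s ∧ Inc p σ))} := by
    ext σ'
    constructor
    · rintro ⟨h1, h2⟩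
      obtain ⟨σ, rfl⟩ := ins_surj h2
      exact ⟨σ, (inc_ins_last hs p σ).mp h1, rfl⟩
    · rintro ⟨σ, h, rfl⟩
      exact ⟨(inc_ins_last hs p σ).mpr h, ins_self _ _ _⟩
  rw [himg, Set.ncard_image_of_injective _ (fun a b h => ins_inj h)]
  split_ifs with h1 h2
  · subst h1
    have : ¬ (n < s) := by omega
    simp [M, this]
  · simp [M, h1, h2]
  · simp [h1, h2]

lemma M_rec (n s : ℕ) (hs : s ≤ n) : M (n+1) s = ∑ p ∈ Finset.range (s+1), M n p := by
  have h1 : M (n+1) s = ∑ p : Fin (n+1),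
      {σ : Equiv.Perm (Fin (n+1)) | (Av σ ∧ Inc s σ) ∧ σ p = Fin.last n}.ncard := by
    unfold M
    simp only [Set.ncard_eq_toFinset_card']
    rw [Finset.card_eq_sum_card_fiberwise (f := fun σ => σ.symm (Fin.last n)) (t := Finset.univ)
      (by intro x _; simp)]
    refine Finset.sum_congr rfl fun p _ => ?_
    congr 1
    ext σ
    simp only [Finset.mem_filter, Set.mem_toFinset, Set.mem_ofPred_eq, Equiv.symm_apply_eq]
    rw [eq_comm (a := Fin.last n)]
  rw [h1]
  simp only [M_fiber n s hs]
  rw [Fin.sum_univ_castSucc, Finset.sum_range_succ]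
  simp only [Fin.castSucc_ne_last, if_false, if_true, Fin.val_castSucc]
  congr 1
  rw [Fin.sum_univ_eq_sum_range (fun p => if p < s then M n p else 0) n, ← Finset.sum_filter]
  congr 1
  ext x; simp; omega

lemma M_last (n : ℕ) : M (n+1) (n+1) = M (n+1) n := by
  unfold M
  congr 1
  ext σ
  simp only [Set.mem_ofPred_eq, and_congr_right_iff]
  intro _
  constructor
  · intro _ i j hi hij
    have := j.2; rw [Fin.lt_def] at hij; omega
  · intro _ i j hi hij
    have := i.2; omega

lemma M_closed (n : ℕ) : ∀ s ≤ n, (M n s : ℤ) = (n+s).choose s - (n+s).choose (n+1) := by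
  induction n with
  | zero =>
    intro s hs
    obtain rfl : s = 0 := by omega
    have : {σ : Equiv.Perm (Fin 0) | Av σ ∧ Inc 0 σ} = Set.univ := by
      ext σ; simp [Av, Inc]
    simp [M, this, Set.ncard_univ]
  | succ n ih =>
    have key : ∀ s ≤ n, (M (n+1) s : ℤ) = (n+1+s).choose s - (n+1+s).choose (n+1+1) := by
      intro s
      induction s with
      | zero =>
        intro _
        rw [M_rec n 0 (by omega)]
        simp [ih 0 (by omega)]
      | succ s ihs =>
        intro hs
        have h1 : M (n+1) (s+1) = M (n+1) s + M n (s+1) := by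
          rw [M_rec n _ hs, M_rec n s (by omega), Finset.sum_range_succ]
        rw [h1]; push_cast
        rw [ihs (by omega), ih _ hs]
        have e1 : n + 1 + (s+1) = (n+1+s)+1 := by ring
        have e2 : n + (s+1) = n+1+s := by ring
        rw [e1, e2, Nat.choose_succ_succ (n+1+s) s, Nat.choose_succ_succ (n+1+s) (n+1)]
        push_cast; ring
    intro s hs
    rcases Nat.lt_or_ge n s with h | h
    · obtain rfl : s = n+1 := by omega
      rw [M_last, key n le_rfl]
      have e1 : n + 1 + (n+1) = (n+1+n)+1 := by ring
      rw [e1, Nat.choose_succ_succ (n+1+n) n, Nat.choose_succ_succ (n+1+n) (n+1)]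
      push_cast
      have := Nat.choose_symm_of_eq_add (n := n+1+n) (a := n) (b := n+1) (by ring)
      rw [this]; ring
    · exact key s h

lemma card_av (n : ℕ) : {σ : Equiv.Perm (Fin n) | Av σ}.ncard = catalan n := by
  have h1 : {σ : Equiv.Perm (Fin n) | Av σ}.ncard = M n n := by
    unfold M
    congr 1
    ext σ
    simp only [Set.mem_ofPred_eq]
    refine ⟨fun h => ⟨h, ?_⟩, fun h => h.1⟩
    intro i j hi; have := i.2; omega
  rw [h1]
  have h2 := M_closed n n le_rfl
  have h3 := succ_mul_catalan_eq_centralBinom n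
  have h4 := Nat.choose_succ_right_eq (n+n) n
  rw [Nat.centralBinom, two_mul] at h3
  have h5 : n + n - n = n := by omega
  rw [h5] at h4
  have h6 : ((n:ℤ)+1) * (M n n : ℤ) = (n+1) * catalan n := by
    rw [h2]
    zify at h3 h4
    linarith
  have : (M n n : ℤ) = catalan n := mul_left_cancel₀ (by positivity) h6
  exact_mod_cast this
end

def dbl {n : ℕ} (q : Fin n) (σ : Equiv.Perm (Fin n)) : Equiv.Perm (Fin (n+1)) :=
  ins q.succ (σ q).succ σ

lemma sA_val {n : ℕ} (q i : Fin n) :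
    ((q.succ.succAbove i : Fin (n+1)) : ℕ) = if (i : ℕ) ≤ q then (i : ℕ) else i + 1 := by
  simp only [Fin.succAbove, Fin.lt_def, Fin.val_castSucc, Fin.val_succ, Nat.lt_succ_iff]
  split_ifs <;> simp

lemma dbl_val {n : ℕ} (q : Fin n) (σ : Equiv.Perm (Fin n)) (x : Fin (n+1)) :
    ∃ c : Fin n, ((x : ℕ) = q + 1 ∧ c = q ∧ (dbl q σ x : ℕ) = σ q + 1) ∨
      ((x : ℕ) = (if (c : ℕ) ≤ q then (c : ℕ) else c + 1) ∧
        (dbl q σ x : ℕ) = if (σ c : ℕ) ≤ σ q then (σ c : ℕ) else σ c + 1) := by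
  by_cases hx : x = q.succ
  · subst hx
    exact ⟨q, Or.inl ⟨by simp, rfl, by simp [dbl, ins_self]⟩⟩
  · obtain ⟨c, rfl⟩ := Fin.exists_succAbove_eq hx
    refine ⟨c, Or.inr ⟨sA_val _ _, ?_⟩⟩
    rw [dbl, ins_above, sA_val]

lemma dbl_inv {n : ℕ} (q : Fin n) (σ : Equiv.Perm (Fin n)) : ∃ c : Fin (n+1) → Fin n,
    ∀ i j, i < j → dbl q σ j < dbl q σ i → c i < c j ∧ σ (c j) < σ (c i) := by
  choose c hc using dbl_val q σ
  refine ⟨c, fun i j hij h => ?_⟩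
  have hi := hc i
  have hj := hc j
  have h1 : (σ (c i) : ℕ) = σ (c j) ↔ (c i : ℕ) = c j := by
    rw [← Fin.ext_iff, ← Fin.ext_iff]; exact σ.injective.eq_iff
  have h2 : (σ (c i) : ℕ) = σ q ↔ (c i : ℕ) = q := by
    rw [← Fin.ext_iff, ← Fin.ext_iff]; exact σ.injective.eq_iff
  have h3 : (σ (c j) : ℕ) = σ q ↔ (c j : ℕ) = q := by
    rw [← Fin.ext_iff, ← Fin.ext_iff]; exact σ.injective.eq_iff
  clear hc
  simp only [Fin.lt_def, Fin.ext_iff] at *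
  rcases hi with ⟨h4, h5, h6⟩ | ⟨h4, h6⟩ <;> rcases hj with ⟨h7, h8, h9⟩ | ⟨h7, h9⟩
  · omega
  · split_ifs at h7 h9 <;> omega
  · split_ifs at h4 h6 <;> omega
  · split_ifs at h7 h9 h4 h6 <;> omega

lemma av_dbl {n : ℕ} (q : Fin n) (σ : Equiv.Perm (Fin n)) : Av (dbl q σ) ↔ Av σ := by
  constructor
  · intro h i j k hij hjk h1 h2
    refine h (q.succ.succAbove i) (q.succ.succAbove j) (q.succ.succAbove k) ?_ ?_ ?_ ?_ <;>
        simpa [dbl, ins_above]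
  · intro h i j k hij hjk h1 h2
    obtain ⟨c, hc⟩ := dbl_inv q σ
    exact h _ _ _ (hc i j hij h1).1 (hc j k hjk h2).1 (hc i j hij h1).2 (hc j k hjk h2).2

def Q {n : ℕ} (k l : ℕ) (σ : Equiv.Perm (Fin n)) : Prop :=
  ∀ i j : Fin n, k ≤ (σ i : ℕ) → (σ j : ℕ) = σ i + 1 → (σ j : ℕ) < k + l → (j : ℕ) = i + 1

lemma Q_dbl {n k l : ℕ} (q : Fin n) (σ : Equiv.Perm (Fin n)) (hq : (σ q : ℕ) = k + l) :
    Q k (l+2) (dbl q σ) ↔ Q k (l+1) σ := by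
  constructor
  · intro h i j h1 h2 h3
    have := h (q.succ.succAbove i) (q.succ.succAbove j)
    rw [dbl, ins_above, ins_above] at this
    simp only [sA_val] at this
    rw [if_pos (by omega), if_pos (by omega)] at this
    have := this h1 h2 (by omega)
    have hne : i ≠ q := by rintro rfl; omega
    have hne := Fin.val_ne_of_ne hne
    split_ifs at this <;> omega
  · intro h i j h1 h2 h3
    obtain ⟨a, ha⟩ := dbl_val q σ i
    obtain ⟨b, hb⟩ := dbl_val q σ j
    have e1 : (σ a : ℕ) = σ q → a = q := fun h => σ.injective (Fin.ext h)
    have hab := h a b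
    have haq : (σ a : ℕ) = σ q ↔ (a : ℕ) = q := by
      rw [← Fin.ext_iff, ← Fin.ext_iff]; exact σ.injective.eq_iff
    rcases ha with ⟨h4, h5, h6⟩ | ⟨h4, h6⟩ <;> rcases hb with ⟨h7, h8, h9⟩ | ⟨h7, h9⟩
    · omega
    · split_ifs at * <;> omega
    · have : a = q := by apply e1; split_ifs at * <;> omega
      subst this
      simp at h4; omega
    · split_ifs at h4 h6 h7 h9 <;> omega

lemma card_Q (l : ℕ) : ∀ n k : ℕ, k + l + 1 ≤ n →
    {σ : Equiv.Perm (Fin n) | Av σ ∧ Q k (l+1) σ}.ncard = catalan (n - l) := by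
  induction l with
  | zero =>
    intro n k _
    rw [Nat.sub_zero, ← card_av]
    congr 1
    ext σ
    simp only [Set.mem_ofPred_eq, and_iff_left_iff_imp]
    intro _ i j h1 h2 h3
    omega
  | succ l ih =>
    intro n k h
    obtain ⟨n, rfl⟩ : ∃ m, n = m + 1 := ⟨n-1, by omega⟩
    rw [show n + 1 - (l+1) = n - l by omega, ← ih n k (by omega)]
    let κ : Fin n := ⟨k + l, by omega⟩
    have hinj : Function.Injective (fun σ : Equiv.Perm (Fin n) => dbl (σ.symm κ) σ) := by
      intro σ σ' he
      simp only [dbl, Equiv.apply_symm_apply] at he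
      have : (σ.symm κ).succ = (σ'.symm κ).succ := by
        apply (ins (σ.symm κ).succ κ.succ σ).injective
        rw [ins_self]
        rw [he, ins_self]
      rw [this] at he
      exact ins_inj he
    rw [← Set.ncard_image_of_injective _ hinj]
    congr 1
    ext σ'
    constructor
    · rintro ⟨h1, h2⟩
      have hp := h2 (σ'.symm κ.castSucc) (σ'.symm κ.succ) (by simp [κ]) (by simp)
        (by simp [κ]; omega)
      have hlt : ((σ'.symm κ.castSucc : Fin (n+1)) : ℕ) < n := by
        have := (σ'.symm κ.succ).2; omega
      let q : Fin n := ⟨_, hlt⟩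
      have hqs : q.succ = σ'.symm κ.succ := by ext; simp [q, hp]
      have hqc : q.castSucc = σ'.symm κ.castSucc := by ext; simp [q]
      have hs : σ' q.succ = κ.succ := by rw [hqs]; simp
      obtain ⟨σ, hins⟩ := ins_surj hs
      have hσ : σ q = κ := by
        have h3 := ins_above q.succ κ.succ σ q
        have e : q.succ.succAbove q = q.castSucc := by simp
        rw [hins, e, hqc, Equiv.apply_symm_apply] at h3
        have e2 : κ.succ.succAbove κ = κ.castSucc := by simp
        rw [← e2] at h3
        exact (Fin.succAbove_right_injective h3).symm
      have hq : σ.symm κ = q := by rw [← hσ]; simp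
      have hd : σ' = dbl (σ.symm κ) σ := by
        rw [← hins, hq, dbl, hσ]
      have h1' : Av (dbl (σ.symm κ) σ) := hd ▸ h1
      have h2' : Q k (l+1+1) (dbl (σ.symm κ) σ) := hd ▸ h2
      exact ⟨σ, ⟨(av_dbl _ _).mp h1', (Q_dbl _ _ (by simp [κ])).mp h2'⟩, hd.symm⟩
    · rintro ⟨σ, ⟨h1, h2⟩, rfl⟩
      exact ⟨(av_dbl _ _).mpr h1, (Q_dbl _ _ (by simp [κ])).mpr h2⟩

lemma cat_step (n : ℕ) : (n+2) * catalan (n+1) = (4*n+2) * catalan n := by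
  have h1 := succ_mul_catalan_eq_centralBinom n
  have h2 := succ_mul_catalan_eq_centralBinom (n+1)
  have h3 := Nat.succ_mul_centralBinom_succ n
  rw [← h1, ← h2] at h3
  have : (n+1) * ((n+2) * catalan (n+1)) = (n+1) * ((4*n+2) * catalan n) := by
    calc _ = (n+1) * ((n+1+1) * catalan (n+1)) := by ring
      _ = _ := h3
      _ = _ := by ring
  exact Nat.eq_of_mul_eq_mul_left (by omega) this

lemma cat_pos (n : ℕ) : 0 < catalan n := by
  have h1 := succ_mul_catalan_eq_centralBinom n
  have := Nat.centralBinom_pos n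
  rcases Nat.eq_zero_or_pos (catalan n) with h | h
  · rw [h] at h1; omega
  · exact h

lemma cat_succ_le (n : ℕ) : catalan (n+1) ≤ 4 * catalan n := by
  have := cat_step n
  have := cat_pos n
  nlinarith

-- log convexity step
lemma cat_conv {i j : ℕ} (h : i ≤ j) : catalan (i+1) * catalan j ≤ catalan i * catalan (j+1) := by
  have hi := cat_step i
  have hj := cat_step j
  have h1 : (i+2)*(j+2) * (catalan (i+1) * catalan j) = (4*i+2)*(j+2) * (catalan i * catalan j) := by
    calc _ = ((i+2) * catalan (i+1)) * ((j+2) * catalan j) := by ring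
      _ = _ := by rw [hi]; ring
  have h2 : (i+2)*(j+2) * (catalan i * catalan (j+1)) = (i+2)*(4*j+2) * (catalan i * catalan j) := by
    calc _ = ((i+2) * catalan i) * ((j+2) * catalan (j+1)) := by ring
      _ = _ := by rw [hj]; ring
  have h3 : (4*i+2)*(j+2) ≤ (i+2)*(4*j+2) := by nlinarith
  have hp : 0 < (i+2)*(j+2) := by positivity
  refine (Nat.mul_le_mul_left_iff hp).mp ?_
  rw [h1, h2]
  exact Nat.mul_le_mul_right _ h3

lemma cat_mono_aux (d : ℕ) : ∀ i j : ℕ, i + d ≤ j + 1 → 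
    catalan (i+d) * catalan j ≤ catalan i * catalan (j+d) := by
  induction d with
  | zero => intro i j _; simp
  | succ d ih =>
    intro i j h
    calc catalan (i+(d+1)) * catalan j = catalan (i+d+1) * catalan j := by rfl
      _ ≤ catalan (i+d) * catalan (j+1) := cat_conv (by omega)
      _ ≤ catalan i * catalan (j+1+d) := ih i (j+1) (by omega)
      _ = _ := by rw [show j+1+d = j+(d+1) by ring]

lemma cat_bound_aux {i j : ℕ} (h : i ≤ j) : (i+1) * (catalan i * catalan j) ≤ catalan (i+j+1) := by
  rw [catalan_succ, Fin.sum_univ_eq_sum_range (fun t => catalan t * catalan (i+j-t)) (i+j).succ]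
  calc _ = ∑ t ∈ Finset.range (i+1), catalan i * catalan j := by simp
    _ ≤ ∑ t ∈ Finset.range (i+1), catalan t * catalan (i+j-t) := by
      refine Finset.sum_le_sum fun t ht => ?_
      have ht : t ≤ i := by simpa [Nat.lt_succ_iff] using ht
      have := cat_mono_aux (i-t) t j (by omega)
      rwa [show t + (i-t) = i by omega, show j + (i-t) = i+j-t by omega] at this
    _ ≤ _ := by
      refine Finset.sum_le_sum_of_subset ?_
      intro x; simp; omega

lemma cat_bound (i j : ℕ) : (min i j+1) * (catalan i * catalan j) ≤ 4 * catalan (i+j) := by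
  refine le_trans ?_ (cat_succ_le (i+j))
  rcases le_total i j with h | h
  · rw [min_eq_left h]; exact cat_bound_aux h
  · rw [min_eq_right h, mul_comm (catalan i), add_comm i]; exact cat_bound_aux h

lemma cat_ratio1 : Filter.Tendsto (fun n : ℕ => (catalan n : ℝ) / catalan (n+1)) Filter.atTop
    (nhds (1/4)) := by
  have h : ∀ n : ℕ, (catalan n : ℝ) / catalan (n+1) = 1/4 + (3/8) * (1 / ((n:ℝ) + 1/2)) := by
    intro n
    have h1 : ((n:ℝ)+2) * catalan (n+1) = (4*n+2) * catalan n := by exact_mod_cast cat_step n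
    have h2 : (0:ℝ) < catalan (n+1) := by exact_mod_cast cat_pos _
    have h3 : (0:ℝ) < (n:ℝ)+1/2 := by positivity
    rw [div_eq_iff h2.ne']
    field_simp
    nlinarith
  simp_rw [h]
  have : Filter.Tendsto (fun n : ℕ => (1:ℝ) / ((n:ℝ) + 1/2)) Filter.atTop (nhds 0) := by
    refine Filter.Tendsto.const_div_atTop ?_ _
    exact Filter.tendsto_atTop_add_const_right _ _ tendsto_natCast_atTop_atTop
  simpa using (this.const_mul (3/8:ℝ)).const_add (1/4:ℝ)

lemma cat_ratio (d : ℕ) : Filter.Tendsto (fun n : ℕ => (catalan n : ℝ) / catalan (n+d)) Filter.atTop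
    (nhds ((1/4)^d)) := by
  induction d with
  | zero =>
    have : ∀ n, (catalan n : ℝ) ≠ 0 := fun n => by exact_mod_cast (cat_pos n).ne'
    simp [this]
  | succ d ih =>
    have h := ih.mul (cat_ratio1.comp (Filter.tendsto_add_atTop_nat d))
    rw [pow_succ]
    refine h.congr fun n => ?_
    have : (catalan (n+d) : ℝ) ≠ 0 := by exact_mod_cast (cat_pos _).ne'
    simp only [Function.comp]
    rw [div_mul_div_cancel₀ this]; rfl

lemma cluster_iff {n l k a : ℕ} {σ : Equiv.Perm (Fin n)} (h : ClusterAt l k a σ) (i : Fin n) :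
    (a ≤ (i:ℕ)+1 ∧ (i:ℕ)+1 < a + l) ↔ (k ≤ (σ i:ℕ)+1 ∧ (σ i:ℕ)+1 < k + l) := by
  unfold ClusterAt at h
  rw [Finset.ext_iff] at h
  have := h ((σ i : ℕ)+1)
  rw [Finset.mem_Ico] at this
  rw [← this]
  simp only [Finset.mem_image, Finset.mem_filter, Finset.mem_univ, true_and]
  constructor
  · intro hi; exact ⟨i, hi, rfl⟩
  · rintro ⟨j, hj, he⟩
    have : j = i := σ.injective (Fin.ext (by omega))
    exact this ▸ hj

lemma cluster_of_iff {n l k a : ℕ} {σ : Equiv.Perm (Fin n)} (hk : 1 ≤ k) (hkn : k + l ≤ n + 1)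
    (h : ∀ i : Fin n, (a ≤ (i:ℕ)+1 ∧ (i:ℕ)+1 < a + l) ↔ (k ≤ (σ i:ℕ)+1 ∧ (σ i:ℕ)+1 < k + l)) :
    ClusterAt l k a σ := by
  unfold ClusterAt
  ext v
  simp only [Finset.mem_image, Finset.mem_filter, Finset.mem_univ, true_and, Finset.mem_Ico]
  constructor
  · rintro ⟨i, hi, rfl⟩
    exact (h i).mp hi
  · intro hv
    refine ⟨σ.symm ⟨v-1, by omega⟩, (h _).mpr ?_, ?_⟩
    · simp; omega
    · simp; omega

lemma Q_cluster {n l K : ℕ} (hl : 1 ≤ l) (hK : K + l ≤ n) {σ : Equiv.Perm (Fin n)} (h : Q K l σ) :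
    ∃ a : ℕ, 1 ≤ a ∧ a ≤ n - l + 1 ∧ ClusterAt l (K+1) a σ := by
  let q : Fin n := σ.symm ⟨K, by omega⟩
  have hq : (σ q : ℕ) = K := by simp [q]
  have key : ∀ i : ℕ, ∀ hi : i < l, ((σ.symm ⟨K+i, by omega⟩ : Fin n) : ℕ) = q + i := by
    intro i
    induction i with
    | zero => intro _; rfl
    | succ i ih =>
      intro hi
      have h1 := ih (by omega)
      have := h (σ.symm ⟨K+i, by omega⟩) (σ.symm ⟨K+(i+1), by omega⟩) (by simp) (by simp; omega)
        (by simp; omega)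
      omega
  have key2 : ∀ i : Fin n, ∀ t < l, (i : ℕ) = q + t → (σ i : ℕ) = K + t := by
    intro i t ht hi
    have : i = σ.symm ⟨K+t, by omega⟩ := by
      ext; rw [hi, key t ht]
    rw [this]; simp
  have key3 : ∀ i : Fin n, ∀ t < l, (σ i : ℕ) = K + t → (i : ℕ) = q + t := by
    intro i t ht hi
    rw [← key t ht]
    congr 1
    rw [Equiv.eq_symm_apply]
    exact Fin.ext hi
  refine ⟨q + 1, by omega, ?_, ?_⟩
  · have h1 := key (l-1) (by omega)
    have h2 := (σ.symm ⟨K+(l-1), by omega⟩).2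
    omega
  · refine cluster_of_iff (by omega) (by omega) fun i => ?_
    constructor
    · intro hi
      have := key2 i (i - q) (by omega) (by omega)
      omega
    · intro hi
      have := key3 i (σ i - K) (by omega) (by omega)
      omega

def Spl {n : ℕ} (K : ℕ) (σ : Equiv.Perm (Fin n)) : Prop := ∀ i : Fin n, (i : ℕ) < K → (σ i : ℕ) < K

lemma cluster_dich {n l K a : ℕ} (hK : K + l ≤ n) (ha : 1 ≤ a) (han : a + l ≤ n + 1)
    {σ : Equiv.Perm (Fin n)}
    (hav : Av σ) (h : ClusterAt l (K+1) a σ) : Q K l σ ∨ Spl K σ := by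
  have hc := cluster_iff h
  by_cases hinv : ∃ i j : Fin n, i < j ∧ σ j < σ i ∧ (a ≤ (i:ℕ)+1 ∧ (i:ℕ)+1 < a + l) ∧
      (a ≤ (j:ℕ)+1 ∧ (j:ℕ)+1 < a + l)
  · right
    obtain ⟨i, j, hij, hs, hi, hj⟩ := hinv
    have hi' := (hc i).mp hi
    have hj' := (hc j).mp hj
    have hiff : ∀ x : Fin n, (x : ℕ) < a - 1 ↔ (σ x : ℕ) < K := by
      intro x
      have hx := hc x
      constructor
      · intro h1
        by_contra h2
        refine hav x i j ?_ hij ?_ hs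
        · rw [Fin.lt_def]; omega
        · rw [Fin.lt_def]; omega
      · intro h1
        by_contra h2
        refine hav i j x hij ?_ hs ?_
        · rw [Fin.lt_def]; omega
        · rw [Fin.lt_def]; omega
    have hcard : a - 1 = K := by
      have c1 : (Finset.univ.filter fun x : Fin n => (x:ℕ) < a - 1).card = a - 1 := by
        rw [Fin.card_filter_val_lt]; omega
      have c2 : (Finset.univ.filter fun x : Fin n => (x:ℕ) < K).card = K := by
        rw [Fin.card_filter_val_lt]; omega
      rw [← c1]
      conv_rhs => rw [← c2]
      refine Finset.card_bij (fun x _ => σ x) ?_ ?_ ?_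
      · intro x hx; simpa [hiff] using hx
      · intro x _ y _ hxy; exact σ.injective hxy
      · intro y hy
        refine ⟨σ.symm y, ?_, by simp⟩
        simpa [hiff] using hy
    intro x hx
    exact (hiff x).mp (by omega)
  · left
    push Not at hinv
    intro i j h1 h2 h3
    have hi := (hc i).mpr (by omega)
    have hj := (hc j).mpr (by omega)
    have hlt : i < j := by
      by_contra hn
      have hne : j ≠ i := by rintro rfl; omega
      have := hinv j i (lt_of_le_of_ne (not_lt.mp hn) hne) (by rw [Fin.lt_def]; omega) hj
      omega
    by_contra hne
    rw [Fin.lt_def] at hlt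
    let m : Fin n := ⟨i+1, by omega⟩
    have hm : (m : ℕ) = i + 1 := rfl
    have e1 : ¬ σ m < σ i := by
      intro hh
      have := hinv i m (by rw [Fin.lt_def]; omega) hh hi
      omega
    have e2 : ¬ σ j < σ m := by
      intro hh
      have := hinv m j (by rw [Fin.lt_def]; omega) hh (by omega)
      omega
    have e3 : σ m ≠ σ i := fun hh => by have := σ.injective hh; rw [this] at hm; omega
    have e4 : σ m ≠ σ j := fun hh => by have := σ.injective hh; rw [this] at hm; omega
    rw [Ne, Fin.ext_iff] at e3 e4
    rw [Fin.lt_def] at e1 e2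
    omega

lemma card_spl (p q : ℕ) :
    {σ : Equiv.Perm (Fin (p+q)) | Av σ ∧ Spl p σ}.ncard ≤ catalan p * catalan q := by
  rw [← card_av, ← card_av, ← Set.ncard_prod]
  let F : Equiv.Perm (Fin p) × Equiv.Perm (Fin q) → Equiv.Perm (Fin (p+q)) := fun x =>
    finSumFinEquiv.permCongr (Equiv.Perm.sumCongr x.1 x.2)
  have hF1 : ∀ x i, F x (Fin.castAdd q i) = Fin.castAdd q (x.1 i) := by
    intro x i; simp [F, Equiv.permCongr_apply]
  have hF2 : ∀ x i, F x (Fin.natAdd p i) = Fin.natAdd p (x.2 i) := by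
    intro x i; simp [F, Equiv.permCongr_apply]
  refine le_trans (Set.ncard_le_ncard (t := F '' _) ?_ (Set.toFinite _))
    (Set.ncard_image_le (Set.toFinite _))
  rintro σ ⟨h1, h2⟩
  have hr : finSumFinEquiv.symm.permCongr σ ∈ (Equiv.Perm.sumCongrHom (Fin p) (Fin q)).range := by
    apply Equiv.Perm.mem_sumCongrHom_range_of_perm_mapsTo_inl
    rintro _ ⟨i, rfl⟩
    have := h2 (Fin.castAdd q i) (by simp)
    refine ⟨⟨_, this⟩, ?_⟩
    simp only [Equiv.permCongr_apply, Equiv.symm_symm, finSumFinEquiv_apply_left]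
    rw [Equiv.eq_symm_apply, finSumFinEquiv_apply_left]
    rfl
  obtain ⟨x, hx⟩ := hr
  have hxF : F x = σ := by
    have h3 : Equiv.Perm.sumCongr x.1 x.2 = finSumFinEquiv.symm.permCongr σ := hx
    simp only [F, h3]
    ext i; simp [Equiv.permCongr_apply]
  refine ⟨x, ⟨?_, ?_⟩, hxF⟩
  · intro i j k a b c d
    apply h1 (Fin.castAdd q i) (Fin.castAdd q j) (Fin.castAdd q k)
    · exact a
    · exact b
    · rw [← hxF, hF1, hF1]; exact c
    · rw [← hxF, hF1, hF1]; exact d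
  · intro i j k a b c d
    apply h1 (Fin.natAdd p i) (Fin.natAdd p j) (Fin.natAdd p k)
    · simpa using a
    · simpa using b
    · rw [← hxF, hF2, hF2]; simpa using c
    · rw [← hxF, hF2, hF2]; simpa using d

lemma card_spl' {n K : ℕ} (h : K ≤ n) :
    {σ : Equiv.Perm (Fin n) | Av σ ∧ Spl K σ}.ncard ≤ catalan K * catalan (n-K) := by
  obtain ⟨q, rfl⟩ := Nat.exists_eq_add_of_le h
  rw [Nat.add_sub_cancel_left]
  exact card_spl K q

lemma avoid321 (n : ℕ) : AvoidSet n perm321 = {σ | Av σ} := by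
  ext σ
  simp only [AvoidSet, Avoids, Contains, Set.mem_ofPred_eq, Av]
  constructor
  · intro h i j k hij hjk h1 h2
    apply h
    refine ⟨![i, j, k], ?_, ?_⟩
    · rw [Fin.strictMono_iff_lt_succ]
      intro x; fin_cases x <;> simpa
    · have h3 := h2.trans h1
      intro x y
      fin_cases x <;> fin_cases y <;> simp [perm321, h1, h2, h3, h1.le, h2.le, h3.le]
  · rintro h ⟨f, hf, hp⟩
    refine h (f 0) (f 1) (f 2) (hf (by decide)) (hf (by decide)) ?_ ?_
    · rw [hp]; decide
    · rw [hp]; decide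

lemma avoid123 (n : ℕ) (σ : Equiv.Perm (Fin n)) :
    σ ∈ AvoidSet n perm123 ↔ Av (Fin.revPerm.trans σ) := by
  simp only [AvoidSet, Avoids, Contains, Set.mem_ofPred_eq, Av]
  constructor
  · intro h i j k hij hjk h1 h2
    apply h
    simp only [Equiv.trans_apply, Fin.revPerm_apply] at h1 h2
    refine ⟨![k.rev, j.rev, i.rev], ?_, ?_⟩
    · rw [Fin.strictMono_iff_lt_succ]
      intro x; fin_cases x <;> simpa
    · have h3 := h2.trans h1
      intro x y
      fin_cases x <;> fin_cases y <;> simp [perm123, h1, h2, h3, h1.le, h2.le, h3.le]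
  · rintro h ⟨f, hf, hp⟩
    refine h (f 2).rev (f 1).rev (f 0).rev ?_ ?_ ?_ ?_
    · simpa using hf (show (1 : Fin 3) < 2 by decide)
    · simpa using hf (show (0 : Fin 3) < 1 by decide)
    · simp only [Equiv.trans_apply, Fin.revPerm_apply, Fin.rev_rev]
      rw [hp]; decide
    · simp only [Equiv.trans_apply, Fin.revPerm_apply, Fin.rev_rev]
      rw [hp]; decide

lemma event_rev {n l k : ℕ} (hl : 1 ≤ l) (hln : l ≤ n) (hk : 1 ≤ k) (hkn : k + l ≤ n + 1)
    {σ : Equiv.Perm (Fin n)}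
    (h : σ ∈ ClusterEvent n l k) : Fin.revPerm.trans σ ∈ ClusterEvent n l k := by
  obtain ⟨a, h1, h2, h3⟩ := h
  refine ⟨n + 2 - l - a, by omega, by omega, cluster_of_iff hk hkn fun i => ?_⟩
  have := cluster_iff h3 i.rev
  rw [Equiv.trans_apply, Fin.revPerm_apply, ← this, Fin.val_rev]
  have := i.2
  omega

lemma rev_inj (n : ℕ) : Function.Injective
    (fun σ : Equiv.Perm (Fin n) => Fin.revPerm.trans σ) := by
  intro σ σ' h
  ext i : 1
  have := congrArg (fun f : Equiv.Perm (Fin n) => f i.rev) h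
  simpa using this

lemma rev_rev' {n : ℕ} (σ : Equiv.Perm (Fin n)) :
    Fin.revPerm.trans (Fin.revPerm.trans σ) = σ := by
  ext i; simp

lemma card123 (n : ℕ) : (AvoidSet n perm123).ncard = (AvoidSet n perm321).ncard := by
  rw [← Set.ncard_image_of_injective _ (rev_inj n), avoid321]
  congr 1
  ext σ
  constructor
  · rintro ⟨σ, h, rfl⟩; exact (avoid123 n σ).mp h
  · intro h
    refine ⟨Fin.revPerm.trans σ, (avoid123 n _).mpr ?_, rev_rev' σ⟩
    rw [rev_rev']; exact h

lemma card123' {n l k : ℕ} (hl : 1 ≤ l) (hln : l ≤ n) (hk : 1 ≤ k) (hkn : k + l ≤ n + 1) :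
    (ClusterEvent n l k ∩ AvoidSet n perm123).ncard =
      (ClusterEvent n l k ∩ AvoidSet n perm321).ncard := by
  rw [← Set.ncard_image_of_injective _ (rev_inj n), avoid321]
  congr 1
  ext σ
  constructor
  · rintro ⟨σ, h, rfl⟩; exact ⟨event_rev hl hln hk hkn h.1, (avoid123 n σ).mp h.2⟩
  · intro h
    refine ⟨Fin.revPerm.trans σ, ⟨event_rev hl hln hk hkn h.1, (avoid123 n _).mpr ?_⟩, rev_rev' σ⟩
    rw [rev_rev']; exact h.2

lemma count_lower {n l k : ℕ} (hl : 1 ≤ l) (hk : 1 ≤ k) (hkn : k + l ≤ n + 1) :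
    catalan (n - (l - 1)) ≤ (ClusterEvent n l k ∩ AvoidSet n perm321).ncard := by
  rw [← card_Q (l-1) n (k-1) (by omega), avoid321]
  refine Set.ncard_le_ncard ?_ (Set.toFinite _)
  rintro σ ⟨h1, h2⟩
  rw [show l - 1 + 1 = l by omega] at h2
  have := Q_cluster hl (by omega) h2
  rw [show k - 1 + 1 = k by omega] at this
  exact ⟨this, h1⟩

lemma count_upper {n l k : ℕ} (hl : 1 ≤ l) (hk : 1 ≤ k) (hkn : k + l ≤ n + 1) :
    (ClusterEvent n l k ∩ AvoidSet n perm321).ncard ≤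
      catalan (n - (l - 1)) + catalan (k-1) * catalan (n - (k-1)) := by
  refine le_trans ?_ (Nat.add_le_add (card_Q (l-1) n (k-1) (by omega)).le
    (card_spl' (n := n) (K := k-1) (by omega)))
  refine le_trans ?_ (Set.ncard_union_le _ _)
  refine Set.ncard_le_ncard ?_ (Set.toFinite _)
  rw [avoid321]
  rintro σ ⟨⟨a, h1, h2, h3⟩, h4⟩
  rw [show l - 1 + 1 = l by omega]
  rw [show k = k - 1 + 1 by omega] at h3
  rcases cluster_dich (by omega) h1 (by omega) h4 h3 with h | h
  · exact Or.inl ⟨h4, h⟩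
  · exact Or.inr ⟨h4, h⟩

lemma main321 (l : ℕ) (hl : 2 ≤ l) (k : ℕ → ℕ) (hk : ∀ n : ℕ, 1 ≤ k n ∧ k n ≤ n - l + 1)
    (hktop : Filter.Tendsto (fun n : ℕ => k n) Filter.atTop Filter.atTop)
    (hnktop : Filter.Tendsto (fun n : ℕ => n - k n) Filter.atTop Filter.atTop) :
    Filter.Tendsto
      (fun n : ℕ => ((ClusterEvent n l (k n) ∩ AvoidSet n perm321).ncard : ℝ) /
        ((AvoidSet n perm321).ncard : ℝ)) Filter.atTop
      (nhds (1 / 4 ^ (l - 1))) := by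
  have hA : ∀ n, (AvoidSet n perm321).ncard = catalan n := by
    intro n; rw [avoid321, card_av]
  have hlow : Filter.Tendsto (fun n : ℕ => (catalan (n - (l-1)) : ℝ) / catalan n) Filter.atTop
      (nhds (1 / 4 ^ (l - 1))) := by
    have := (cat_ratio (l-1)).comp (Filter.tendsto_sub_atTop_nat (l-1))
    rw [one_div_pow] at this
    refine this.congr' ?_
    filter_upwards [Filter.eventually_ge_atTop l] with n hn
    simp only [Function.comp]
    rw [Nat.sub_add_cancel (by omega)]
  have herr : Filter.Tendsto (fun n : ℕ => (4:ℝ) / ((min (k n - 1) (n - (k n - 1)) : ℕ) + 1 : ℝ))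
      Filter.atTop (nhds 0) := by
    refine Filter.Tendsto.const_div_atTop ?_ _
    refine Filter.tendsto_atTop_add_const_right _ _ (tendsto_natCast_atTop_atTop.comp ?_)
    rw [Filter.tendsto_atTop] at hktop hnktop ⊢
    intro b
    filter_upwards [hktop (b+1), hnktop b] with n h1 h2
    rw [le_min_iff]; omega
  have hup := hlow.add herr
  rw [add_zero] at hup
  refine tendsto_of_tendsto_of_tendsto_of_le_of_le' hlow hup ?_ ?_
  · filter_upwards [Filter.eventually_ge_atTop l] with n hn
    have := hk n
    rw [hA]
    have h1 := count_lower (n := n) (l := l) (k := k n) (by omega) (by omega) (by omega)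
    gcongr
  · filter_upwards [Filter.eventually_ge_atTop l] with n hn
    have := hk n
    rw [hA]
    have h1 := count_upper (n := n) (l := l) (k := k n) (by omega) (by omega) (by omega)
    have h2 := cat_bound (k n - 1) (n - (k n - 1))
    rw [show k n - 1 + (n - (k n - 1)) = n by omega] at h2
    have hp : (0:ℝ) < catalan n := by exact_mod_cast cat_pos n
    have h3 : (catalan (k n - 1) : ℝ) * catalan (n - (k n - 1)) / catalan n ≤
        (4:ℝ) / ((min (k n - 1) (n - (k n - 1)) : ℕ) + 1 : ℝ) := by
      rw [div_le_div_iff₀ hp (by positivity)]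
      have : (((min (k n - 1) (n - (k n - 1)) : ℕ) : ℝ) + 1) *
        ((catalan (k n - 1) : ℝ) * catalan (n - (k n - 1))) ≤ 4 * catalan n := by exact_mod_cast h2
      linarith
    refine le_trans ?_ (add_le_add_right h3 _)
    rw [← add_div]
    gcongr
    exact_mod_cast h1

/-- for `τ ∈ {123, 321}` and `k_n → ∞`, `n - k_n → ∞`, the limiting
probability of `A^{(n)}_{l;k_n}` equals `1/4^{l-1}`. -/
theorem avoid123or321_cluster_limit_interior (τ : Equiv.Perm (Fin 3))
    (hτ : τ = perm123 ∨ τ = perm321)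
    (l : ℕ) (hl : 2 ≤ l) (k : ℕ → ℕ) (hk : ∀ n : ℕ, 1 ≤ k n ∧ k n ≤ n - l + 1)
    (hktop : Filter.Tendsto (fun n : ℕ => k n) Filter.atTop Filter.atTop)
    (hnktop : Filter.Tendsto (fun n : ℕ => n - k n) Filter.atTop Filter.atTop) :
    Filter.Tendsto
      (fun n : ℕ => ((ClusterEvent n l (k n) ∩ AvoidSet n τ).ncard : ℝ) /
        ((AvoidSet n τ).ncard : ℝ)) Filter.atTop
      (nhds (1 / 4 ^ (l - 1))) := by
  rcases hτ with rfl | rfl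
  · refine (main321 l hl k hk hktop hnktop).congr' ?_
    filter_upwards [Filter.eventually_ge_atTop l] with n hn
    have := hk n
    rw [card123, card123' (by omega) hn (by omega) (by omega)]
  · exact main321 l hl k hk hktop hnktop
end
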